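/- There exist a symmetric positive definite real d×d matrix g⁰ and a constant C > 0 (depending only on a, μ, d) with the following property. For each ε > 0 let 𝔸_ε be the bounded self-adjoint operator on L²(ℝ^d; ℂ) given by (𝔸_ε u)(x) = ε^{-d-2} ∫_{ℝ^d} a((x-y)/ε) μ(x/ε, y/ε) (u(x) - u(y)) dy, and let R⁰ be the bounded operator on L²(ℝ^d; ℂ) acting as the Fourier multiplier with symbol (⟨g⁰ξ, ξ⟩ + 1)^{-1} (i.e. R⁰ = (𝔸⁰ + I)^{-1} where 𝔸⁰ = -div g⁰∇ with domain H²(ℝ^d)). Then for every ε > 0 the operator norm satisfies ‖(𝔸_ε + I)^{-1} − R⁰‖_{L²(ℝ^d)→L²(ℝ^d)} ≤ C ε. -/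

import Mathlib

open MeasureTheory Real
open scoped ENNReal

noncomputable section

abbrev Euc (d : ℕ) := EuclideanSpace ℝ (Fin d)

/-- The vector of `ℝ^d` with integer coordinates `m`. -/
def intVec {d : ℕ} (m : Fin d → ℤ) : Euc d :=
  (WithLp.equiv 2 (Fin d → ℝ)).symm fun i => (m i : ℝ)

namespace NonlocalHomogenization

set_option linter.unusedSectionVars false

local instance : MeasureSpace UnitAddCircle := ⟨AddCircle.haarAddCircle⟩

local instance : Measure.IsAddHaarMeasure (volume : Measure UnitAddCircle) :=
  inferInstanceAs (Measure.IsAddHaarMeasure AddCircle.haarAddCircle)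

local instance : IsProbabilityMeasure (volume : Measure UnitAddCircle) :=
  inferInstanceAs (IsProbabilityMeasure AddCircle.haarAddCircle)

section Operator

variable {Z G : Type*} [AddCommGroup Z] [MeasurableSpace Z] [MeasurableNeg Z]
  [AddCommGroup G] [MeasurableSpace G] [MeasurableSub₂ G] [MeasurableAdd₂ G] [MeasurableNeg G]
  {ρ : Measure Z} [IsProbabilityMeasure ρ] [ρ.IsNegInvariant]
  {m : Measure G} [SFinite m] [m.IsAddLeftInvariant]
  {j : Z →+ G} {w : G → G → ℝ}

/-- The change of variables exchanging `x` and `y = x - j z`. -/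
def flip (j : Z →+ G) (p : Z × G) : Z × G := (-p.1, p.2 - j p.1)

@[simp] lemma flip_fst (p : Z × G) : (flip j p).1 = -p.1 := rfl

@[simp] lemma flip_snd (p : Z × G) : (flip j p).2 = p.2 - j p.1 := rfl

lemma flip_flip (p : Z × G) : flip j (flip j p) = p := by
  ext <;> simp

lemma measurable_flip (hj : Measurable j) : Measurable (flip j) := by
  unfold flip
  exact (measurable_fst.neg).prodMk (measurable_snd.sub (hj.comp measurable_fst))

lemma measurePreserving_flip (hj : Measurable j) :
    MeasurePreserving (flip j) (ρ.prod m) (ρ.prod m) := by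
  refine MeasurePreserving.skew_product (f := fun z => -z) (g := fun z x => x - j z)
    (Measure.measurePreserving_neg ρ) ?_ ?_
  · exact measurable_snd.sub (hj.comp measurable_fst)
  · refine .of_forall fun z => ?_
    have := (measurePreserving_add_left m (-(j z))).map_eq
    simpa [sub_eq_neg_add] using this

lemma integral_comp_flip {F : Type*} [NormedAddCommGroup F] [NormedSpace ℝ F] (hj : Measurable j)
    (f : Z × G → F) :
    ∫ p, f (flip j p) ∂(ρ.prod m) = ∫ p, f p ∂(ρ.prod m) := by
  refine (measurePreserving_flip hj).integral_comp ?_ f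
  exact (MeasurableEquiv.mk ⟨flip j, flip j, flip_flip, flip_flip⟩ (measurable_flip hj)
    (measurable_flip hj)).measurableEmbedding

lemma integrable_comp_flip {F : Type*} [NormedAddCommGroup F] (hj : Measurable j)
    {f : Z × G → F} (hf : Integrable f (ρ.prod m)) :
    Integrable (fun p => f (flip j p)) (ρ.prod m) :=
  (measurePreserving_flip hj).integrable_comp_of_integrable hf

variable {𝕜 : Type*} [RCLike 𝕜]

/-- The nonlocal operator with jump measure `ρ`, transported along `j`, and conductance `w`. -/
def nonlocalOp (ρ : Measure Z) (j : Z →+ G) (w : G → G → ℝ) (u : G → 𝕜) (x : G) : 𝕜 :=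
  ∫ z, w x (x - j z) • (u x - u (x - j z)) ∂ρ

/-- Conductances that are measurable, symmetric, and pinched between `wm` and `wp`. -/
structure IsConductance (w : G → G → ℝ) (wm wp : ℝ) : Prop where
  measurable : Measurable (Function.uncurry w)
  symm : ∀ x y, w x y = w y x
  lower : ∀ x y, wm ≤ w x y
  upper : ∀ x y, w x y ≤ wp
  pos : 0 < wm

namespace IsConductance

variable {wm wp : ℝ} (hw : IsConductance w wm wp)
include hw

lemma nonneg (x y : G) : 0 ≤ w x y := hw.pos.le.trans (hw.lower x y)

lemma norm_le (x y : G) : ‖w x y‖ ≤ wp := by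
  rw [Real.norm_of_nonneg (hw.nonneg x y)]; exact hw.upper x y

lemma measurable_comp (hj : Measurable j) :
    Measurable fun p : Z × G => w p.2 (p.2 - j p.1) :=
  hw.measurable.comp (measurable_snd.prodMk (measurable_snd.sub (hj.comp measurable_fst)))

lemma integrable_smul (hj : Measurable j) {F : Type*} [NormedAddCommGroup F] [NormedSpace ℝ F]
    {μ : Measure (Z × G)} {f : Z × G → F}
    (hf : Integrable f μ) :
    Integrable (fun p => w p.2 (p.2 - j p.1) • f p) μ :=
  hf.bdd_smul wp (hw.measurable_comp hj).aestronglyMeasurable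
    (.of_forall fun _ => hw.norm_le _ _)

lemma integrable_nonlocalOp_mul (hj : Measurable j) {u v : G → 𝕜}
    (h1 : Integrable (fun p : Z × G => u p.2 * v p.2) (ρ.prod m))
    (h2 : Integrable (fun p : Z × G => u (p.2 - j p.1) * v p.2) (ρ.prod m)) :
    Integrable (fun p : Z × G =>
      w p.2 (p.2 - j p.1) • ((u p.2 - u (p.2 - j p.1)) * v p.2)) (ρ.prod m) := by
  refine hw.integrable_smul hj ?_
  simpa only [sub_mul, Pi.sub_apply] using! h1.sub h2

/-- The bilinear form of the nonlocal operator. -/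
theorem integral_nonlocalOp_mul (hj : Measurable j) {u v : G → 𝕜}
    (h1 : Integrable (fun p : Z × G => u p.2 * v p.2) (ρ.prod m))
    (h2 : Integrable (fun p : Z × G => u (p.2 - j p.1) * v p.2) (ρ.prod m)) :
    ∫ x, nonlocalOp ρ j w u x * v x ∂m = (1 / 2 : ℝ) • ∫ p : Z × G, w p.2 (p.2 - j p.1) •
      ((u p.2 - u (p.2 - j p.1)) * (v p.2 - v (p.2 - j p.1))) ∂(ρ.prod m) := by
  have hI := hw.integrable_nonlocalOp_mul (w := w) hj h1 h2
  have e1 : ∫ x, nonlocalOp ρ j w u x * v x ∂m = ∫ p : Z × G,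
      w p.2 (p.2 - j p.1) • ((u p.2 - u (p.2 - j p.1)) * v p.2) ∂(ρ.prod m) := by
    rw [integral_prod_symm _ hI]
    refine integral_congr_ae (.of_forall fun x => ?_)
    simp only [nonlocalOp]
    rw [← integral_mul_const]
    simp only [smul_mul_assoc]
  have e2 : ∫ p : Z × G,
      w p.2 (p.2 - j p.1) • ((u p.2 - u (p.2 - j p.1)) * v p.2) ∂(ρ.prod m) = ∫ p : Z × G,
      w p.2 (p.2 - j p.1) • ((u (p.2 - j p.1) - u p.2) * v (p.2 - j p.1)) ∂(ρ.prod m) := by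
    rw [← integral_comp_flip hj]
    refine integral_congr_ae (.of_forall fun p => ?_)
    simp [hw.symm (p.2 - j p.1) p.2]
  have hI' : Integrable (fun p : Z × G =>
      w p.2 (p.2 - j p.1) • ((u (p.2 - j p.1) - u p.2) * v (p.2 - j p.1))) (ρ.prod m) := by
    refine (integrable_comp_flip hj hI).congr (.of_forall fun p => ?_)
    simp [hw.symm (p.2 - j p.1) p.2]
  have e3 : ∫ p : Z × G, w p.2 (p.2 - j p.1) •
      ((u p.2 - u (p.2 - j p.1)) * (v p.2 - v (p.2 - j p.1))) ∂(ρ.prod m) =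
      (∫ p : Z × G,
      w p.2 (p.2 - j p.1) • ((u p.2 - u (p.2 - j p.1)) * v p.2) ∂(ρ.prod m)) + ∫ p : Z × G,
      w p.2 (p.2 - j p.1) • ((u (p.2 - j p.1) - u p.2) * v (p.2 - j p.1)) ∂(ρ.prod m) := by
    rw [← integral_add hI hI']
    refine integral_congr_ae (.of_forall fun p => ?_)
    simp only [← smul_add]
    congr 1; ring
  rw [e3, ← e2, ← e1, ← two_smul ℝ, smul_smul]
  norm_num

/-- The nonlocal operator is symmetric. -/
theorem integral_nonlocalOp_mul_comm (hj : Measurable j) {u v : G → 𝕜}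
    (h1 : Integrable (fun p : Z × G => u p.2 * v p.2) (ρ.prod m))
    (h2 : Integrable (fun p : Z × G => u (p.2 - j p.1) * v p.2) (ρ.prod m)) :
    ∫ x, nonlocalOp ρ j w u x * v x ∂m = ∫ x, u x * nonlocalOp ρ j w v x ∂m := by
  rw [hw.integral_nonlocalOp_mul hj h1 h2]
  simp only [mul_comm (u _)]
  rw [hw.integral_nonlocalOp_mul hj (by simpa only [mul_comm] using h1)]
  · simp only [mul_comm]
  · refine (integrable_comp_flip hj h2).congr (.of_forall fun p => ?_)
    simp [mul_comm]

end IsConductance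

end Operator

section Torus

variable {d : ℕ}

/-- The flat torus. -/
abbrev Tor (d : ℕ) := UnitAddTorus (Fin d)

/-- The canonical projection onto the torus. -/
def toTor : Euc d →+ Tor d where
  toFun x i := (x i : UnitAddCircle)
  map_zero' := by ext; simp
  map_add' x y := by ext; simp

lemma toTor_apply (x : Euc d) (i : Fin d) : toTor x i = (x i : UnitAddCircle) := rfl

lemma continuous_toTor : Continuous (toTor : Euc d → Tor d) := by
  refine continuous_pi fun i => ?_
  exact (AddCircle.continuous_mk' 1).comp (by fun_prop)

lemma measurable_toTor : Measurable (toTor : Euc d → Tor d) := continuous_toTor.measurable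

@[simp] lemma intVec_apply (n : Fin d → ℤ) (i : Fin d) : intVec n i = (n i : ℝ) := rfl

lemma toTor_intVec (n : Fin d → ℤ) : toTor (intVec n) = 0 := by
  ext i
  rw [toTor_apply, intVec_apply]
  exact (AddCircle.coe_eq_zero_iff 1).2 ⟨n i, by simp⟩

/-- A measurable section of the projection onto the torus. -/
def sec (t : Tor d) : Euc d := WithLp.toLp 2 (UnitAddTorus.measurableEquivPiIoc 0 t).1

lemma measurable_sec : Measurable (sec : Tor d → Euc d) := by
  have h : Measurable (WithLp.toLp 2 : (Fin d → ℝ) → Euc d) := by fun_prop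
  exact h.comp (measurable_subtype_coe.comp
    (UnitAddTorus.measurableEquivPiIoc (0 : Fin d → ℝ)).measurable)

lemma sec_mem (t : Tor d) (i : Fin d) : sec t i ∈ Set.Ioc (0 : ℝ) 1 := by
  simpa [sec] using (UnitAddTorus.measurableEquivPiIoc (0 : Fin d → ℝ) t).2 i

@[simp] lemma toTor_sec (t : Tor d) : toTor (sec t) = t :=
  (UnitAddTorus.measurableEquivPiIoc (0 : Fin d → ℝ)).symm_apply_apply t

lemma exists_intVec_of_toTor_eq {x y : Euc d} (h : toTor x = toTor y) : ∃ n, x = y + intVec n := by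
  have (i : Fin d) : ∃ n : ℤ, x i = y i + n := by
    have h1 : ((x i - y i : ℝ) : UnitAddCircle) = 0 := by
      have := congrFun h i
      rw [toTor_apply, toTor_apply] at this
      rw [AddCircle.coe_sub, this, sub_self]
    obtain ⟨n, hn⟩ := (AddCircle.coe_eq_zero_iff 1).1 h1
    refine ⟨n, ?_⟩
    simp at hn
    linarith
  choose n hn using this
  exact ⟨n, by ext i; simp [hn]⟩

lemma norm_sec_le (t : Tor d) : ‖sec t‖ ≤ √d := by
  rw [EuclideanSpace.norm_eq]
  refine Real.sqrt_le_sqrt ?_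
  calc ∑ i, ‖sec t i‖ ^ 2 ≤ ∑ i : Fin d, (1 : ℝ) := by
        refine Finset.sum_le_sum fun i _ => ?_
        have := sec_mem t i
        rw [Real.norm_of_nonneg this.1.le]
        exact pow_le_one₀ this.1.le this.2
    _ = d := by simp

/-- Points of space as points of the unit cell translated by integer vectors. -/
def unfold (p : (Fin d → ℤ) × Tor d) : Euc d := sec p.2 + intVec p.1

@[simp] lemma toTor_unfold (p : (Fin d → ℤ) × Tor d) : toTor (unfold p) = p.2 := by
  simp [unfold, toTor_intVec]

lemma measurable_unfold : Measurable (unfold (d := d)) :=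
  (measurable_sec.comp measurable_snd).add
    ((measurable_of_countable intVec).comp measurable_fst)

lemma lintegral_eq_tsum_unfold (h : Euc d → ℝ≥0∞) :
    ∫⁻ x, h x = ∑' n : Fin d → ℤ, ∫⁻ t : Tor d, h (unfold (n, t)) := by
  let cell (n : Fin d → ℤ) : Set (Fin d → ℝ) := {x | ∀ i, x i ∈ Set.Ioc (n i : ℝ) (n i + 1)}
  have hmeas (n) : MeasurableSet (cell n) := by
    simp only [cell, Set.ofPred_forall]
    exact MeasurableSet.iInter fun i => (measurable_pi_apply i) measurableSet_Ioc
  have hcover : ⋃ n, cell n = Set.univ := by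
    refine Set.eq_univ_of_forall fun x => Set.mem_iUnion.2 ⟨fun i => ⌈x i⌉ - 1, fun i => ?_⟩
    have h1 := Int.le_ceil (x i)
    have h2 := Int.ceil_lt_add_one (x i)
    constructor <;> push_cast <;> linarith
  have hdisj : Pairwise (Function.onFun Disjoint cell) := by
    intro n k hnk
    refine Set.disjoint_left.2 fun x hx hx' => hnk ?_
    ext i
    have := hx i
    have := hx' i
    simp only [Set.mem_Ioc] at *
    have h1 : (n i : ℝ) < k i + 1 := by linarith
    have h2 : (k i : ℝ) < n i + 1 := by linarith
    norm_cast at h1 h2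
    lia
  calc ∫⁻ x, h x = ∫⁻ x : Fin d → ℝ, h (WithLp.toLp 2 x) := by
        have := (PiLp.volume_preserving_toLp (Fin d)).lintegral_comp_emb
          (MeasurableEquiv.toLp 2 (Fin d → ℝ)).measurableEmbedding h
        exact this.symm
    _ = ∑' n, ∫⁻ x in cell n, h (WithLp.toLp 2 x) := by
        rw [← setLIntegral_univ, ← hcover, lintegral_iUnion hmeas hdisj]
    _ = _ := by
        refine tsum_congr fun n => ?_
        refine Eq.trans ?_ (UnitAddTorus.lintegral_preimage
          (fun t : Tor d => h (unfold (n, t))) (fun i => (n i : ℝ))).symm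
        refine setLIntegral_congr_fun (hmeas n) fun x hx => ?_
        simp only
        congr 1
        set y : Tor d := fun i => (x i : UnitAddCircle)
        obtain ⟨k, hk⟩ := exists_intVec_of_toTor_eq (x := WithLp.toLp 2 x) (y := unfold (n, y))
          (by rw [toTor_unfold]; rfl)
        rw [hk]
        suffices k = 0 by rw [this]; ext i; simp [y]
        ext i
        have h1 := hx i
        have h2 := sec_mem y i
        have h3 := congrFun (congrArg WithLp.ofLp hk) i
        simp [unfold] at h1 h2 h3
        have h4 : (k i : ℝ) < 1 := by linarith
        have h5 : (-1 : ℝ) < k i := by linarith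
        norm_cast at h4 h5
        simp; lia

theorem measurePreserving_unfold :
    MeasurePreserving (unfold (d := d)) (Measure.count.prod volume) volume := by
  refine ⟨measurable_unfold, Measure.ext_of_lintegral _ fun h hh => ?_⟩
  rw [lintegral_map hh measurable_unfold, lintegral_prod (fun p => h (unfold p))
      (Measurable.aemeasurable (hh.comp measurable_unfold)),
    lintegral_count, lintegral_eq_tsum_unfold]

/-- A fixed integrable weight on space. -/
def weight (x : Euc d) : ℝ := ((1 + ‖x‖) ^ (d + 1))⁻¹

lemma weight_pos (x : Euc d) : 0 < weight x := by unfold weight; positivity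

lemma measurable_weight : Measurable (weight (d := d)) := by unfold weight; fun_prop

lemma integrable_weight : Integrable (weight (d := d)) := by
  have := integrable_one_add_norm (E := Euc d) (μ := volume) (r := (d + 1 : ℕ)) (by simp)
  refine this.congr (.of_forall fun x => ?_)
  simp only [weight]
  rw [Real.rpow_neg (by positivity), Real.rpow_natCast]

lemma weight_unfold_le (n : Fin d → ℤ) (s t : Tor d) :
    weight (unfold (n, t)) ≤ (1 + 2 * √d) ^ (d + 1) * weight (unfold (n, s)) := by
  have h0 : ‖unfold (n, s)‖ ≤ ‖unfold (n, t)‖ + 2 * √d := by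
    have : unfold (n, s) = unfold (n, t) + (sec s - sec t) := by simp [unfold]; abel
    rw [this]
    refine (norm_add_le _ _).trans ?_
    have := norm_sub_le (sec s) (sec t)
    linarith [norm_sec_le s, norm_sec_le t]
  have h1 : 1 + ‖unfold (n, s)‖ ≤ (1 + 2 * √d) * (1 + ‖unfold (n, t)‖) := by
    have : 0 ≤ √(d : ℝ) * ‖unfold (n, t)‖ := by positivity
    linarith
  unfold weight
  rw [← div_eq_mul_inv, inv_eq_one_div, div_le_div_iff₀ (by positivity) (by positivity), one_mul,
    ← mul_pow]
  gcongr

lemma exists_lintegral_weight_le :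
    ∃ S : ℝ, 0 < S ∧ ∀ t : Tor d,
      ∫⁻ n, ENNReal.ofReal (weight (unfold (n, t))) ∂Measure.count ≤ ENNReal.ofReal S := by
  have h1 : ∫⁻ t : Tor d, ∫⁻ n, ENNReal.ofReal (weight (unfold (n, t))) ∂Measure.count ≠ ∞ := by
    rw [← lintegral_prod_symm' (μ := Measure.count)
      (fun p => ENNReal.ofReal (weight (unfold p)))
      (measurable_weight.comp measurable_unfold).ennreal_ofReal,
      measurePreserving_unfold.lintegral_comp (measurable_weight.ennreal_ofReal)]
    exact (integrable_weight.lintegral_lt_top).ne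
  have h2 : ∃ s : Tor d, ∫⁻ n, ENNReal.ofReal (weight (unfold (n, s))) ∂Measure.count ≠ ∞ := by
    by_contra! h
    simp [h] at h1
  obtain ⟨s, hs⟩ := h2
  refine ⟨(1 + 2 * √d) ^ (d + 1) *
    ((∫⁻ n, ENNReal.ofReal (weight (unfold (n, s))) ∂Measure.count).toReal + 1),
    by positivity, fun t => ?_⟩
  calc _ ≤ ∫⁻ n, ENNReal.ofReal ((1 + 2 * √d) ^ (d + 1)) *
        ENNReal.ofReal (weight (unfold (n, s))) ∂Measure.count := by
        refine lintegral_mono fun n => ?_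
        rw [← ENNReal.ofReal_mul (by positivity)]
        exact ENNReal.ofReal_le_ofReal (weight_unfold_le n s t)
    _ = ENNReal.ofReal ((1 + 2 * √d) ^ (d + 1)) *
        ∫⁻ n, ENNReal.ofReal (weight (unfold (n, s))) ∂Measure.count :=
        lintegral_const_mul' _ _ ENNReal.ofReal_ne_top
    _ ≤ _ := by
        rw [ENNReal.ofReal_mul (by positivity)]
        gcongr
        rw [ENNReal.ofReal_add (by positivity) zero_le_one, ENNReal.ofReal_toReal hs]
        exact le_self_add

lemma lintegral_weight_mul_le {S : ℝ} (hS : ∀ t : Tor d,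
      ∫⁻ n, ENNReal.ofReal (weight (unfold (n, t))) ∂Measure.count ≤ ENNReal.ofReal S)
    {c : Tor d → ℝ≥0∞} (hc : Measurable c) :
    ∫⁻ x : Euc d, ENNReal.ofReal (weight x) * c (toTor x) ≤ ENNReal.ofReal S * ∫⁻ t, c t := by
  have hm : Measurable fun x : Euc d => ENNReal.ofReal (weight x) * c (toTor x) :=
    measurable_weight.ennreal_ofReal.mul (hc.comp measurable_toTor)
  rw [← measurePreserving_unfold.lintegral_comp hm,
    lintegral_prod_symm' (fun p => ENNReal.ofReal (weight (unfold p)) * c (toTor (unfold p)))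
      (hm.comp measurable_unfold),
    ← lintegral_const_mul _ hc]
  refine lintegral_mono fun t => ?_
  simp only [toTor_unfold]
  rw [lintegral_mul_const _ (measurable_of_countable _)]
  gcongr
  exact hS t

/-- The periodization of a function on space. -/
def periodization (h : Euc d → ℂ) (t : Tor d) : ℂ := ∫ n, h (unfold (n, t)) ∂Measure.count

lemma integrable_unfold {F : Type*} [NormedAddCommGroup F] {h : Euc d → F} (hh : Integrable h) :
    Integrable (fun p => h (unfold p)) (Measure.count.prod volume) :=
  measurePreserving_unfold.integrable_comp_of_integrable hh

lemma integral_mul_toTor {h : Euc d → ℂ} (hh : Integrable h) {c : Tor d → ℂ} (hc : Measurable c)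
    {K : ℝ} (hK : ∀ t, ‖c t‖ ≤ K) :
    ∫ x, h x * c (toTor x) = ∫ t, periodization h t * c t := by
  have hi : Integrable fun x => h x * c (toTor x) :=
    hh.mul_bdd (hc.comp measurable_toTor).aestronglyMeasurable (.of_forall fun x => hK _)
  have hi' := integrable_unfold hi
  rw [← measurePreserving_unfold.map_eq, integral_map measurable_unfold.aemeasurable
    (by rw [measurePreserving_unfold.map_eq]; exact hi.1), integral_prod_symm _ hi']
  refine integral_congr_ae (.of_forall fun t => ?_)
  simp only [toTor_unfold, periodization]
  rw [integral_mul_const]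

lemma integrable_periodization {h : Euc d → ℂ} (hh : Integrable h) :
    Integrable (periodization h) :=
  (integrable_unfold hh).integral_prod_right

lemma norm_periodization_le {S : ℝ} (hS : ∀ t : Tor d,
      ∫⁻ n, ENNReal.ofReal (weight (unfold (n, t))) ∂Measure.count ≤ ENNReal.ofReal S)
    (hS0 : 0 < S) {h : Euc d → ℂ} {K : ℝ} (hK : ∀ x, ‖h x‖ ≤ K * weight x) (hK0 : 0 ≤ K)
    (t : Tor d) : ‖periodization h t‖ ≤ K * S := by
  have h1 : ‖periodization h t‖ₑ ≤ ENNReal.ofReal (K * S) := by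
    refine (enorm_integral_le_lintegral_enorm _).trans ?_
    calc _ ≤ ∫⁻ n, ENNReal.ofReal K * ENNReal.ofReal (weight (unfold (n, t))) ∂Measure.count := by
          refine lintegral_mono fun n => ?_
          rw [← ENNReal.ofReal_mul hK0, ← ofReal_norm]
          exact ENNReal.ofReal_le_ofReal (hK _)
      _ ≤ _ := by
          rw [lintegral_const_mul' _ _ ENNReal.ofReal_ne_top, ENNReal.ofReal_mul hK0]
          gcongr
          exact hS t
  rw [← ofReal_norm] at h1
  exact (ENNReal.ofReal_le_ofReal_iff (by positivity)).1 h1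

end Torus

section Symbol

open Filter Topology
open scoped RealInnerProductSpace FourierTransform

variable {d : ℕ} {ρ : Measure (Euc d)} [IsProbabilityMeasure ρ]

/-- The Fourier symbol of the translation-invariant nonlocal operator with jump measure `ρ`. -/
def symbol (ρ : Measure (Euc d)) (ξ : Euc d) : ℝ := ∫ z, (1 - cos (2 * π * ⟪z, ξ⟫)) ∂ρ

lemma integrable_one_sub_cos (ξ : Euc d) :
    Integrable (fun z => 1 - cos (2 * π * ⟪z, ξ⟫)) ρ := by
  refine Integrable.of_bound (C := 2) (by fun_prop) (.of_forall fun z => ?_)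
  rw [Real.norm_eq_abs, abs_le]
  constructor <;> linarith [neg_one_le_cos (2 * π * ⟪z, ξ⟫), cos_le_one (2 * π * ⟪z, ξ⟫)]

lemma symbol_nonneg (ξ : Euc d) : 0 ≤ symbol ρ ξ :=
  integral_nonneg fun _ => sub_nonneg.2 (cos_le_one _)

lemma continuous_symbol : Continuous (symbol ρ) := by
  refine continuous_of_dominated (bound := fun _ => 2) (fun ξ => by fun_prop) (fun ξ => ?_)
    (integrable_const _) (.of_forall fun z => by fun_prop)
  refine .of_forall fun z => ?_
  rw [Real.norm_eq_abs, abs_le]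
  constructor <;> linarith [neg_one_le_cos (2 * π * ⟪z, ξ⟫), cos_le_one (2 * π * ⟪z, ξ⟫)]

lemma ae_inner_notMem (hac : ρ ≪ volume) {ξ : Euc d} (hξ : ξ ≠ 0) {s : Set ℝ}
    (hs : s.Countable) : ∀ᵐ z ∂ρ, ⟪z, ξ⟫ ∉ s := by
  refine hac.ae_le ?_
  have hsurj : Function.Surjective (innerₛₗ ℝ ξ : Euc d →ₗ[ℝ] ℝ) :=
    LinearMap.surjective (by
      intro h
      have := LinearMap.congr_fun h ξ
      simp at this
      exact hξ this)
  have hq := (ae_comp_linearMap_mem_iff (innerₛₗ ℝ ξ : Euc d →ₗ[ℝ] ℝ) volume volume hsurj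
    (s := sᶜ) hs.measurableSet.compl).2 (by
      have := hs.measure_zero (volume : Measure ℝ)
      simpa [ae_iff] using this)
  filter_upwards [hq] with z hz
  simpa [real_inner_comm] using hz

lemma symbol_pos (hac : ρ ≪ volume) {ξ : Euc d} (hξ : ξ ≠ 0) : 0 < symbol ρ ξ := by
  refine (symbol_nonneg ξ).lt_of_ne' fun h => ?_
  rw [symbol, integral_eq_zero_iff_of_nonneg (fun z => sub_nonneg.2 (cos_le_one _))
    (integrable_one_sub_cos ξ)] at h
  have h2 := ae_inner_notMem hac hξ (Set.countable_range fun n : ℤ => (n : ℝ))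
  obtain ⟨z, hz, hz'⟩ := (h.and h2).exists
  refine hz' ?_
  simp only [Pi.zero_apply] at hz
  obtain ⟨n, hn⟩ := (cos_eq_one_iff _).1 (by linarith : cos (2 * π * ⟪z, ξ⟫) = 1)
  exact ⟨n, by have := pi_pos; field_simp at hn; linarith⟩

lemma tendsto_symbol (hac : ρ ≪ volume) : Tendsto (symbol ρ) (cocompact (Euc d)) (𝓝 1) := by
  have h := tendsto_integral_exp_inner_smul_cocompact
    (fun z : Euc d => ((ρ.rnDeriv volume z).toReal : ℂ))
  have h2 : ∀ ξ : Euc d, symbol ρ ξ =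
      1 - (∫ z : Euc d, 𝐞 (-⟪z, ξ⟫) • ((ρ.rnDeriv volume z).toReal : ℂ)).re := by
    intro ξ
    have e1 : ∫ z : Euc d, 𝐞 (-⟪z, ξ⟫) • ((ρ.rnDeriv volume z).toReal : ℂ) =
        ∫ z : Euc d, Complex.exp ((2 * π * -⟪z, ξ⟫ : ℝ) * Complex.I) ∂ρ := by
      rw [← integral_rnDeriv_smul hac]
      refine integral_congr_ae (.of_forall fun z => ?_)
      dsimp only
      rw [Circle.smul_def, Real.fourierChar_apply, Complex.real_smul, smul_eq_mul, mul_comm]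
    have hi : Integrable (fun z : Euc d => Complex.exp ((2 * π * -⟪z, ξ⟫ : ℝ) * Complex.I)) ρ := by
      refine Integrable.of_bound (C := 1) (by fun_prop) (.of_forall fun z => ?_)
      rw [Complex.norm_exp_ofReal_mul_I]
    rw [e1, ← RCLike.re_eq_complex_re, ← integral_re hi, symbol,
      integral_sub (integrable_const _)]
    · simp only [integral_const, probReal_univ, smul_eq_mul, one_mul]
      congr 1
      refine integral_congr_ae (.of_forall fun z => ?_)
      dsimp only
      rw [RCLike.re_eq_complex_re, Complex.exp_ofReal_mul_I_re, mul_neg, cos_neg]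
    · refine Integrable.of_bound (C := 1) (by fun_prop) (.of_forall fun z => ?_)
      exact abs_cos_le_one _
  have h3 := (tendsto_const_nhds (x := (1 : ℝ))).sub
    ((Complex.continuous_re.tendsto _).comp h)
  simp only [Complex.zero_re, sub_zero] at h3
  exact h3.congr fun ξ => (h2 ξ).symm

lemma exists_symbol_ge_of_le_norm (hac : ρ ≪ volume) {δ : ℝ} (hδ : 0 < δ) :
    ∃ c, 0 < c ∧ ∀ ξ, δ ≤ ‖ξ‖ → c ≤ symbol ρ ξ := by
  have h1 := (tendsto_symbol hac).eventually (lt_mem_nhds (show (1 / 2 : ℝ) < 1 by norm_num))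
  obtain ⟨K, hK, hK'⟩ := mem_cocompact.1 h1
  obtain ⟨c, hc, hc'⟩ := (hK.inter_right
    (isClosed_le continuous_const continuous_norm : IsClosed
        {ξ : Euc d | δ ≤ ‖ξ‖})).exists_forall_le'
    (continuous_symbol (ρ := ρ)).continuousOn (a := 0)
    (fun ξ hξ => symbol_pos hac (norm_pos_iff.1 (hδ.trans_le hξ.2)))
  refine ⟨min c (1 / 2), by positivity, fun ξ hξ => ?_⟩
  by_cases hξK : ξ ∈ K
  · exact (min_le_left _ _).trans (hc' ξ ⟨hξK, hξ⟩)
  · exact (min_le_right _ _).trans (le_of_lt (hK' hξK))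

lemma exists_symbol_ge_near_zero (hac : ρ ≪ volume) :
    ∃ δ c, 0 < δ ∧ 0 < c ∧ ∀ ξ, ‖ξ‖ ≤ δ → c * ‖ξ‖ ^ 2 ≤ symbol ρ ξ := by
  obtain ⟨R, hR0, hR⟩ : ∃ R : ℝ, 0 < R ∧ ρ (Metric.closedBall 0 R) ≠ 0 := by
    by_contra! h
    have h2 : ρ (⋃ n : ℕ, Metric.closedBall 0 ((n : ℝ) + 1)) = 0 :=
      measure_iUnion_null fun n => h _ (by positivity)
    have h3 : ⋃ n : ℕ, Metric.closedBall (0 : Euc d) ((n : ℝ) + 1) = Set.univ := by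
      refine Set.eq_univ_of_forall fun x => Set.mem_iUnion.2 ?_
      obtain ⟨n, hn⟩ := exists_nat_ge ‖x‖
      exact ⟨n, by simp; linarith⟩
    rw [h3, measure_univ] at h2
    exact one_ne_zero h2
  set B : Set (Euc d) := Metric.closedBall 0 R with hB
  have hBm : MeasurableSet B := Metric.isClosed_closedBall.measurableSet
  have hin (z ξ : Euc d) (hz : z ∈ B) : |⟪z, ξ⟫| ≤ R * ‖ξ‖ := by
    refine (abs_real_inner_le_norm _ _).trans ?_
    have : ‖z‖ ≤ R := by simpa [hB] using hz
    gcongr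
  let Q (ξ : Euc d) : ℝ := ∫ z in B, ⟪z, ξ⟫ ^ 2 ∂ρ
  have hQi (ξ : Euc d) : Integrable (fun z => ⟪z, ξ⟫ ^ 2) (ρ.restrict B) := by
    refine Integrable.of_bound (C := (R * ‖ξ‖) ^ 2) (by fun_prop) ?_
    filter_upwards [ae_restrict_mem hBm] with z hz
    rw [norm_pow, Real.norm_eq_abs]
    gcongr
    exact hin z ξ hz
  have hQpos (ξ : Euc d) (hξ : ξ ≠ 0) : 0 < Q ξ := by
    refine (integral_nonneg fun z => sq_nonneg _).lt_of_ne' fun h => ?_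
    rw [integral_eq_zero_iff_of_nonneg (fun z => sq_nonneg _) (hQi ξ)] at h
    have h2 := ae_restrict_of_ae (s := B) (ae_inner_notMem hac hξ (Set.countable_singleton (0 : ℝ)))
    have : (ae (ρ.restrict B)).NeBot := by
      rw [ae_restrict_neBot]; exact hR
    obtain ⟨z, hz, hz'⟩ := (h.and h2).exists
    simp at hz hz'
    exact hz' hz
  have hQc : ContinuousOn Q (Metric.sphere 0 1) := by
    refine continuousOn_of_dominated (bound := fun _ => (R * 1) ^ 2) (fun ξ _ => by fun_prop)
      (fun ξ hξ => ?_) (integrable_const _) (.of_forall fun z => by fun_prop)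
    filter_upwards [ae_restrict_mem hBm] with z hz
    rw [norm_pow, Real.norm_eq_abs]
    have := hin z ξ hz
    rw [mem_sphere_zero_iff_norm.1 hξ] at this
    gcongr
  obtain ⟨c, hc, hc'⟩ := (isCompact_sphere (0 : Euc d) 1).exists_forall_le' hQc (a := 0)
    (fun ξ hξ => hQpos ξ (ne_zero_of_mem_unit_sphere ⟨ξ, hξ⟩))
  refine ⟨1 / (2 * R), 8 * c, by positivity, by positivity, fun ξ hξ => ?_⟩
  rcases eq_or_ne ξ 0 with rfl | hξ0
  · simpa using symbol_nonneg _
  have h1 : c * ‖ξ‖ ^ 2 ≤ Q ξ := by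
    have hn : 0 < ‖ξ‖ := norm_pos_iff.2 hξ0
    have h2 := hc' (‖ξ‖⁻¹ • ξ) (by simp [norm_smul, hn.ne'])
    have h3 : Q (‖ξ‖⁻¹ • ξ) = (‖ξ‖⁻¹) ^ 2 * Q ξ := by
      simp only [Q, inner_smul_right, mul_pow, integral_const_mul]
    rw [h3] at h2
    calc c * ‖ξ‖ ^ 2 ≤ (‖ξ‖⁻¹) ^ 2 * Q ξ * ‖ξ‖ ^ 2 := by gcongr
      _ = Q ξ := by field_simp
  calc 8 * c * ‖ξ‖ ^ 2 ≤ 8 * Q ξ := by linarith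
    _ = ∫ z in B, 8 * ⟪z, ξ⟫ ^ 2 ∂ρ := by rw [integral_const_mul]
    _ ≤ ∫ z in B, (1 - cos (2 * π * ⟪z, ξ⟫)) ∂ρ := by
        refine setIntegral_mono_on ((hQi ξ).const_mul 8) (integrable_one_sub_cos ξ).integrableOn
          hBm fun z hz => ?_
        have h4 : |2 * π * ⟪z, ξ⟫| ≤ π := by
          have h5 := hin z ξ hz
          have h6 : R * ‖ξ‖ ≤ 1 / 2 := by
            calc R * ‖ξ‖ ≤ R * (1 / (2 * R)) := by gcongr
              _ = 1 / 2 := by field_simp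
          rw [abs_mul, abs_of_pos (by positivity)]
          nlinarith [pi_pos]
        have h7 := cos_le_one_sub_mul_cos_sq h4
        have h8 : 2 / π ^ 2 * (2 * π * ⟪z, ξ⟫) ^ 2 = 8 * ⟪z, ξ⟫ ^ 2 := by
          field_simp; ring
        linarith
    _ ≤ symbol ρ ξ := setIntegral_le_integral (integrable_one_sub_cos ξ)
        (.of_forall fun z => sub_nonneg.2 (cos_le_one _))

/-- The symbol is bounded below by a multiple of `min 1 (‖ξ‖²)`. -/
theorem exists_symbol_ge (hac : ρ ≪ volume) :
    ∃ c, 0 < c ∧ ∀ ξ, c * min 1 (‖ξ‖ ^ 2) ≤ symbol ρ ξ := by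
  obtain ⟨δ, c, hδ, hc, h⟩ := exists_symbol_ge_near_zero hac
  obtain ⟨c', hc', h'⟩ := exists_symbol_ge_of_le_norm hac hδ
  refine ⟨min c c', by positivity, fun ξ => ?_⟩
  rcases le_total ‖ξ‖ δ with hξ | hξ
  · refine le_trans ?_ (h ξ hξ)
    gcongr
    exacts [min_le_left _ _, min_le_right _ _]
  · refine le_trans ?_ (h' ξ hξ)
    calc _ ≤ c' * 1 := by
          gcongr
          exacts [min_le_right _ _, min_le_left _ _]
      _ = c' := mul_one _

end Symbol

section SpectralGap

open UnitAddTorus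
open scoped RealInnerProductSpace ComplexConjugate

variable {d : ℕ}

lemma mFourier_toTor (n : Fin d → ℤ) (x : Euc d) :
    mFourier n (toTor x) = Complex.exp ((2 * π * ⟪x, intVec n⟫ : ℝ) * Complex.I) := by
  simp only [mFourier, ContinuousMap.coe_mk, toTor_apply, fourier_coe_apply, ← Complex.exp_sum,
    PiLp.inner_apply, intVec_apply]
  congr 1
  push_cast
  rw [Finset.mul_sum, Finset.sum_mul]
  refine Finset.sum_congr rfl fun i _ => ?_
  simp
  ring

lemma mFourier_add_arg (n : Fin d → ℤ) (s t : Tor d) :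
    mFourier n (s + t) = mFourier n s * mFourier n t := by
  simp only [mFourier, ContinuousMap.coe_mk, Pi.add_apply, ← Finset.prod_mul_distrib]
  refine Finset.prod_congr rfl fun i _ => ?_
  simp [fourier_apply, smul_add, AddCircle.toCircle_add]

lemma mFourierCoeff_comp_sub (u : Tor d → ℂ) (s : Tor d) (n : Fin d → ℤ) :
    mFourierCoeff (fun t => u (t - s)) n = mFourier (-n) s * mFourierCoeff u n := by
  rw [mFourierCoeff, mFourierCoeff, ← integral_const_mul,
    ← integral_add_right_eq_self _ s]
  refine integral_congr_ae (.of_forall fun t => ?_)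
  simp only [add_sub_cancel_right, smul_eq_mul]
  rw [mFourier_add_arg]
  ring

lemma mFourierCoeff_sub {u v : Tor d → ℂ} (hu : Integrable u) (hv : Integrable v)
    (n : Fin d → ℤ) :
    mFourierCoeff (fun t => u t - v t) n = mFourierCoeff u n - mFourierCoeff v n := by
  have key {w : Tor d → ℂ} (hw : Integrable w) :
      Integrable fun t => mFourier (-n) t • w t := by
    refine hw.bdd_smul 1 (mFourier (-n)).continuous.aestronglyMeasurable (.of_forall fun t => ?_)
    exact ((mFourier (-n)).norm_coe_le_norm t).trans mFourier_norm.le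
  rw [mFourierCoeff, mFourierCoeff, mFourierCoeff, ← integral_sub (key hu) (key hv)]
  simp only [smul_sub]

lemma mFourierCoeff_zero_index (u : Tor d → ℂ) : mFourierCoeff u 0 = ∫ t, u t := by
  simp [mFourierCoeff, mFourier_zero]

lemma mFourierCoeff_const (c : ℂ) {n : Fin d → ℤ} (hn : n ≠ 0) :
    mFourierCoeff (fun _ : Tor d => c) n = 0 := by
  obtain ⟨i, hi⟩ := Function.ne_iff.1 hn
  have h := mFourierCoeff_comp_sub (fun _ : Tor d => c)
    (toTor (EuclideanSpace.single i ((2 * (n i : ℝ))⁻¹))) n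
  rw [mFourier_toTor] at h
  have h2 : ⟪EuclideanSpace.single i ((2 * (n i : ℝ))⁻¹), intVec (-n)⟫ = -(1 / 2 : ℝ) := by
    have : (n i : ℝ) ≠ 0 := by exact_mod_cast hi
    rw [EuclideanSpace.inner_single_left]
    simp
    field_simp
  rw [h2, show ((2 * π * -(1 / 2) : ℝ) : ℂ) * Complex.I = -(π * Complex.I) by push_cast; ring,
    Complex.exp_neg, Complex.exp_pi_mul_I] at h
  have h3 : (2 : ℂ) * mFourierCoeff (fun _ : Tor d => c) n = 0 := by
    linear_combination h
  simpa using h3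

lemma lintegral_sq_eq_tsum {u : Tor d → ℂ} (hu : MemLp u 2) :
    ∫⁻ t, ‖u t‖ₑ ^ 2 = ∑' n, ‖mFourierCoeff u n‖ₑ ^ 2 := by
  have hc (n) : mFourierCoeff (hu.toLp u) n = mFourierCoeff u n := by
    refine integral_congr_ae ?_
    filter_upwards [hu.coeFn_toLp] with t ht
    rw [ht]
  have h := hasSum_sq_mFourierCoeff (hu.toLp u)
  simp only [hc] at h
  have h2 : ∫ t, ‖hu.toLp u t‖ ^ 2 = ∫ t, ‖u t‖ ^ 2 := by
    refine integral_congr_ae ?_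
    filter_upwards [hu.coeFn_toLp] with t ht
    rw [ht]
  rw [h2] at h
  have h3 : ∫⁻ t, ‖u t‖ₑ ^ 2 = ENNReal.ofReal (∫ t, ‖u t‖ ^ 2) := by
    rw [ofReal_integral_eq_lintegral_ofReal hu.norm.integrable_sq (.of_forall fun t => sq_nonneg _)]
    refine lintegral_congr fun t => ?_
    rw [ENNReal.ofReal_pow (norm_nonneg _), ofReal_norm]
  rw [h3, ← h.tsum_eq, ENNReal.ofReal_tsum_of_nonneg (fun n => sq_nonneg _) h.summable]
  refine tsum_congr fun n => ?_
  rw [ENNReal.ofReal_pow (norm_nonneg _), ofReal_norm]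

lemma lintegral_sub_mean_sq {u : Tor d → ℂ} (hu : MemLp u 2) :
    ∫⁻ t, ‖u t - ∫ s, u s‖ₑ ^ 2 =
      ∑' n, if n = 0 then 0 else ‖mFourierCoeff u n‖ₑ ^ 2 := by
  have hc : MemLp (fun _ : Tor d => ∫ s, u s) 2 := memLp_const _
  refine (lintegral_sq_eq_tsum (hu.sub hc)).trans ?_
  refine tsum_congr fun n => ?_
  have h1 := mFourierCoeff_sub (hu.integrable one_le_two) (hc.integrable one_le_two) n
  simp only [Pi.sub_def]
  rw [h1]
  split_ifs with hn
  · subst hn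
    simp [mFourierCoeff_zero_index]
  · simp [mFourierCoeff_const _ hn]

lemma norm_one_sub_mFourier_sq (n : Fin d → ℤ) (z : Euc d) :
    ‖1 - mFourier (-n) (toTor z)‖ ^ 2 = 2 * (1 - cos (2 * π * ⟪z, intVec n⟫)) := by
  have h : intVec (-n) = -intVec n := by ext i; simp
  rw [mFourier_toTor, h, inner_neg_right, ← Complex.normSq_eq_norm_sq, Complex.normSq_apply]
  simp only [Complex.sub_re, Complex.sub_im, Complex.one_re, Complex.one_im,
    Complex.exp_ofReal_mul_I_re, Complex.exp_ofReal_mul_I_im, mul_neg, cos_neg, sin_neg]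
  nlinarith [sin_sq_add_cos_sq (2 * π * ⟪z, intVec n⟫)]

lemma one_le_norm_intVec {n : Fin d → ℤ} (hn : n ≠ 0) : 1 ≤ ‖intVec n‖ := by
  obtain ⟨i, hi⟩ := Function.ne_iff.1 hn
  refine le_trans ?_ (PiLp.norm_apply_le (intVec n) i)
  rw [intVec_apply, Real.norm_eq_abs]
  exact_mod_cast Int.one_le_abs hi

variable {ρ : Measure (Euc d)} [IsProbabilityMeasure ρ]

/-- Poincaré inequality for the nonlocal Dirichlet form on the torus. -/
theorem lintegral_sub_mean_sq_le {c : ℝ}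
    (hc : ∀ ξ, c * min 1 (‖ξ‖ ^ 2) ≤ symbol ρ ξ) {u : Tor d → ℂ} (hu : MemLp u 2)
    (hum : Measurable u) :
    ENNReal.ofReal (2 * c) * ∫⁻ t, ‖u t - ∫ s, u s‖ₑ ^ 2 ≤
      ∫⁻ p : Euc d × Tor d, ‖u p.2 - u (p.2 - toTor p.1)‖ₑ ^ 2 ∂(ρ.prod volume) := by
  have hmeas : Measurable fun p : Euc d × Tor d => ‖u p.2 - u (p.2 - toTor p.1)‖ₑ ^ 2 := by
    have h1 := measurable_toTor (d := d)
    have h2 : Measurable fun p : Euc d × Tor d => u (p.2 - toTor p.1) := by fun_prop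
    fun_prop
  have hshift (s : Tor d) : MemLp (fun t => u (t - s)) 2 :=
    hu.comp_measurePreserving (measurePreserving_sub_right volume s)
  have h1 (z : Euc d) : ∫⁻ t, ‖u t - u (t - toTor z)‖ₑ ^ 2 =
      ∑' n, ENNReal.ofReal (2 * (1 - cos (2 * π * ⟪z, intVec n⟫))) *
        ‖mFourierCoeff u n‖ₑ ^ 2 := by
    refine (lintegral_sq_eq_tsum (hu.sub (hshift (toTor z)))).trans ?_
    refine tsum_congr fun n => ?_
    have h2 := mFourierCoeff_sub (hu.integrable one_le_two)
      ((hshift (toTor z)).integrable one_le_two) n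
    rw [show (u - fun t => u (t - toTor z)) = fun t => u t - u (t - toTor z) from rfl, h2,
      mFourierCoeff_comp_sub, ← one_sub_mul, enorm_mul, mul_pow, ← norm_one_sub_mFourier_sq,
      ENNReal.ofReal_pow (norm_nonneg _), ofReal_norm]
  rw [lintegral_prod _ hmeas.aemeasurable]
  simp only [h1]
  rw [lintegral_tsum (fun n => by fun_prop), lintegral_sub_mean_sq hu, ← ENNReal.tsum_mul_left]
  refine ENNReal.tsum_le_tsum fun n => ?_
  split_ifs with hn
  · simp
  · rw [lintegral_mul_const _ (by fun_prop)]
    gcongr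
    rw [← ofReal_integral_eq_lintegral_ofReal ((integrable_one_sub_cos _).const_mul 2)
      (.of_forall fun z => mul_nonneg two_pos.le (sub_nonneg.2 (cos_le_one _))), integral_const_mul]
    refine ENNReal.ofReal_le_ofReal ?_
    have h2 := hc (intVec n)
    have h3 := one_le_norm_intVec hn
    rw [min_eq_left (one_le_pow₀ h3)] at h2
    simp only [symbol] at h2
    linarith

end SpectralGap

section WeakCorrector

open scoped RealInnerProductSpace

lemma exists_weak_solution {H K : Type*} [NormedAddCommGroup H] [InnerProductSpace ℝ H]
    [CompleteSpace H] [NormedAddCommGroup K] [InnerProductSpace ℝ K] [CompleteSpace K]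
    (D : H →L[ℝ] K) (M : K →L[ℝ] K) (e : H →L[ℝ] ℝ) {α c : ℝ} (hα : 0 < α) (hc : 0 < c)
    (hM : ∀ k, α * ‖k‖ ^ 2 ≤ ⟪M k, k⟫) (hD : ∀ u, c * ‖u‖ ^ 2 ≤ ‖D u‖ ^ 2 + (e u) ^ 2)
    {one : H} (hone : D one = 0) (hone' : e one = 1) (F : K) :
    ∃ u, e u = 0 ∧ ∀ v, ⟪M (D u + F), D v⟫ = 0 := by
  let B : H →L[ℝ] H →L[ℝ] ℝ :=
    (isBoundedBilinearMap_inner (𝕜 := ℝ) (E := K)).toContinuousLinearMap.bilinearComp (M ∘L D) D +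
        (ContinuousLinearMap.mul ℝ ℝ).bilinearComp e e
  have hB (u v : H) : B u v = ⟪M (D u), D v⟫ + e u * e v := by
    simp only [B, ContinuousLinearMap.bilinearComp_apply, add_apply,
      ContinuousLinearMap.mul_apply', IsBoundedBilinearMap.toContinuousLinearMap_apply,
      ContinuousLinearMap.comp_apply]
  have hcoer : IsCoercive B := by
    refine ⟨min α 1 * c, by positivity, fun u => ?_⟩
    rw [hB]
    calc min α 1 * c * ‖u‖ * ‖u‖ = min α 1 * (c * ‖u‖ ^ 2) := by ring
      _ ≤ min α 1 * (‖D u‖ ^ 2 + (e u) ^ 2) := by gcongr; exact hD u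
      _ = min α 1 * ‖D u‖ ^ 2 + min α 1 * (e u) ^ 2 := by ring
      _ ≤ α * ‖D u‖ ^ 2 + 1 * (e u) ^ 2 := by
          gcongr
          exacts [min_le_left _ _, min_le_right _ _]
      _ ≤ _ := by linarith [hM (D u), sq (e u)]
  let L : H →L[ℝ] ℝ := -((innerSL ℝ (M F)) ∘L D)
  obtain ⟨f, hf⟩ := (InnerProductSpace.toDual ℝ H).surjective L
  refine ⟨hcoer.continuousLinearEquivOfBilin.symm f, ?_⟩
  set u := hcoer.continuousLinearEquivOfBilin.symm f with hu
  have key (v : H) : B u v = -⟪M F, D v⟫ := by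
    rw [← hcoer.continuousLinearEquivOfBilin_apply u v, hu,
      ContinuousLinearEquiv.apply_symm_apply, ← InnerProductSpace.toDual_apply_apply (𝕜 := ℝ), hf]
    simp [L]
  have h0 : e u = 0 := by
    have := key one
    rw [hB, hone, hone'] at this
    simpa using this
  refine ⟨h0, fun v => ?_⟩
  have := key v
  rw [hB, h0] at this
  rw [map_add, inner_add_left]
  linarith

variable {d : ℕ} {ρ : Measure (Euc d)} [IsProbabilityMeasure ρ] [ρ.IsNegInvariant]
  {w : Tor d → Tor d → ℝ} {wm wp : ℝ}

lemma measurePreserving_shift :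
    MeasurePreserving (fun p : Euc d × Tor d => p.2 - toTor p.1) (ρ.prod volume) volume :=
  measurePreserving_snd.comp (measurePreserving_flip (j := toTor) measurable_toTor)

/-- The difference operator on `L²` of the torus. -/
def differenceL (ρ : Measure (Euc d)) [IsProbabilityMeasure ρ] [ρ.IsNegInvariant] :
    Lp ℝ 2 (volume : Measure (Tor d)) →L[ℝ]
      Lp ℝ 2 (ρ.prod (volume : Measure (Tor d))) :=
  (Lp.compMeasurePreservingₗᵢ ℝ Prod.snd measurePreserving_snd).toContinuousLinearMap -
    (Lp.compMeasurePreservingₗᵢ ℝ _ measurePreserving_shift).toContinuousLinearMap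

lemma coeFn_differenceL {u : Tor d → ℝ} {U : Lp ℝ 2 (volume : Measure (Tor d))}
    (h : U =ᵐ[volume] u) :
    differenceL ρ U =ᵐ[ρ.prod volume] fun p => u p.2 - u (p.2 - toTor p.1) := by
  have h1 := Lp.coeFn_compMeasurePreserving U
    (measurePreserving_snd (μ := ρ) (ν := (volume : Measure (Tor d))))
  have h2 := Lp.coeFn_compMeasurePreserving U (measurePreserving_shift (ρ := ρ))
  have h3 := Lp.coeFn_sub (Lp.compMeasurePreservingₗᵢ ℝ Prod.snd
    (measurePreserving_snd (μ := ρ) (ν := (volume : Measure (Tor d)))) U)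
    (Lp.compMeasurePreservingₗᵢ ℝ _ (measurePreserving_shift (ρ := ρ)) U)
  have h4 := (measurePreserving_snd (μ := ρ) (ν :=
      (volume : Measure (Tor d)))).quasiMeasurePreserving.ae_eq h
  have h5 := (measurePreserving_shift (ρ := ρ)).quasiMeasurePreserving.ae_eq h
  filter_upwards [h1, h2, h3, h4, h5] with p h1 h2 h3 h4 h5
  refine h3.trans ?_
  rw [Pi.sub_apply]
  congr 1
  · exact h1.trans h4
  · exact h2.trans h5

theorem exists_weak_corrector (hw : IsConductance w wm wp) {c : ℝ} (hc0 : 0 < c)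
    (hc : ∀ ξ, c * min 1 (‖ξ‖ ^ 2) ≤ symbol ρ ξ) {F : Euc d × Tor d → ℝ}
    (hF : MemLp F 2 (ρ.prod volume)) :
    ∃ u : Tor d → ℝ, Measurable u ∧ MemLp u 2 ∧ ∫ t, u t = 0 ∧
      ∀ v : Tor d → ℝ, MemLp v 2 → ∫ p : Euc d × Tor d, w p.2 (p.2 - toTor p.1) *
        (u p.2 - u (p.2 - toTor p.1) + F p) *
          (v p.2 - v (p.2 - toTor p.1)) ∂(ρ.prod volume) = 0 := by
  have hwm := hw.measurable_comp (Z := Euc d) measurable_toTor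
  have hwL : MemLp (fun p : Euc d × Tor d => w p.2 (p.2 - toTor p.1)) ∞ (ρ.prod volume) :=
    memLp_top_of_bound hwm.aestronglyMeasurable wp (.of_forall fun p => hw.norm_le _ _)
  let M : Lp ℝ 2 (ρ.prod (volume : Measure (Tor d))) →L[ℝ] Lp ℝ 2 (ρ.prod volume) :=
    (ContinuousLinearMap.mul ℝ ℝ).holderL (ρ.prod volume) ∞ 2 2 (hwL.toLp _)
  have hM (k) : M k =ᵐ[ρ.prod volume] fun p => w p.2 (p.2 - toTor p.1) * k p := by
    have h1 :=
      ContinuousLinearMap.coeFn_holder (r := 2) (ContinuousLinearMap.mul ℝ ℝ) (hwL.toLp _) k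
    filter_upwards [h1, hwL.coeFn_toLp] with p h1 h2
    rw [← h2]
    exact h1
  let one : Lp ℝ 2 (volume : Measure (Tor d)) := (memLp_const (1 : ℝ)).toLp _
  have hone : one =ᵐ[volume] fun _ => 1 := MemLp.coeFn_toLp _
  let e : Lp ℝ 2 (volume : Measure (Tor d)) →L[ℝ] ℝ := innerSL ℝ one
  have he (u : Lp ℝ 2 (volume : Measure (Tor d))) : e u = ∫ t, u t := by
    simp only [e, innerSL_apply_apply, L2.inner_def]
    refine integral_congr_ae ?_
    filter_upwards [hone] with t ht
    simp [ht]
  have hMc (k : Lp ℝ 2 (ρ.prod (volume : Measure (Tor d)))) : wm * ‖k‖ ^ 2 ≤ ⟪M k, k⟫ := by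
    rw [← real_inner_self_eq_norm_sq, L2.inner_def, L2.inner_def, ← integral_const_mul]
    refine integral_mono_ae ((L2.integrable_inner k k).const_mul wm) (L2.integrable_inner _ _) ?_
    filter_upwards [hM k] with p hp
    simp only [hp, RCLike.inner_apply, conj_trivial]
    nlinarith [hw.lower p.2 (p.2 - toTor p.1), mul_self_nonneg (k p)]
  have hD (u : Lp ℝ 2 (volume : Measure (Tor d))) :
      min (2 * c) 1 * ‖u‖ ^ 2 ≤ ‖differenceL ρ u‖ ^ 2 + (e u) ^ 2 := by
    have hum := (Lp.stronglyMeasurable u).measurable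
    have hu2 := Lp.memLp u
    have h1 := lintegral_sub_mean_sq_le hc (u := fun t => (u t : ℂ)) hu2.ofReal
      (Complex.measurable_ofReal.comp hum)
    have hi1 : Integrable fun t => u t ^ 2 := hu2.integrable_sq
    have hi2 : Integrable fun t => u t := hu2.integrable one_le_two
    have h3 : ‖u‖ ^ 2 - (e u) ^ 2 = ∫ t, (u t - e u) ^ 2 := by
      have e1 : ‖u‖ ^ 2 = ∫ t, u t ^ 2 := by
        rw [← real_inner_self_eq_norm_sq, L2.inner_def]
        simp [sq]
      have e2 (t) : (u t - e u) ^ 2 = u t ^ 2 - 2 * e u * u t + e u ^ 2 := by ring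
      simp only [e2]
      have hi3 : Integrable fun t => u t ^ 2 - 2 * e u * u t := hi1.sub (hi2.const_mul _)
      rw [integral_add hi3 (integrable_const _),
        integral_sub hi1 (hi2.const_mul _), integral_const_mul, ← he, e1]
      simp
      ring
    have h2 : ∫⁻ t, ‖(u t : ℂ) - ∫ s, (u s : ℂ)‖ₑ ^ 2 = ENNReal.ofReal (‖u‖ ^ 2 - (e u) ^ 2) := by
      have hi4 : Integrable fun t => (u t - e u) ^ 2 :=
        (hu2.sub (memLp_const (e u))).integrable_sq
      rw [h3, ofReal_integral_eq_lintegral_ofReal hi4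
        (.of_forall fun t => sq_nonneg _)]
      refine lintegral_congr fun t => ?_
      rw [integral_complex_ofReal, ← he]
      rw [← Complex.ofReal_sub, ← ofReal_norm, Complex.norm_real,
        ← ENNReal.ofReal_pow (norm_nonneg _), Real.norm_eq_abs, sq_abs]
    have h4 : ∫⁻ p : Euc d × Tor d, ‖(u p.2 : ℂ) - u (p.2 - toTor p.1)‖ₑ ^ 2 ∂(ρ.prod volume) =
        ENNReal.ofReal (‖differenceL ρ u‖ ^ 2) := by
      rw [← real_inner_self_eq_norm_sq, L2.inner_def, ofReal_integral_eq_lintegral_ofReal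
        (L2.integrable_inner _ _) (.of_forall fun p => real_inner_self_nonneg)]
      refine lintegral_congr_ae ?_
      filter_upwards [coeFn_differenceL (ρ := ρ) (Filter.EventuallyEq.refl _ u)] with p hp
      rw [hp, real_inner_self_eq_norm_sq, ENNReal.ofReal_pow (norm_nonneg _), ofReal_norm,
        ← Complex.ofReal_sub, ← ofReal_norm, Complex.norm_real, ofReal_norm]
    rw [h2, h4, ← ENNReal.ofReal_mul (by positivity),
      ENNReal.ofReal_le_ofReal_iff (by positivity)] at h1
    calc _ = min (2 * c) 1 * (‖u‖ ^ 2 - e u ^ 2) + min (2 * c) 1 * e u ^ 2 := by ring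
      _ ≤ 2 * c * (‖u‖ ^ 2 - e u ^ 2) + 1 * e u ^ 2 := by
          have : 0 ≤ ‖u‖ ^ 2 - e u ^ 2 := h3 ▸ integral_nonneg fun t => sq_nonneg _
          gcongr
          exacts [min_le_left _ _, min_le_right _ _]
      _ ≤ _ := by linarith
  obtain ⟨U, hU0, hU⟩ := exists_weak_solution (differenceL ρ) M e hw.pos
    (c := min (2 * c) 1) (by positivity) hMc hD (one := one) (by
      rw [Lp.eq_zero_iff_ae_eq_zero]
      filter_upwards [coeFn_differenceL (ρ := ρ) hone] with p hp
      simp [hp]) (by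
      rw [he, integral_congr_ae hone]; simp) (hF.toLp F)
  have hUm := (Lp.stronglyMeasurable U).measurable
  refine ⟨U, hUm, Lp.memLp U, by rw [← he, hU0], fun v hv => ?_⟩
  rw [← hU (hv.toLp v), L2.inner_def]
  refine integral_congr_ae ?_
  filter_upwards [hM (differenceL ρ U + hF.toLp F), Lp.coeFn_add (differenceL ρ U) (hF.toLp F),
    coeFn_differenceL (ρ := ρ) (Filter.EventuallyEq.refl _ U), hF.coeFn_toLp,
    coeFn_differenceL (ρ := ρ) hv.coeFn_toLp] with p h1 h2 h3 h4 h5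
  rw [h1, h2, h5, Pi.add_apply, h3, h4]
  simp
  ring

end WeakCorrector

section BoundedCorrector

variable {d : ℕ}

lemma ae_le_of_le_add_lintegral {ν : Measure (Euc d)} [SFinite ν] {K D : ℝ≥0∞}
    (hD : D * ν Set.univ ≤ 1 / 2) {c : Tor d → ℝ≥0∞} (hc : Measurable c) (hc1 : ∫⁻ t, c t ≠ ∞)
    (h : ∀ᵐ t, c t ≤ K + D * ∫⁻ z, c (t - toTor z) ∂ν) : ∀ᵐ t, c t ≤ 2 * K := by
  let η (t : Tor d) : ℝ≥0∞ := c t - 2 * K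
  have hη : Measurable η := hc.sub measurable_const
  have hsub : Measurable fun p : Tor d × Euc d => p.1 - toTor p.2 :=
    measurable_fst.sub (measurable_toTor.comp measurable_snd)
  have hηs : Measurable fun p : Tor d × Euc d => η (p.1 - toTor p.2) := hη.comp hsub
  have h1 : ∀ᵐ t, η t ≤ D * ∫⁻ z, η (t - toTor z) ∂ν := by
    filter_upwards [h] with t ht
    refine tsub_le_iff_left.2 ?_
    calc c t ≤ K + D * ∫⁻ z, c (t - toTor z) ∂ν := ht
      _ ≤ K + D * ∫⁻ z, (2 * K + η (t - toTor z)) ∂ν := by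
          gcongr with z
          exact le_add_tsub
      _ = K + D * ν Set.univ * (2 * K) + D * ∫⁻ z, η (t - toTor z) ∂ν := by
          rw [lintegral_add_left measurable_const, lintegral_const]
          ring
      _ ≤ K + 1 / 2 * (2 * K) + D * ∫⁻ z, η (t - toTor z) ∂ν := by gcongr
      _ = _ := by
          rw [← mul_assoc, ENNReal.div_mul_cancel (by norm_num) (by norm_num), one_mul, two_mul]
  have h2 : ∫⁻ t, η t ≤ 1 / 2 * ∫⁻ t, η t := by
    calc ∫⁻ t, η t ≤ ∫⁻ t, D * ∫⁻ z, η (t - toTor z) ∂ν := lintegral_mono_ae h1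
      _ = D * ∫⁻ z, (∫⁻ t, η (t - toTor z)) ∂ν := by
          rw [lintegral_const_mul _ (Measurable.lintegral_prod_right' hηs),
            lintegral_lintegral_swap hηs.aemeasurable]
      _ = D * ν Set.univ * ∫⁻ t, η t := by
          simp only [lintegral_sub_right_eq_self, lintegral_const]
          ring
      _ ≤ _ := by gcongr
  have h3 : ∫⁻ t, η t ≠ ∞ := ne_top_of_le_ne_top hc1 (lintegral_mono fun t => tsub_le_self)
  have h4 : ∫⁻ t, η t = 0 := by
    by_contra h0
    have : (1 / 2 : ℝ≥0∞) * ∫⁻ t, η t < ∫⁻ t, η t := by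
      rw [one_div, mul_comm, ← div_eq_mul_inv]
      exact ENNReal.half_lt_self h0 h3
    exact absurd h2 this.not_ge
  filter_upwards [(lintegral_eq_zero_iff hη).1 h4] with t ht
  exact tsub_eq_zero_iff_le.1 ht

variable {ρ : Measure (Euc d)} [IsProbabilityMeasure ρ]

lemma exists_split (hac : ρ ≪ volume) {δ : ℝ≥0∞} (hδ : δ ≠ 0) :
    ∃ (s : Set (Euc d)) (N : ℝ≥0∞), MeasurableSet s ∧ N ≠ ∞ ∧ ρ sᶜ ≤ δ ∧
      ∀ c : Tor d → ℝ≥0∞, Measurable c → ∀ t,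
        ∫⁻ z in s, c (t - toTor z) ∂ρ ≤ N * ∫⁻ t, c t := by
  obtain ⟨S, hS0, hS⟩ := exists_lintegral_weight_le (d := d)
  let κ := ρ.rnDeriv volume
  have hκm : Measurable κ := Measure.measurable_rnDeriv _ _
  have hκ : volume.withDensity κ = ρ := Measure.withDensity_rnDeriv_eq _ _ hac
  let s (n : ℕ) : Set (Euc d) := {z | κ z ≤ n * ENNReal.ofReal (weight z)}
  have hs (n) : MeasurableSet (s n) :=
    measurableSet_le hκm (measurable_const.mul measurable_weight.ennreal_ofReal)
  have hlim : Filter.Tendsto (fun n => ρ (s n)ᶜ) Filter.atTop (nhds (ρ (⋂ n, (s n)ᶜ))) := by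
    refine tendsto_measure_iInter_atTop (fun n => (hs n).compl.nullMeasurableSet) ?_
      ⟨0, measure_ne_top _ _⟩
    intro n m hnm
    refine Set.compl_subset_compl.2 fun z hz => ?_
    refine (show κ z ≤ n * ENNReal.ofReal (weight z) from hz).trans ?_
    gcongr
  have hzero : ρ (⋂ n, (s n)ᶜ) = 0 := by
    refine measure_mono_null (t := {z | ¬ κ z < ∞}) ?_
        (ae_iff.1 (hac.ae_le (Measure.rnDeriv_lt_top ρ volume)))
    intro z hz hlt
    have hw0 : ENNReal.ofReal (weight z) ≠ 0 := by simpa using weight_pos z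
    obtain ⟨n, hn⟩ := ENNReal.exists_nat_mul_gt hw0 hlt.ne
    exact (Set.mem_iInter.1 hz n) hn.le
  rw [hzero] at hlim
  obtain ⟨n, hn⟩ := (hlim.eventually (gt_mem_nhds (pos_iff_ne_zero.2 hδ))).exists
  refine ⟨s n, n * ENNReal.ofReal S, hs n, ENNReal.mul_ne_top (by simp) (by simp), hn.le,
    fun c hc t => ?_⟩
  have hct : Measurable fun r => c (t - r) := hc.comp (measurable_const.sub measurable_id)
  calc ∫⁻ z in s n, c (t - toTor z) ∂ρ
      = ∫⁻ z in s n, κ z * c (t - toTor z) := by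
        rw [← hκ, setLIntegral_withDensity_eq_setLIntegral_mul _ hκm
          (show Measurable fun z => c (t - toTor z) from hct.comp measurable_toTor) (hs n)]
        rfl
    _ ≤ ∫⁻ z in s n, n * (ENNReal.ofReal (weight z) * c (t - toTor z)) := by
        refine setLIntegral_mono' (hs n) fun z hz => ?_
        rw [← mul_assoc]
        gcongr
        exact hz
    _ ≤ ∫⁻ z, n * (ENNReal.ofReal (weight z) * c (t - toTor z)) := setLIntegral_le_lintegral _ _
    _ = n * ∫⁻ z, ENNReal.ofReal (weight z) * c (t - toTor z) :=
        lintegral_const_mul _ (measurable_weight.ennreal_ofReal.mul (hct.comp measurable_toTor))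
    _ ≤ n * (ENNReal.ofReal S * ∫⁻ r, c (t - r)) := by
        gcongr
        exact lintegral_weight_mul_le hS hct
    _ = _ := by
        have : (volume : Measure UnitAddCircle).IsNegInvariant :=
          inferInstanceAs AddCircle.haarAddCircle.IsNegInvariant
        have : (volume : Measure (Tor d)).IsNegInvariant :=
          inferInstanceAs (Measure.pi fun _ => volume).IsNegInvariant
        rw [lintegral_sub_left_eq_self, mul_assoc]

variable [ρ.IsNegInvariant] {w : Tor d → Tor d → ℝ} {wm wp : ℝ}

/-- The weak form of the cell problem with an odd datum `θ`. -/
def IsWeakCorrector (ρ : Measure (Euc d)) (w : Tor d → Tor d → ℝ) (θ : Euc d → ℝ)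
    (u : Tor d → ℝ) : Prop :=
  ∀ v : Tor d → ℝ, MemLp v 2 → ∫ p : Euc d × Tor d, w p.2 (p.2 - toTor p.1) *
    (θ p.1 + (u p.2 - u (p.2 - toTor p.1))) * (v p.2 - v (p.2 - toTor p.1)) ∂(ρ.prod volume) = 0

lemma memLp_comp_shift {F : Type*} [NormedAddCommGroup F] {u : Tor d → F} {q : ℝ≥0∞}
    (hu : MemLp u q) :
    MemLp (fun p : Euc d × Tor d => u (p.2 - toTor p.1)) q (ρ.prod volume) :=
  hu.comp_measurePreserving measurePreserving_shift

lemma memLp_comp_snd {F : Type*} [NormedAddCommGroup F] {u : Tor d → F} {q : ℝ≥0∞}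
    (hu : MemLp u q) :
    MemLp (fun p : Euc d × Tor d => u p.2) q (ρ.prod volume) :=
  hu.comp_measurePreserving measurePreserving_snd

lemma memLp_flux {θ : Euc d → ℝ} (hθ : MemLp θ 2 ρ) {u : Tor d → ℝ} (hu : MemLp u 2) :
    MemLp (fun p : Euc d × Tor d => θ p.1 + (u p.2 - u (p.2 - toTor p.1))) 2 (ρ.prod volume) :=
  (hθ.comp_measurePreserving measurePreserving_fst).add
    ((memLp_comp_snd hu).sub (memLp_comp_shift hu))

lemma IsWeakCorrector.integral_mul_eq_zero (hw : IsConductance w wm wp) {θ : Euc d → ℝ}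
    (hθ : MemLp θ 2 ρ) (hodd : ∀ z, θ (-z) = -θ z) {u : Tor d → ℝ} (hu : MemLp u 2)
    (h : IsWeakCorrector ρ w θ u) {v : Tor d → ℝ} (hv : MemLp v 2) :
    ∫ p : Euc d × Tor d, w p.2 (p.2 - toTor p.1) *
      (θ p.1 + (u p.2 - u (p.2 - toTor p.1))) * v p.2 ∂(ρ.prod volume) = 0 := by
  have hI : Integrable (fun p : Euc d × Tor d => w p.2 (p.2 - toTor p.1) *
      (θ p.1 + (u p.2 - u (p.2 - toTor p.1))) * v p.2) (ρ.prod volume) := by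
    simp only [mul_assoc]
    exact hw.integrable_smul measurable_toTor ((memLp_flux hθ hu).integrable_mul
        (memLp_comp_snd hv))
  have hI' := integrable_comp_flip (m := (volume : Measure (Tor d))) measurable_toTor hI
  have e := integral_comp_flip (ρ := ρ) (m := (volume : Measure (Tor d))) measurable_toTor
    (fun p : Euc d × Tor d => w p.2 (p.2 - toTor p.1) *
      (θ p.1 + (u p.2 - u (p.2 - toTor p.1))) * v p.2)
  have e2 := h v hv
  have e3 : ∀ p : Euc d × Tor d, w p.2 (p.2 - toTor p.1) *
    (θ p.1 + (u p.2 - u (p.2 - toTor p.1))) * (v p.2 - v (p.2 - toTor p.1)) =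
    w p.2 (p.2 - toTor p.1) * (θ p.1 + (u p.2 - u (p.2 - toTor p.1))) * v p.2 +
    w (flip toTor p).2 ((flip toTor p).2 - toTor (flip toTor p).1) *
      (θ (flip toTor p).1 + (u (flip toTor p).2 - u ((flip toTor p).2 - toTor (flip toTor p).1))) *
      v (flip toTor p).2 := by
    intro p
    simp only [flip_fst, flip_snd, map_neg, sub_neg_eq_add, sub_add_cancel, hodd,
      hw.symm (p.2 - toTor p.1) p.2]
    ring
  simp only [e3] at e2
  rw [integral_add hI hI', e] at e2
  linarith

lemma IsWeakCorrector.ae_eq_zero (hw : IsConductance w wm wp) {θ : Euc d → ℝ}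
    (hθ : MemLp θ 2 ρ) (hodd : ∀ z, θ (-z) = -θ z) {u : Tor d → ℝ} (hu : MemLp u 2)
    (h : IsWeakCorrector ρ w θ u) :
    ∀ᵐ t, ∫ z, w t (t - toTor z) * (θ z + (u t - u (t - toTor z))) ∂ρ = 0 := by
  have hI : Integrable (fun p : Euc d × Tor d => w p.2 (p.2 - toTor p.1) *
      (θ p.1 + (u p.2 - u (p.2 - toTor p.1)))) (ρ.prod volume) :=
    hw.integrable_smul measurable_toTor ((memLp_flux hθ hu).integrable one_le_two)
  refine Integrable.ae_eq_zero_of_forall_setIntegral_eq_zero hI.integral_prod_right fun s hs _ => ?_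
  have hv : MemLp (s.indicator fun _ => (1 : ℝ)) 2 (volume : Measure (Tor d)) :=
    (memLp_const 1).indicator hs
  have h1 := h.integral_mul_eq_zero hw hθ hodd hu hv
  rw [integral_prod_symm] at h1
  · simp only [integral_mul_const] at h1
    rw [← integral_indicator hs, ← h1]
    refine integral_congr_ae (.of_forall fun t => ?_)
    by_cases ht : t ∈ s <;> simp [ht]
  · simp only [mul_assoc]
    exact hw.integrable_smul measurable_toTor ((memLp_flux hθ hu).integrable_mul
        (memLp_comp_snd hv))

lemma IsWeakCorrector.ae_bound (hw : IsConductance w wm wp) (hac : ρ ≪ volume) {θ : Euc d → ℝ}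
    (hθ : MemLp θ 2 ρ) (hodd : ∀ z, θ (-z) = -θ z) {u : Tor d → ℝ} (hum : Measurable u)
    (hu : MemLp u 2) (h : IsWeakCorrector ρ w θ u) : ∃ K : ℝ, ∀ᵐ t, |u t| ≤ K := by
  have hwp : 0 < wp := hw.pos.trans_le ((hw.lower 0 0).trans (hw.upper 0 0))
  set r : ℝ≥0∞ := ENNReal.ofReal (wp / wm) with hr
  have hr0 : r ≠ 0 := by simpa [hr] using div_pos hwp hw.pos
  obtain ⟨s, N, hs, hN, hsδ, hsN⟩ := exists_split hac (δ := 1 / 2 / r) (by simp [hr])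
  have hθ1 : ∫⁻ z, ‖θ z‖ₑ ∂ρ ≠ ∞ := (hθ.integrable one_le_two).2.ne
  have hu1 : ∫⁻ t, ‖u t‖ₑ ≠ ∞ := (hu.integrable one_le_two).2.ne
  have key : ∀ᵐ t, ‖u t‖ₑ ≤ r * (∫⁻ z, ‖θ z‖ₑ ∂ρ) + r * ∫⁻ z, ‖u (t - toTor z)‖ₑ ∂ρ := by
    filter_upwards [h.ae_eq_zero hw hθ hodd hu,
      ((memLp_comp_shift (ρ := ρ) hu).integrable one_le_two).prod_left_ae] with t h1 h2
    have hwt : Measurable fun z => w t (t - toTor z) :=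
      (hw.measurable_comp (Z := Euc d) measurable_toTor).comp measurable_prodMk_right
    have hb {f : Euc d → ℝ} (hf : Integrable f ρ) :
        Integrable (fun z => w t (t - toTor z) * f z) ρ :=
      hf.bdd_mul hwt.aestronglyMeasurable (.of_forall fun z => hw.norm_le _ _)
    have e1 : u t * ∫ z, w t (t - toTor z) ∂ρ =
        ∫ z, w t (t - toTor z) * (u (t - toTor z) - θ z) ∂ρ := by
      have hi1 := hb (integrable_const (u t))
      have hi2 := hb (h2.sub (hθ.integrable one_le_two))
      have e0 : ∀ z, w t (t - toTor z) * (θ z + (u t - u (t - toTor z))) =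
        w t (t - toTor z) * u t - w t (t - toTor z) * (u (t - toTor z) - θ z) := fun z => by ring
      simp only [e0] at h1
      refine Eq.trans ?_ (sub_eq_zero.1 ((integral_sub hi1 hi2).symm.trans h1))
      rw [integral_mul_const, mul_comm]
    have e2 : wm ≤ ∫ z, w t (t - toTor z) ∂ρ := by
      have := integral_mono (μ := ρ) (integrable_const wm) (by simpa using hb (integrable_const 1))
        (fun z => hw.lower t (t - toTor z))
      simpa using this
    have e3 : ENNReal.ofReal wm * ‖u t‖ₑ ≤ ENNReal.ofReal wp *
        (∫⁻ z, ‖θ z‖ₑ ∂ρ + ∫⁻ z, ‖u (t - toTor z)‖ₑ ∂ρ) := by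
      calc ENNReal.ofReal wm * ‖u t‖ₑ ≤ ‖∫ z, w t (t - toTor z) ∂ρ‖ₑ * ‖u t‖ₑ := by
            gcongr
            rw [Real.enorm_of_nonneg (hw.pos.le.trans e2)]
            exact ENNReal.ofReal_le_ofReal e2
        _ = ‖∫ z, w t (t - toTor z) * (u (t - toTor z) - θ z) ∂ρ‖ₑ := by
            rw [← e1, enorm_mul, mul_comm]
        _ ≤ ∫⁻ z, ‖w t (t - toTor z) * (u (t - toTor z) - θ z)‖ₑ ∂ρ :=
            enorm_integral_le_lintegral_enorm _
        _ ≤ ∫⁻ z, ENNReal.ofReal wp * (‖θ z‖ₑ + ‖u (t - toTor z)‖ₑ) ∂ρ := by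
            refine lintegral_mono fun z => ?_
            rw [enorm_mul]
            gcongr
            · rw [← ofReal_norm]
              exact ENNReal.ofReal_le_ofReal (hw.norm_le _ _)
            · rw [add_comm]
              exact enorm_sub_le
        _ = _ := by
            rw [lintegral_const_mul' _ _ (by simp), lintegral_add_left'
                hθ.aestronglyMeasurable.enorm]
    rw [← mul_add, hr, ENNReal.ofReal_div_of_pos hw.pos, ← ENNReal.mul_div_right_comm,
      ENNReal.le_div_iff_mul_le (by simp [hw.pos]) (by simp), mul_comm]
    exact e3
  have key2 : ∀ᵐ t, ‖u t‖ₑ ≤ (r * (∫⁻ z, ‖θ z‖ₑ ∂ρ) + r * (N * ∫⁻ t, ‖u t‖ₑ)) +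
      r * ∫⁻ z, ‖u (t - toTor z)‖ₑ ∂(ρ.restrict sᶜ) := by
    filter_upwards [key] with t ht
    refine ht.trans ?_
    rw [← lintegral_add_compl (fun z => ‖u (t - toTor z)‖ₑ) hs, mul_add, add_assoc]
    gcongr
    exact hsN _ hum.enorm t
  have hKfin : r * (∫⁻ z, ‖θ z‖ₑ ∂ρ) + r * (N * ∫⁻ t, ‖u t‖ₑ) ≠ ∞ :=
    ENNReal.add_ne_top.2 ⟨ENNReal.mul_ne_top (by simp [hr]) hθ1,
      ENNReal.mul_ne_top (by simp [hr]) (ENNReal.mul_ne_top hN hu1)⟩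
  have := ae_le_of_le_add_lintegral (by
    rw [Measure.restrict_apply_univ]
    calc r * ρ sᶜ ≤ r * (1 / 2 / r) := by gcongr
      _ ≤ 1 / 2 := ENNReal.mul_div_le) hum.enorm hu1 key2
  refine ⟨(2 * (r * (∫⁻ z, ‖θ z‖ₑ ∂ρ) + r * (N * ∫⁻ t, ‖u t‖ₑ))).toReal, ?_⟩
  filter_upwards [this] with t ht
  rw [← Real.norm_eq_abs, ← toReal_enorm]
  exact ENNReal.toReal_mono (ENNReal.mul_ne_top (by simp) hKfin) ht

theorem exists_bounded_corrector (hw : IsConductance w wm wp) (hac : ρ ≪ volume)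
    {θ : Euc d → ℝ} (hθ : MemLp θ 2 ρ) (hodd : ∀ z, θ (-z) = -θ z) :
    ∃ (u : Tor d → ℝ) (K : ℝ), Measurable u ∧ (∀ t, |u t| ≤ K) ∧ ∫ t, u t = 0 ∧
      IsWeakCorrector ρ w θ u := by
  obtain ⟨c, hc0, hc⟩ := exists_symbol_ge hac
  obtain ⟨u, hum, hu, hu0, h⟩ := exists_weak_corrector hw hc0 hc
    (hθ.comp_measurePreserving (measurePreserving_fst (μ := ρ) (ν := (volume : Measure (Tor d)))))
  have hweak : IsWeakCorrector ρ w θ u := fun v hv => by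
    simpa only [add_comm, Function.comp_apply] using h v hv
  obtain ⟨K, hK⟩ := hweak.ae_bound hw hac hθ hodd hum hu
  let s : Set (Tor d) := {t | |u t| ≤ K}
  have hs : MeasurableSet s := measurableSet_le hum.abs measurable_const
  have hK0 : 0 ≤ K := by
    obtain ⟨t, ht⟩ := hK.exists
    exact (abs_nonneg _).trans ht
  have hae : s.indicator u =ᵐ[volume] u := by
    filter_upwards [hK] with t ht
    exact Set.indicator_of_mem (s := s) ht u
  refine ⟨s.indicator u, K, hum.indicator hs, fun t => ?_, by rw [integral_congr_ae hae, hu0],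
    fun v hv => ?_⟩
  · by_cases ht : t ∈ s
    · rw [Set.indicator_of_mem ht]
      exact ht
    · simpa [Set.indicator_of_notMem ht] using hK0
  · rw [← hweak v hv]
    refine integral_congr_ae ?_
    filter_upwards [(measurePreserving_snd (μ := ρ) (ν := (volume : Measure
      (Tor d)))).quasiMeasurePreserving.ae_eq hae,
      (measurePreserving_shift (ρ := ρ)).quasiMeasurePreserving.ae_eq hae] with p h1 h2
    simp only [Function.comp_apply] at h1 h2
    rw [h1, h2]

end BoundedCorrector

section Fiber

open scoped RealInnerProductSpace
open Complex (I)

lemma norm_exp_sub_one_sub_le (x : ℝ) : ‖Complex.exp (I * x) - 1 - I * x‖ ≤ 3 * |x| ^ 2 := by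
  have hx : ‖I * x‖ = |x| := by simp
  have h1 : ‖Complex.exp (I * x)‖ = 1 := Complex.norm_exp_I_mul_ofReal x
  rcases le_or_gt |x| 1 with h | h
  · have := Complex.norm_exp_sub_one_sub_id_le (x := I * x) (by rwa [hx])
    rw [hx] at this
    nlinarith [sq_nonneg |x|]
  · calc ‖Complex.exp (I * x) - 1 - I * x‖ ≤ ‖Complex.exp (I * x)‖ + ‖(1 : ℂ)‖ + ‖I * x‖ :=
        (norm_sub_le _ _).trans (add_le_add_left (norm_sub_le _ _) _)
      _ = 2 + |x| := by rw [h1, hx, norm_one]; norm_num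
      _ ≤ _ := by nlinarith

lemma norm_exp_sub_one_sub_sub_le (x : ℝ) :
    ‖Complex.exp (I * x) - 1 - I * x + x ^ 2 / 2‖ ≤ 4 * |x| ^ 3 := by
  have hx : ‖I * x‖ = |x| := by simp
  have h1 : ‖Complex.exp (I * x)‖ = 1 := Complex.norm_exp_I_mul_ofReal x
  rcases le_or_gt |x| 1 with h | h
  · have := Complex.exp_bound (x := I * x) (by rwa [hx]) (n := 3) (by norm_num)
    rw [hx] at this
    have e : Complex.exp (I * x) - 1 - I * x + x ^ 2 / 2 =
        Complex.exp (I * x) - ∑ m ∈ Finset.range 3, (I * x) ^ m / (m.factorial : ℂ) := by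
      simp [Finset.sum_range_succ, mul_pow]
      ring
    rw [e]
    refine this.trans ?_
    rw [mul_comm]
    gcongr
    norm_num [Nat.factorial]
  · have h2 : ‖(x : ℂ) ^ 2 / 2‖ = |x| ^ 2 / 2 := by simp
    have h3 : |x| ≤ |x| ^ 3 := le_self_pow₀ h.le (by norm_num)
    have h4 : |x| ^ 2 ≤ |x| ^ 3 := pow_le_pow_right₀ h.le (by norm_num)
    calc ‖Complex.exp (I * x) - 1 - I * x + x ^ 2 / 2‖
        ≤ ‖Complex.exp (I * x)‖ + ‖(1 : ℂ)‖ + ‖I * x‖ + ‖(x : ℂ) ^ 2 / 2‖ :=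
        (norm_add_le _ _).trans (add_le_add_left ((norm_sub_le _ _).trans
          (add_le_add_left (norm_sub_le _ _) _)) _)
      _ = 2 + |x| + |x| ^ 2 / 2 := by rw [h1, hx, norm_one, h2]; norm_num
      _ ≤ _ := by nlinarith

variable {d : ℕ} {ρ : Measure (Euc d)} [IsProbabilityMeasure ρ] [ρ.IsNegInvariant]
  {w : Tor d → Tor d → ℝ} {wm wp : ℝ} {χ : Fin d → Tor d → ℝ} {K : ℝ}

/-- Bounded solutions of the cell problems in the coordinate directions. -/
structure IsCorrector (ρ : Measure (Euc d)) (w : Tor d → Tor d → ℝ) (χ : Fin d → Tor d → ℝ)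
    (K : ℝ) : Prop where
  measurable : ∀ i, Measurable (χ i)
  bound : ∀ i t, |χ i t| ≤ K
  weak : ∀ i, IsWeakCorrector ρ w (fun z => z i) (χ i)
  nonneg : 0 ≤ K

lemma memLp_coord (hM : Integrable (fun z : Euc d => ‖z‖ ^ 2) ρ) (i : Fin d) :
    MemLp (fun z : Euc d => z i) 2 ρ := by
  have hm : Measurable fun z : Euc d => z i := by fun_prop
  refine (memLp_two_iff_integrable_sq hm.aestronglyMeasurable).2 ?_
  refine hM.mono' (hm.pow_const 2).aestronglyMeasurable (.of_forall fun z => ?_)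
  rw [norm_pow]
  gcongr
  exact PiLp.norm_apply_le z i

theorem exists_isCorrector (hw : IsConductance w wm wp) (hac : ρ ≪ volume)
    (hM : Integrable (fun z : Euc d => ‖z‖ ^ 2) ρ) : ∃ χ K, IsCorrector ρ w χ K := by
  choose χ K h1 h2 _ h4 using fun i : Fin d =>
    exists_bounded_corrector hw hac (memLp_coord hM i) (fun z => by simp)
  refine ⟨χ, ∑ i, |K i|, h1, fun i t => (h2 i t).trans ((le_abs_self _).trans ?_), h4,
    by positivity⟩
  exact Finset.single_le_sum (f := fun i => |K i|) (fun i _ => abs_nonneg _) (Finset.mem_univ i)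

/-- The phase `2π⟨z, ξ⟩`. -/
def phase (ξ z : Euc d) : ℝ := 2 * π * ⟪z, ξ⟫

/-- The corrector in the direction `2πξ`. -/
def dirCorrector (χ : Fin d → Tor d → ℝ) (ξ : Euc d) (t : Tor d) : ℝ :=
  2 * π * ∑ i, ξ i * χ i t

/-- The effective matrix. -/
def effMatrix (ρ : Measure (Euc d)) (w : Tor d → Tor d → ℝ) (χ : Fin d → Tor d → ℝ) :
    Matrix (Fin d) (Fin d) ℝ :=
  Matrix.of fun i j => (1 / 2) * ∫ p : Euc d × Tor d, w p.2 (p.2 - toTor p.1) *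
    ((p.1 i + (χ i p.2 - χ i (p.2 - toTor p.1))) * (p.1 j + (χ j p.2 - χ j (p.2 - toTor p.1))))
      ∂(ρ.prod volume)

/-- The Fourier symbol of `-div g ∇`. -/
def effSymbol (g : Matrix (Fin d) (Fin d) ℝ) (ξ : Euc d) : ℝ :=
  4 * π ^ 2 * ∑ i, ∑ j, g i j * (ξ i * ξ j)

/-- The nonlocal operator applied to `exp (2πi⟨x, ξ⟩) (1 + i η)`, divided by the exponential. -/
def fiber (ρ : Measure (Euc d)) (w : Tor d → Tor d → ℝ) (χ : Fin d → Tor d → ℝ) (ξ : Euc d)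
    (t : Tor d) : ℂ :=
  ∫ z, w t (t - toTor z) • ((1 + I * dirCorrector χ ξ t) -
    Complex.exp (I * (-phase ξ z : ℝ)) * (1 + I * dirCorrector χ ξ (t - toTor z))) ∂ρ

lemma phase_neg (ξ z : Euc d) : phase ξ (-z) = -phase ξ z := by simp [phase]

lemma phase_eq_sum (ξ z : Euc d) : phase ξ z = 2 * π * ∑ i, ξ i * z i := by
  rw [phase, PiLp.inner_apply]
  simp

lemma continuous_phase (ξ : Euc d) : Continuous (phase ξ) := by
  unfold phase
  fun_prop

lemma abs_phase_le (ξ z : Euc d) : |phase ξ z| ≤ 2 * π * (‖ξ‖ * ‖z‖) := by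
  rw [phase, abs_mul, abs_of_pos (by positivity : 0 < 2 * π), mul_comm ‖ξ‖]
  gcongr
  exact abs_real_inner_le_norm z ξ

lemma integrable_phase_pow {k : ℕ} (hM : Integrable (fun z : Euc d => ‖z‖ ^ k) ρ) (ξ : Euc d) :
    Integrable (fun z => |phase ξ z| ^ k) ρ := by
  refine (hM.const_mul ((2 * π * ‖ξ‖) ^ k)).mono'
    ((continuous_phase ξ).abs.pow k).aestronglyMeasurable (.of_forall fun z => ?_)
  rw [norm_pow, norm_abs_eq_norm, ← mul_pow, Real.norm_eq_abs]
  gcongr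
  exact (abs_phase_le ξ z).trans_eq (by ring)

lemma integral_phase_pow_le {k : ℕ} (hM : Integrable (fun z : Euc d => ‖z‖ ^ k) ρ) (ξ : Euc d) :
    ∫ z, |phase ξ z| ^ k ∂ρ ≤ (2 * π * ‖ξ‖) ^ k * ∫ z, ‖z‖ ^ k ∂ρ := by
  rw [← integral_const_mul]
  refine integral_mono (integrable_phase_pow hM ξ) (hM.const_mul _) fun z => ?_
  dsimp only
  rw [← mul_pow]
  gcongr
  exact (abs_phase_le ξ z).trans_eq (by ring)

lemma memLp_phase (hM : Integrable (fun z : Euc d => ‖z‖ ^ 2) ρ) (ξ : Euc d) :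
    MemLp (phase ξ) 2 ρ := by
  refine (memLp_two_iff_integrable_sq (continuous_phase ξ).aestronglyMeasurable).2 ?_
  simpa using integrable_phase_pow hM ξ

namespace IsCorrector

variable (hχ : IsCorrector ρ w χ K)
include hχ

lemma measurable_dirCorrector (ξ : Euc d) : Measurable (dirCorrector χ ξ) := by
  unfold dirCorrector
  have := hχ.measurable
  fun_prop

lemma abs_dirCorrector_le (ξ : Euc d) (t : Tor d) : |dirCorrector χ ξ t| ≤ 2 * π * d * K * ‖ξ‖ := by
  rw [dirCorrector, abs_mul, abs_of_pos (by positivity : 0 < 2 * π)]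
  calc 2 * π * |∑ i, ξ i * χ i t| ≤ 2 * π * ∑ i : Fin d, ‖ξ‖ * K := by
        gcongr
        refine (Finset.abs_sum_le_sum_abs _ _).trans (Finset.sum_le_sum fun i _ => ?_)
        rw [abs_mul]
        exact mul_le_mul (PiLp.norm_apply_le ξ i) (hχ.bound i t) (abs_nonneg _) (norm_nonneg _)
    _ = _ := by simp; ring

lemma memLp (i : Fin d) : MemLp (χ i) 2 :=
  MemLp.of_bound (hχ.measurable i).aestronglyMeasurable K (.of_forall fun t => hχ.bound i t)

lemma memLp_dirCorrector (ξ : Euc d) : MemLp (dirCorrector χ ξ) 2 :=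
  MemLp.of_bound (hχ.measurable_dirCorrector ξ).aestronglyMeasurable _
    (.of_forall fun t => hχ.abs_dirCorrector_le ξ t)

lemma weak_dirCorrector (hw : IsConductance w wm wp)
    (hM : Integrable (fun z : Euc d => ‖z‖ ^ 2) ρ) (ξ : Euc d) :
    IsWeakCorrector ρ w (phase ξ) (dirCorrector χ ξ) := by
  intro v hv
  have e : ∀ p : Euc d × Tor d, w p.2 (p.2 - toTor p.1) *
      (phase ξ p.1 + (dirCorrector χ ξ p.2 - dirCorrector χ ξ (p.2 - toTor p.1))) *
        (v p.2 - v (p.2 - toTor p.1)) = ∑ i, 2 * π * ξ i * (w p.2 (p.2 - toTor p.1) *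
        (p.1 i + (χ i p.2 - χ i (p.2 - toTor p.1))) * (v p.2 - v (p.2 - toTor p.1))) := by
    intro p
    rw [phase_eq_sum, dirCorrector, dirCorrector, ← mul_sub, ← mul_add, ← Finset.sum_sub_distrib,
      ← Finset.sum_add_distrib, Finset.mul_sum, Finset.mul_sum, Finset.sum_mul]
    refine Finset.sum_congr rfl fun i _ => ?_
    ring
  simp only [e]
  rw [integral_finsetSum]
  · refine Finset.sum_eq_zero fun i _ => ?_
    rw [integral_const_mul, hχ.weak i v hv, mul_zero]
  · intro i _
    refine Integrable.const_mul ?_ _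
    simp only [mul_assoc]
    exact hw.integrable_smul measurable_toTor ((memLp_flux (memLp_coord hM i)
      (hχ.memLp i)).integrable_mul ((memLp_comp_snd hv).sub (memLp_comp_shift hv)))

lemma effSymbol_eq (hw : IsConductance w wm wp)
    (hM : Integrable (fun z : Euc d => ‖z‖ ^ 2) ρ) (ξ : Euc d) :
    effSymbol (effMatrix ρ w χ) ξ = (1 / 2) * ∫ p : Euc d × Tor d, w p.2 (p.2 - toTor p.1) *
      (phase ξ p.1 + (dirCorrector χ ξ p.2 - dirCorrector χ ξ (p.2 - toTor p.1))) ^ 2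
        ∂(ρ.prod volume) := by
  have e : ∀ p : Euc d × Tor d, w p.2 (p.2 - toTor p.1) *
      (phase ξ p.1 + (dirCorrector χ ξ p.2 - dirCorrector χ ξ (p.2 - toTor p.1))) ^ 2 =
      ∑ i, ∑ j, 4 * π ^ 2 * (ξ i * ξ j) * (w p.2 (p.2 - toTor p.1) *
        ((p.1 i + (χ i p.2 - χ i (p.2 - toTor p.1))) *
          (p.1 j + (χ j p.2 - χ j (p.2 - toTor p.1))))) := by
    intro p
    rw [phase_eq_sum, dirCorrector, dirCorrector, ← mul_sub, ← mul_add, ← Finset.sum_sub_distrib,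
      ← Finset.sum_add_distrib, mul_pow, sq (∑ i, _), Finset.sum_mul_sum, Finset.mul_sum,
      Finset.mul_sum]
    refine Finset.sum_congr rfl fun i _ => ?_
    rw [Finset.mul_sum, Finset.mul_sum]
    refine Finset.sum_congr rfl fun j _ => ?_
    ring
  have hI (i j : Fin d) : Integrable (fun p : Euc d × Tor d => 4 * π ^ 2 * (ξ i * ξ j) *
      (w p.2 (p.2 - toTor p.1) *
        ((p.1 i + (χ i p.2 - χ i (p.2 - toTor p.1))) *
          (p.1 j + (χ j p.2 - χ j (p.2 - toTor p.1)))))) (ρ.prod volume) := by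
    refine Integrable.const_mul ?_ _
    exact hw.integrable_smul measurable_toTor ((memLp_flux (memLp_coord hM i)
      (hχ.memLp i)).integrable_mul (memLp_flux (memLp_coord hM j) (hχ.memLp j)))
  simp only [e]
  rw [integral_finsetSum _ fun i _ => integrable_finsetSum _ fun j _ => hI i j, effSymbol,
    Finset.mul_sum, Finset.mul_sum]
  refine Finset.sum_congr rfl fun i _ => ?_
  rw [integral_finsetSum _ fun j _ => hI i j, Finset.mul_sum, Finset.mul_sum]
  refine Finset.sum_congr rfl fun j _ => ?_
  rw [integral_const_mul, effMatrix, Matrix.of_apply]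
  ring

end IsCorrector

lemma effMatrix_isSymm : (effMatrix ρ w χ).IsSymm := by
  ext i j
  simp only [effMatrix, Matrix.transpose_apply, Matrix.of_apply]
  congr 2
  ext p
  rw [mul_comm (p.1 j + _)]

end Fiber

section FiberEstimates

open scoped RealInnerProductSpace
open Complex (I)

variable {d : ℕ} {ρ : Measure (Euc d)} [IsProbabilityMeasure ρ] [ρ.IsNegInvariant]
  {w : Tor d → Tor d → ℝ} {wm wp : ℝ} {χ : Fin d → Tor d → ℝ} {K : ℝ}

/-- The part of the integrand of `fiber` of second order in `ξ`. -/
def fiberRem (χ : Fin d → Tor d → ℝ) (ξ : Euc d) (p : Euc d × Tor d) : ℂ :=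
  -(Complex.exp (I * (-phase ξ p.1 : ℝ)) - 1 - I * (-phase ξ p.1 : ℝ)) -
    I * dirCorrector χ ξ (p.2 - toTor p.1) * (Complex.exp (I * (-phase ξ p.1 : ℝ)) - 1)

/-- The second order Taylor coefficient of `fiberRem`. -/
def fiberMain (χ : Fin d → Tor d → ℝ) (ξ : Euc d) (p : Euc d × Tor d) : ℝ :=
  phase ξ p.1 ^ 2 / 2 - dirCorrector χ ξ (p.2 - toTor p.1) * phase ξ p.1

lemma fiber_eq (ξ : Euc d) (t : Tor d) :
    fiber ρ w χ ξ t = ∫ z, w t (t - toTor z) • (I * ((phase ξ z +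
      (dirCorrector χ ξ t - dirCorrector χ ξ (t - toTor z)) : ℝ) : ℂ) +
        fiberRem χ ξ (z, t)) ∂ρ := by
  refine integral_congr_ae (.of_forall fun z => ?_)
  dsimp only [fiberRem]
  congr 1
  push_cast
  ring

namespace IsCorrector

variable (hχ : IsCorrector ρ w χ K)
include hχ

lemma norm_fiberRem_le (ξ : Euc d) (p : Euc d × Tor d) :
    ‖fiberRem χ ξ p‖ ≤ 3 * |phase ξ p.1| ^ 2 + 2 * π * d * K * ‖ξ‖ * |phase ξ p.1| := by
  rw [fiberRem]
  refine (norm_sub_le _ _).trans ?_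
  rw [norm_neg, norm_mul, norm_mul, Complex.norm_I, one_mul, Complex.norm_real]
  refine add_le_add ?_ (mul_le_mul (hχ.abs_dirCorrector_le ξ _) ?_ (norm_nonneg _) ?_)
  · simpa using norm_exp_sub_one_sub_le (-phase ξ p.1)
  · simpa using Real.norm_exp_I_mul_ofReal_sub_one_le (x := -phase ξ p.1)
  · have := hχ.nonneg
    positivity

lemma norm_fiberRem_sub_fiberMain_le (ξ : Euc d) (p : Euc d × Tor d) :
    ‖fiberRem χ ξ p - fiberMain χ ξ p‖ ≤
      4 * |phase ξ p.1| ^ 3 + 2 * π * d * K * ‖ξ‖ * (3 * |phase ξ p.1| ^ 2) := by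
  have e : fiberRem χ ξ p - fiberMain χ ξ p =
      -(Complex.exp (I * (-phase ξ p.1 : ℝ)) - 1 - I * (-phase ξ p.1 : ℝ) +
        ((-phase ξ p.1 : ℝ) : ℂ) ^ 2 / 2) -
      I * dirCorrector χ ξ (p.2 - toTor p.1) *
        (Complex.exp (I * (-phase ξ p.1 : ℝ)) - 1 - I * (-phase ξ p.1 : ℝ)) := by
    rw [fiberRem, fiberMain]
    push_cast
    linear_combination (dirCorrector χ ξ (p.2 - toTor p.1) * phase ξ p.1 : ℂ) * Complex.I_sq
  rw [e]
  refine (norm_sub_le _ _).trans ?_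
  rw [norm_neg, norm_mul, norm_mul, Complex.norm_I, one_mul, Complex.norm_real]
  refine add_le_add ?_ (mul_le_mul (hχ.abs_dirCorrector_le ξ _) ?_ (norm_nonneg _) ?_)
  · simpa using norm_exp_sub_one_sub_sub_le (-phase ξ p.1)
  · simpa using norm_exp_sub_one_sub_le (-phase ξ p.1)
  · have := hχ.nonneg
    positivity

lemma measurable_fiberRem (ξ : Euc d) : Measurable (fiberRem χ ξ) := by
  have h1 := (hχ.measurable_dirCorrector ξ).comp
    (measurable_snd.sub (measurable_toTor.comp measurable_fst) :
      Measurable fun p : Euc d × Tor d => p.2 - toTor p.1)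
  have h2 := (continuous_phase ξ).measurable.comp
      (measurable_fst : Measurable (Prod.fst : Euc d × Tor d → _))
  simp only [Function.comp_def] at h1 h2
  unfold fiberRem
  fun_prop

lemma integrable_fiberRem_bound (hM1 : Integrable (fun z : Euc d => ‖z‖ ^ 1) ρ)
    (hM2 : Integrable (fun z : Euc d => ‖z‖ ^ 2) ρ) (ξ : Euc d) :
    Integrable (fun z => 3 * |phase ξ z| ^ 2 + 2 * π * d * K * ‖ξ‖ * |phase ξ z|) ρ := by
  have h1 := integrable_phase_pow hM1 ξ
  simp only [pow_one] at h1
  exact ((integrable_phase_pow hM2 ξ).const_mul _).add (h1.const_mul _)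

lemma integrable_fiberRem (hM1 : Integrable (fun z : Euc d => ‖z‖ ^ 1) ρ)
    (hM2 : Integrable (fun z : Euc d => ‖z‖ ^ 2) ρ) (ξ : Euc d) :
    Integrable (fiberRem χ ξ) (ρ.prod volume) :=
  ((hχ.integrable_fiberRem_bound hM1 hM2 ξ).comp_fst volume).mono'
    (hχ.measurable_fiberRem ξ).aestronglyMeasurable (.of_forall (hχ.norm_fiberRem_le ξ))

lemma integrable_fiberMain (hM2 : Integrable (fun z : Euc d => ‖z‖ ^ 2) ρ) (ξ : Euc d) :
    Integrable (fiberMain χ ξ) (ρ.prod volume) := by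
  have h1 := (memLp_phase hM2 ξ).comp_measurePreserving
    (measurePreserving_fst (μ := ρ) (ν := (volume : Measure (Tor d))))
  exact (h1.integrable_sq.div_const 2).sub
    ((memLp_comp_shift (hχ.memLp_dirCorrector ξ)).integrable_mul h1)

lemma integrable_flux (hM2 : Integrable (fun z : Euc d => ‖z‖ ^ 2) ρ) (ξ : Euc d) :
    Integrable (fun p : Euc d × Tor d => I * ((phase ξ p.1 +
      (dirCorrector χ ξ p.2 - dirCorrector χ ξ (p.2 - toTor p.1)) : ℝ) : ℂ)) (ρ.prod volume) :=
  ((memLp_flux (memLp_phase hM2 ξ) (hχ.memLp_dirCorrector ξ)).integrable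
      one_le_two).ofReal.const_mul I

lemma exists_norm_fiber_le (hw : IsConductance w wm wp)
    (hM1 : Integrable (fun z : Euc d => ‖z‖ ^ 1) ρ)
    (hM2 : Integrable (fun z : Euc d => ‖z‖ ^ 2) ρ) :
    ∃ C, 0 ≤ C ∧ ∀ ξ, ∀ᵐ t, ‖fiber ρ w χ ξ t‖ ≤ C * ‖ξ‖ ^ 2 := by
  have hwp : 0 ≤ wp := (norm_nonneg _).trans (hw.norm_le 0 0)
  have hK := hχ.nonneg
  refine ⟨wp * (3 * ((2 * π) ^ 2 * ∫ z, ‖z‖ ^ 2 ∂ρ) +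
    2 * π * d * K * (2 * π * ∫ z, ‖z‖ ^ 1 ∂ρ)), by positivity, fun ξ => ?_⟩
  have h0 := (hχ.weak_dirCorrector hw hM2 ξ).ae_eq_zero hw (memLp_phase hM2 ξ) (phase_neg ξ)
    (hχ.memLp_dirCorrector ξ)
  have hI1 := (hw.integrable_smul (Z := Euc d) measurable_toTor
      (hχ.integrable_flux hM2 ξ)).prod_left_ae
  filter_upwards [h0, hI1] with t h0 h1
  have hb := hχ.integrable_fiberRem_bound hM1 hM2 ξ
  have hle (z : Euc d) : ‖w t (t - toTor z) • fiberRem χ ξ (z, t)‖ ≤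
      wp * (3 * |phase ξ z| ^ 2 + 2 * π * d * K * ‖ξ‖ * |phase ξ z|) := by
    rw [norm_smul]
    exact mul_le_mul (hw.norm_le _ _) (hχ.norm_fiberRem_le ξ (z, t)) (norm_nonneg _) hwp
  have hwt : Measurable fun z => w t (t - toTor z) :=
    (hw.measurable_comp (Z := Euc d) measurable_toTor).comp measurable_prodMk_right
  have hRt : Measurable fun z => fiberRem χ ξ (z, t) :=
    (hχ.measurable_fiberRem ξ).comp measurable_prodMk_right
  have h2 : Integrable (fun z => w t (t - toTor z) • fiberRem χ ξ (z, t)) ρ :=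
    (hb.const_mul wp).mono' (hwt.smul hRt).aestronglyMeasurable (.of_forall hle)
  have e : fiber ρ w χ ξ t = ∫ z, w t (t - toTor z) • fiberRem χ ξ (z, t) ∂ρ := by
    rw [fiber_eq]
    simp only [smul_add]
    rw [integral_add h1 h2]
    have e1 (z : Euc d) : w t (t - toTor z) • (I * ((phase ξ z +
        (dirCorrector χ ξ t - dirCorrector χ ξ (t - toTor z)) : ℝ) : ℂ)) =
        I * ((w t (t - toTor z) * (phase ξ z +
        (dirCorrector χ ξ t - dirCorrector χ ξ (t - toTor z))) : ℝ) : ℂ) := by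
      rw [Complex.real_smul]
      push_cast
      ring
    simp only [e1]
    rw [integral_const_mul, integral_complex_ofReal, h0]
    simp
  rw [e]
  refine (norm_integral_le_of_norm_le (hb.const_mul wp) (.of_forall hle)).trans ?_
  have p1 := integral_phase_pow_le hM1 ξ
  have p2 := integral_phase_pow_le hM2 ξ
  have hi1 := integrable_phase_pow hM1 ξ
  simp only [pow_one] at p1 hi1
  rw [integral_const_mul, integral_add ((integrable_phase_pow hM2 ξ).const_mul _)
    (hi1.const_mul _), integral_const_mul, integral_const_mul]
  simp only [pow_one]
  calc _ ≤ wp * (3 * ((2 * π * ‖ξ‖) ^ 2 * ∫ z, ‖z‖ ^ 2 ∂ρ) +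
        2 * π * d * K * ‖ξ‖ * (2 * π * ‖ξ‖ * ∫ z, ‖z‖ ∂ρ)) := by gcongr
    _ = _ := by ring

lemma effSymbol_eq_integral_fiberMain (hw : IsConductance w wm wp)
    (hM2 : Integrable (fun z : Euc d => ‖z‖ ^ 2) ρ) (ξ : Euc d) :
    effSymbol (effMatrix ρ w χ) ξ =
      ∫ p : Euc d × Tor d, w p.2 (p.2 - toTor p.1) * fiberMain χ ξ p ∂(ρ.prod volume) := by
  have hθ := (memLp_phase hM2 ξ).comp_measurePreserving
    (measurePreserving_fst (μ := ρ) (ν := (volume : Measure (Tor d))))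
  have hη := hχ.memLp_dirCorrector ξ
  have hf := memLp_flux (memLp_phase hM2 ξ) hη
  have hη1 := memLp_comp_snd (ρ := ρ) hη
  have hη2 := memLp_comp_shift (ρ := ρ) hη
  have h1 := hχ.weak_dirCorrector hw hM2 ξ _ hη
  have hI1 : Integrable (fun p : Euc d × Tor d => w p.2 (p.2 - toTor p.1) *
      (phase ξ p.1 + (dirCorrector χ ξ p.2 - dirCorrector χ ξ (p.2 - toTor p.1))) *
        (dirCorrector χ ξ p.2 - dirCorrector χ ξ (p.2 - toTor p.1))) (ρ.prod volume) := by
    simp only [mul_assoc]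
    exact hw.integrable_smul measurable_toTor (hf.integrable_mul (hη1.sub hη2))
  have hI2 : Integrable (fun p : Euc d × Tor d => w p.2 (p.2 - toTor p.1) *
      (phase ξ p.1 * dirCorrector χ ξ p.2)) (ρ.prod volume) :=
    hw.integrable_smul measurable_toTor (hθ.integrable_mul hη1)
  have hI2' := integrable_comp_flip (m := (volume : Measure (Tor d))) measurable_toTor hI2
  have hI3 : Integrable (fun p : Euc d × Tor d => w p.2 (p.2 - toTor p.1) * fiberMain χ ξ p)
      (ρ.prod volume) := hw.integrable_smul measurable_toTor (hχ.integrable_fiberMain hM2 ξ)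
  have h2 := integral_comp_flip (ρ := ρ) (m := (volume : Measure (Tor d))) measurable_toTor
    (fun p : Euc d × Tor d => w p.2 (p.2 - toTor p.1) * (phase ξ p.1 * dirCorrector χ ξ p.2))
  have e (p : Euc d × Tor d) : w p.2 (p.2 - toTor p.1) *
      (phase ξ p.1 + (dirCorrector χ ξ p.2 - dirCorrector χ ξ (p.2 - toTor p.1))) ^ 2 =
      ((w p.2 (p.2 - toTor p.1) *
      (phase ξ p.1 + (dirCorrector χ ξ p.2 - dirCorrector χ ξ (p.2 - toTor p.1))) *
        (dirCorrector χ ξ p.2 - dirCorrector χ ξ (p.2 - toTor p.1)) +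
      2 * (w p.2 (p.2 - toTor p.1) * fiberMain χ ξ p)) +
      w p.2 (p.2 - toTor p.1) * (phase ξ p.1 * dirCorrector χ ξ p.2)) +
      w (flip toTor p).2 ((flip toTor p).2 - toTor (flip toTor p).1) *
        (phase ξ (flip toTor p).1 * dirCorrector χ ξ (flip toTor p).2) * (-1) := by
    rw [fiberMain]
    simp only [flip_fst, flip_snd, map_neg, sub_neg_eq_add, sub_add_cancel, phase_neg,
      hw.symm (p.2 - toTor p.1) p.2]
    ring
  rw [hχ.effSymbol_eq hw hM2]
  simp only [e]
  have hI4 := hI1.add (hI3.const_mul 2)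
  have hI5 := hI4.add hI2
  simp only [Pi.add_def] at hI4 hI5
  rw [integral_add hI5 (hI2'.mul_const _), integral_add hI4 hI2, integral_add hI1 (hI3.const_mul 2),
    integral_mul_const, h1, h2, integral_const_mul]
  ring

lemma exists_norm_integral_fiber_sub_le (hw : IsConductance w wm wp)
    (hM1 : Integrable (fun z : Euc d => ‖z‖ ^ 1) ρ)
    (hM2 : Integrable (fun z : Euc d => ‖z‖ ^ 2) ρ)
    (hM3 : Integrable (fun z : Euc d => ‖z‖ ^ 3) ρ) :
    ∃ C, 0 ≤ C ∧ ∀ ξ, ‖(∫ t, fiber ρ w χ ξ t) - effSymbol (effMatrix ρ w χ) ξ‖ ≤ C * ‖ξ‖ ^ 3 := by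
  have hwp : 0 ≤ wp := (norm_nonneg _).trans (hw.norm_le 0 0)
  have hK := hχ.nonneg
  refine ⟨wp * (4 * ((2 * π) ^ 3 * ∫ z, ‖z‖ ^ 3 ∂ρ) +
    2 * π * d * K * (3 * ((2 * π) ^ 2 * ∫ z, ‖z‖ ^ 2 ∂ρ))), by positivity, fun ξ => ?_⟩
  have hI1 := hw.integrable_smul (Z := Euc d) measurable_toTor (hχ.integrable_flux hM2 ξ)
  have hI2 := hw.integrable_smul (Z := Euc d) measurable_toTor (hχ.integrable_fiberRem hM1 hM2 ξ)
  have hI3 : Integrable (fun p : Euc d × Tor d => w p.2 (p.2 - toTor p.1) •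
      ((fiberMain χ ξ p : ℝ) : ℂ)) (ρ.prod volume) :=
    hw.integrable_smul (Z := Euc d) measurable_toTor (hχ.integrable_fiberMain hM2 ξ).ofReal
  have hI12 := hI1.add hI2
  simp only [Pi.add_def, ← smul_add] at hI12
  have h0 := (hχ.weak_dirCorrector hw hM2 ξ).integral_mul_eq_zero hw (memLp_phase hM2 ξ)
    (phase_neg ξ) (hχ.memLp_dirCorrector ξ) (v := fun _ => 1) (memLp_const 1)
  have e1 : ∫ t, fiber ρ w χ ξ t =
      ∫ p : Euc d × Tor d, w p.2 (p.2 - toTor p.1) • fiberRem χ ξ p ∂(ρ.prod volume) := by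
    simp only [fiber_eq]
    refine (integral_prod_symm _ hI12).symm.trans ?_
    simp only [smul_add]
    rw [integral_add hI1 hI2]
    have e1 (p : Euc d × Tor d) : w p.2 (p.2 - toTor p.1) • (I * ((phase ξ p.1 +
        (dirCorrector χ ξ p.2 - dirCorrector χ ξ (p.2 - toTor p.1)) : ℝ) : ℂ)) =
        I * ((w p.2 (p.2 - toTor p.1) * (phase ξ p.1 +
        (dirCorrector χ ξ p.2 - dirCorrector χ ξ (p.2 - toTor p.1))) : ℝ) : ℂ) := by
      rw [Complex.real_smul]
      push_cast
      ring
    simp only [mul_one] at h0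
    simp only [e1]
    rw [integral_const_mul, integral_complex_ofReal, h0]
    simp
  have e2 : (effSymbol (effMatrix ρ w χ) ξ : ℂ) = ∫ p : Euc d × Tor d,
      w p.2 (p.2 - toTor p.1) • ((fiberMain χ ξ p : ℝ) : ℂ) ∂(ρ.prod volume) := by
    rw [hχ.effSymbol_eq_integral_fiberMain hw hM2, ← integral_complex_ofReal]
    simp only [Complex.real_smul, Complex.ofReal_mul]
  have hb1 := (integrable_phase_pow hM3 ξ).const_mul 4
  have hb2 := ((integrable_phase_pow hM2 ξ).const_mul 3).const_mul (2 * π * d * K * ‖ξ‖)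
  have hb : Integrable
      (fun z => 4 * |phase ξ z| ^ 3 + 2 * π * d * K * ‖ξ‖ * (3 * |phase ξ z| ^ 2)) ρ :=
    hb1.add hb2
  rw [e1, e2, ← integral_sub hI2 hI3]
  refine (norm_integral_le_of_norm_le ((hb.const_mul wp).comp_fst volume)
      (.of_forall fun p => ?_)).trans ?_
  · rw [← smul_sub, norm_smul]
    exact mul_le_mul (hw.norm_le _ _) (hχ.norm_fiberRem_sub_fiberMain_le ξ p) (norm_nonneg _) hwp
  rw [integral_fun_fst (fun z => wp * (4 * |phase ξ z| ^ 3 + 2 * π * d * K * ‖ξ‖ *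
      (3 * |phase ξ z| ^ 2)))]
  simp only [probReal_univ, one_smul]
  rw [integral_const_mul, integral_add hb1 hb2, integral_const_mul, integral_const_mul,
      integral_const_mul]
  have p2 := integral_phase_pow_le hM2 ξ
  have p3 := integral_phase_pow_le hM3 ξ
  calc _ ≤ wp * (4 * ((2 * π * ‖ξ‖) ^ 3 * ∫ z, ‖z‖ ^ 3 ∂ρ) +
        2 * π * d * K * ‖ξ‖ * (3 * ((2 * π * ‖ξ‖) ^ 2 * ∫ z, ‖z‖ ^ 2 ∂ρ))) := by gcongr
    _ = _ := by ring

lemma exists_effSymbol_ge (hw : IsConductance w wm wp) (hac : ρ ≪ volume)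
    (hM2 : Integrable (fun z : Euc d => ‖z‖ ^ 2) ρ) :
    ∃ c, 0 < c ∧ ∀ ξ, c * ‖ξ‖ ^ 2 ≤ effSymbol (effMatrix ρ w χ) ξ := by
  obtain ⟨c, hc0, hc⟩ := exists_symbol_ge hac
  refine ⟨wm * c, mul_pos hw.pos hc0, ?_⟩
  have h1 (ξ : Euc d) : wm * (1 / 2 * ∫ z, phase ξ z ^ 2 ∂ρ) ≤ effSymbol (effMatrix ρ w χ) ξ := by
    have hθ := (memLp_phase hM2 ξ).comp_measurePreserving
      (measurePreserving_fst (μ := ρ) (ν := (volume : Measure (Tor d))))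
    have hη := hχ.memLp_dirCorrector ξ
    have hf := memLp_flux (memLp_phase hM2 ξ) hη
    have hη1 := memLp_comp_snd (ρ := ρ) hη
    have hη2 := memLp_comp_shift (ρ := ρ) hη
    have hηd := hη1.sub hη2
    have hI1 := hθ.integrable_sq
    have hI2 := hθ.integrable_mul hηd
    simp only [Pi.mul_def, Pi.sub_apply, Function.comp_apply] at hI1 hI2
    have hI12 := hI1.add (hI2.const_mul 2)
    simp only [Pi.add_def] at hI12
    have h0 : ∫ p : Euc d × Tor d, phase ξ p.1 *
        (dirCorrector χ ξ p.2 - dirCorrector χ ξ (p.2 - toTor p.1)) ∂(ρ.prod volume) = 0 := by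
      rw [integral_prod _ hI2]
      have hsh (z : Euc d) : Integrable fun t => dirCorrector χ ξ (t - toTor z) :=
        (hη.integrable one_le_two).comp_sub_right (toTor z)
      simp [integral_const_mul, integral_sub (hη.integrable one_le_two) (hsh _),
        integral_sub_right_eq_self (dirCorrector χ ξ)]
    have h2 : ∫ z, phase ξ z ^ 2 ∂ρ ≤ ∫ p : Euc d × Tor d, (phase ξ p.1 +
        (dirCorrector χ ξ p.2 - dirCorrector χ ξ (p.2 - toTor p.1))) ^ 2 ∂(ρ.prod volume) := by
      calc ∫ z, phase ξ z ^ 2 ∂ρ = ∫ p : Euc d × Tor d, (phase ξ p.1 ^ 2 + 2 * (phase ξ p.1 *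
            (dirCorrector χ ξ p.2 - dirCorrector χ ξ (p.2 - toTor p.1)))) ∂(ρ.prod volume) := by
            rw [integral_add hI1 (hI2.const_mul 2), integral_const_mul, h0,
              integral_fun_fst (fun z => phase ξ z ^ 2)]
            simp
        _ ≤ _ := integral_mono hI12 hf.integrable_sq fun p => by
            dsimp only
            nlinarith [sq_nonneg (dirCorrector χ ξ p.2 - dirCorrector χ ξ (p.2 - toTor p.1))]
    rw [hχ.effSymbol_eq hw hM2]
    calc _ ≤ wm * (1 / 2 * ∫ p : Euc d × Tor d, (phase ξ p.1 +
        (dirCorrector χ ξ p.2 - dirCorrector χ ξ (p.2 - toTor p.1))) ^ 2 ∂(ρ.prod volume)) := by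
          have := hw.pos.le
          gcongr
      _ = 1 / 2 * ∫ p : Euc d × Tor d, wm * (phase ξ p.1 +
        (dirCorrector χ ξ p.2 - dirCorrector χ ξ (p.2 - toTor p.1))) ^ 2 ∂(ρ.prod volume) := by
          rw [integral_const_mul]
          ring
      _ ≤ _ := by
          refine mul_le_mul_of_nonneg_left ?_ (by norm_num)
          refine integral_mono (hf.integrable_sq.const_mul wm)
            (hw.integrable_smul measurable_toTor hf.integrable_sq) fun p => ?_
          exact mul_le_mul_of_nonneg_right (hw.lower _ _) (sq_nonneg _)
  have h2 (ξ : Euc d) : symbol ρ ξ ≤ 1 / 2 * ∫ z, phase ξ z ^ 2 ∂ρ := by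
    rw [← integral_const_mul]
    have hI := integrable_phase_pow hM2 ξ
    simp only [sq_abs] at hI
    refine integral_mono (integrable_one_sub_cos ξ) (hI.const_mul _) fun z => ?_
    have := Real.one_sub_sq_div_two_le_cos (x := phase ξ z)
    simp only [phase] at this ⊢
    linarith
  have h3 (ξ : Euc d) (hξ : ‖ξ‖ = 1) : wm * c ≤ effSymbol (effMatrix ρ w χ) ξ := by
    refine le_trans ?_ (h1 ξ)
    have := hc ξ
    rw [hξ] at this
    norm_num at this
    exact mul_le_mul_of_nonneg_left (this.trans (h2 ξ)) hw.pos.le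
  intro ξ
  rcases eq_or_ne ξ 0 with rfl | hξ
  · simp [effSymbol]
  · have hn : ‖ξ‖ ≠ 0 := norm_ne_zero_iff.2 hξ
    have h4 := h3 (‖ξ‖⁻¹ • ξ) (by rw [norm_smul, norm_inv, norm_norm, inv_mul_cancel₀ hn])
    have h5 : effSymbol (effMatrix ρ w χ) (‖ξ‖⁻¹ • ξ) * ‖ξ‖ ^ 2 =
        effSymbol (effMatrix ρ w χ) ξ := by
      simp only [effSymbol, PiLp.smul_apply, smul_eq_mul, mul_assoc, Finset.sum_mul]
      congr 2
      refine Finset.sum_congr rfl fun i _ => Finset.sum_congr rfl fun j _ => ?_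
      field_simp
    rw [← h5]
    gcongr

end IsCorrector

lemma posDef_of_effSymbol_ge {g : Matrix (Fin d) (Fin d) ℝ} (hg : g.IsSymm) {c : ℝ} (hc : 0 < c)
    (h : ∀ ξ, c * ‖ξ‖ ^ 2 ≤ effSymbol g ξ) : g.PosDef := by
  refine .of_dotProduct_mulVec_pos ?_ fun x hx => ?_
  · rw [Matrix.IsHermitian, Matrix.conjTranspose_eq_transpose_of_trivial]
    exact hg
  · have h1 := h (WithLp.toLp 2 x)
    have h2 : 0 < ‖(WithLp.toLp 2 x : Euc d)‖ := norm_pos_iff.2 (by simpa using hx)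
    have h3 : 0 < effSymbol g (WithLp.toLp 2 x) := lt_of_lt_of_le (by positivity) h1
    have h4 : 0 < 4 * π ^ 2 := by positivity
    have h5 := pos_of_mul_pos_right h3 h4.le
    refine h5.trans_eq ?_
    simp only [dotProduct, Matrix.mulVec, star_trivial, Finset.mul_sum]
    refine Finset.sum_congr rfl fun i _ => Finset.sum_congr rfl fun j _ => ?_
    ring

lemma exists_abs_effSymbol_le (g : Matrix (Fin d) (Fin d) ℝ) :
    ∃ C, 0 ≤ C ∧ ∀ ξ, |effSymbol g ξ| ≤ C * ‖ξ‖ ^ 2 := by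
  refine ⟨4 * π ^ 2 * ∑ i, ∑ j, |g i j|, by positivity, fun ξ => ?_⟩
  rw [effSymbol, abs_mul, abs_of_pos (by positivity : 0 < 4 * π ^ 2), mul_assoc (4 * π ^ 2),
    Finset.sum_mul]
  refine mul_le_mul_of_nonneg_left ?_ (by positivity)
  refine (Finset.abs_sum_le_sum_abs _ _).trans (Finset.sum_le_sum fun i _ => ?_)
  rw [Finset.sum_mul]
  refine (Finset.abs_sum_le_sum_abs _ _).trans (Finset.sum_le_sum fun j _ => ?_)
  rw [abs_mul, abs_mul, sq]
  have h1 := PiLp.norm_apply_le ξ i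
  have h2 := PiLp.norm_apply_le ξ j
  rw [Real.norm_eq_abs] at h1 h2
  gcongr

lemma continuous_effSymbol (g : Matrix (Fin d) (Fin d) ℝ) : Continuous (effSymbol g) := by
  unfold effSymbol
  fun_prop

end FiberEstimates

section Plancherel

open FourierTransform SchwartzMap

variable {d : ℕ} {f h : Euc d → ℂ}

lemma continuous_fourierInv (hf : Integrable f) : Continuous (𝓕⁻ f) :=
  VectorFourier.fourierIntegral_continuous continuous_fourierChar
    (show Continuous fun p : Euc d × Euc d => -(inner ℝ p.1 p.2) from continuous_inner.neg) hf

lemma integral_fourier_mul_fourierInv (Y : 𝓢(Euc d, ℂ)) (hh : Integrable h) :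
    ∫ ξ, (𝓕 Y) ξ * (𝓕⁻ h) ξ = ∫ x, Y x * h x := by
  have h1 := VectorFourier.integral_bilin_fourierIntegral_eq_flip (μ := volume) (ν := volume)
    (ContinuousLinearMap.mul ℂ ℂ) (L := -innerₗ (Euc d)) continuous_fourierChar
    (show Continuous fun p : Euc d × Euc d => -(inner ℝ p.1 p.2) from continuous_inner.neg) hh
        (𝓕 Y).integrable
  have h2 : VectorFourier.fourierIntegral 𝐞 volume (-innerₗ (Euc d)).flip (𝓕 Y : 𝓢(Euc d, ℂ)) =
      (Y : Euc d → ℂ) := by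
    have h3 : ((𝓕⁻ (𝓕 Y) : 𝓢(Euc d, ℂ)) : Euc d → ℂ) = Y := by rw [fourierInv_fourier_eq]
    rw [fourierInv_coe] at h3
    refine Eq.trans ?_ h3
    ext x
    simp [FourierTransformInv.fourierInv, VectorFourier.fourierIntegral, real_inner_comm]
  rw [h2] at h1
  simp only [ContinuousLinearMap.mul_apply'] at h1
  simp only [mul_comm _ ((𝓕⁻ h) _), mul_comm _ (h _)]
  exact h1

lemma integral_fourier_mul_left (Y : 𝓢(Euc d, ℂ)) (hh : Integrable h) :
    ∫ ξ, (𝓕 h) ξ * Y ξ = ∫ x, h x * (𝓕 Y) x := by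
  have h1 := VectorFourier.integral_bilin_fourierIntegral_eq_flip (μ := volume) (ν := volume)
    (ContinuousLinearMap.mul ℂ ℂ) (L := innerₗ (Euc d)) continuous_fourierChar
    (by simpa using! (continuous_inner (𝕜 := ℝ) (E := Euc d))) hh Y.integrable
  rw [flip_innerₗ] at h1
  exact h1

lemma lintegral_enorm_sq_fourier (h1 : Integrable h) (h2 : MemLp h 2) :
    ∫⁻ ξ, ‖(𝓕 h) ξ‖ₑ ^ 2 = ∫⁻ x, ‖h x‖ₑ ^ 2 := by
  have hc : Continuous (𝓕 h) := VectorFourier.fourierIntegral_continuous continuous_fourierChar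
    (by simpa using! (continuous_inner (𝕜 := ℝ) (E := Euc d))) h1
  have hae : ∀ᵐ ξ, (𝓕 h) ξ = (𝓕 (h2.toLp h) : Lp ℂ 2 (volume : Measure (Euc d))) ξ := by
    refine ae_eq_of_integral_contDiff_smul_eq hc.locallyIntegrable
      ((Lp.memLp _).locallyIntegrable one_le_two) fun g hg hgs => ?_
    have hg₁ : HasCompactSupport (Complex.ofRealCLM ∘ g) := hgs.comp_left rfl
    have hg₂ : ContDiff ℝ ((⊤ : ℕ∞) : WithTop ℕ∞) (Complex.ofRealCLM ∘ g) :=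
      Complex.ofRealCLM.contDiff.comp hg
    have e1 := integral_fourier_mul_left (hg₁.toSchwartzMap hg₂) h1
    have e2 := congrArg (fun T => T (hg₁.toSchwartzMap hg₂))
      (Lp.fourier_toTemperedDistribution_eq (h2.toLp h))
    simp only [TemperedDistribution.fourier_apply, Lp.toTemperedDistribution_apply] at e2
    have e3 : ∫ x, (𝓕 (hg₁.toSchwartzMap hg₂)) x • h2.toLp h x =
        ∫ x, h x * (𝓕 (hg₁.toSchwartzMap hg₂)) x := by
      refine integral_congr_ae ?_
      filter_upwards [h2.coeFn_toLp] with x hx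
      rw [hx, smul_eq_mul, mul_comm]
    rw [e3, ← e1] at e2
    simpa [mul_comm] using e2
  have e4 : eLpNorm (𝓕 h) 2 volume = eLpNorm h 2 volume := by
    rw [eLpNorm_congr_ae hae, ← Lp.enorm_def, ← ofReal_norm, Lp.norm_fourier_eq, ofReal_norm,
      Lp.enorm_toLp]
  have e5 (u : Euc d → ℂ) : ∫⁻ ξ, ‖u ξ‖ₑ ^ 2 = eLpNorm u 2 volume ^ 2 := by
    have := eLpNorm_nnreal_pow_eq_lintegral (f := u) (μ := (volume : Measure (Euc d)))
      (p := 2) two_ne_zero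
    simpa using this.symm
  rw [e5, e5, e4]

lemma lintegral_enorm_sq_fourierInv (h1 : Integrable h) (h2 : MemLp h 2) :
    ∫⁻ ξ, ‖(𝓕⁻ h) ξ‖ₑ ^ 2 = ∫⁻ x, ‖h x‖ₑ ^ 2 := by
  simp only [Real.fourierInv_eq_fourier_neg]
  rw [← lintegral_enorm_sq_fourier h1 h2]
  exact lintegral_neg_eq_self (μ := volume) fun ξ => ‖(𝓕 h) ξ‖ₑ ^ 2

end Plancherel

lemma lintegral_mul_sq_le {α : Type*} [MeasurableSpace α] {μ : Measure α} {f g : α → ℝ≥0∞}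
    (hf : AEMeasurable f μ) (hg : AEMeasurable g μ) :
    (∫⁻ x, f x * g x ∂μ) ^ 2 ≤ (∫⁻ x, f x ^ 2 ∂μ) * ∫⁻ x, g x ^ 2 ∂μ := by
  have h := ENNReal.lintegral_mul_le_Lp_mul_Lq μ Real.HolderConjugate.two_two hf hg
  have h2 := pow_le_pow_left₀ zero_le h 2
  rw [mul_pow, ← ENNReal.rpow_mul_natCast, ← ENNReal.rpow_mul_natCast] at h2
  simpa using h2

section BlochPairing

open FourierTransform SchwartzMap UnitAddTorus
open Complex (I)
open scoped RealInnerProductSpace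

variable {d : ℕ}

lemma ae_toTor {p : Tor d → Prop} (h : ∀ᵐ t, p t) : ∀ᵐ x : Euc d, p (toTor x) := by
  have hq : Measure.QuasiMeasurePreserving (toTor (d := d)) volume volume := by
    refine ⟨measurable_toTor, ?_⟩
    rw [← measurePreserving_unfold.map_eq, Measure.map_map measurable_toTor measurable_unfold,
      show (toTor ∘ unfold : (Fin d → ℤ) × Tor d → Tor d) = Prod.snd from
        funext fun p => toTor_unfold p]
    exact Measure.quasiMeasurePreserving_snd.absolutelyContinuous
  exact hq.ae h

/-- The plane wave of frequency `ξ`. -/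
def wave (ξ x : Euc d) : ℂ := Complex.exp ((phase ξ x : ℝ) * I)

lemma continuous_wave (ξ : Euc d) : Continuous (wave ξ) := by
  have := continuous_phase ξ
  unfold wave
  fun_prop

lemma norm_wave (ξ x : Euc d) : ‖wave ξ x‖ = 1 := Complex.norm_exp_ofReal_mul_I _

lemma wave_sub (ξ x z : Euc d) :
    wave ξ (x - z) = wave ξ x * Complex.exp (I * (-phase ξ z : ℝ)) := by
  rw [wave, wave, ← Complex.exp_add]
  congr 1
  simp only [phase, inner_sub_left]
  push_cast
  ring

lemma wave_mul_mFourier (ξ x : Euc d) (n : Fin d → ℤ) :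
    wave ξ x * mFourier (-n) (toTor x) = wave (ξ - intVec n) x := by
  have h : intVec (-n) = -intVec n := by ext i; simp
  rw [mFourier_toTor, h, wave, wave, ← Complex.exp_add]
  congr 1
  simp only [phase, inner_sub_right, inner_neg_right]
  push_cast
  ring

lemma fourierInv_eq_integral_wave (f : Euc d → ℂ) (ξ : Euc d) :
    (𝓕⁻ f) ξ = ∫ x, f x * wave ξ x := by
  rw [Real.fourierInv_eq']
  simp only [smul_eq_mul, mul_comm (f _)]
  rfl

lemma exists_norm_le_weight (V : 𝓢(Euc d, ℂ)) : ∃ K, 0 ≤ K ∧ ∀ x, ‖V x‖ ≤ K * weight x := by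
  have h (x : Euc d) := SchwartzMap.one_add_le_sup_seminorm_apply (𝕜 := ℂ) (m := (d + 1, 0))
    (k := d + 1) (n := 0) le_rfl le_rfl V x
  simp only [norm_iteratedFDeriv_zero] at h
  refine ⟨_, le_trans (by positivity) (h 0), fun x => ?_⟩
  rw [weight, ← div_eq_mul_inv, le_div_iff₀ (by positivity), mul_comm]
  exact h x

/-- Pairing a function times a plane wave with a periodic function: the mean of the periodic
function sees only the frequency `ξ`, the remainder sees the translates of `ξ` by the dual
lattice. -/
lemma enorm_integral_wave_mul_sub_le (V : 𝓢(Euc d, ℂ)) (ξ : Euc d) {F : Tor d → ℂ}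
    (hF : Measurable F) {K : ℝ} (hK0 : 0 ≤ K) (hK : ∀ᵐ t, ‖F t‖ ≤ K) :
    ‖(∫ x, V x * wave ξ x * F (toTor x)) - (∫ t, F t) * (𝓕⁻ (V : Euc d → ℂ)) ξ‖ₑ ^ 2 ≤
      ENNReal.ofReal K ^ 2 * ∑' n : Fin d → ℤ,
        if n = 0 then 0 else ‖(𝓕⁻ (V : Euc d → ℂ)) (ξ - intVec n)‖ₑ ^ 2 := by
  let F' : Tor d → ℂ := {t | ‖F t‖ ≤ K}.indicator F
  have hF' : Measurable F' := hF.indicator (measurableSet_le hF.norm measurable_const)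
  have hK' (t) : ‖F' t‖ ≤ K := by
    by_cases ht : ‖F t‖ ≤ K
    · simp [F', ht]
    · simp [F', ht, hK0]
  have hFF : ∀ᵐ t, F t = F' t := by
    filter_upwards [hK] with t ht
    simp [F', ht]
  let h : Euc d → ℂ := fun x => V x * wave ξ x
  have hh : Integrable h := V.integrable.mul_bdd (continuous_wave ξ).aestronglyMeasurable
    (.of_forall fun x => (norm_wave ξ x).le)
  obtain ⟨K0, hK0', hV⟩ := exists_norm_le_weight V
  obtain ⟨S, hS0, hS⟩ := exists_lintegral_weight_le (d := d)
  have hb := norm_periodization_le hS hS0 (h := h) (K := K0)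
    (fun x => by simpa [h, norm_wave] using hV x) hK0'
  have hP := integrable_periodization hh
  have hP2 : MemLp (periodization h) 2 := MemLp.of_bound hP.1 _ (.of_forall hb)
  have hcoef (n : Fin d → ℤ) : mFourierCoeff (periodization h) n =
      (𝓕⁻ (V : Euc d → ℂ)) (ξ - intVec n) := by
    rw [mFourierCoeff, fourierInv_eq_integral_wave]
    simp only [smul_eq_mul, mul_comm _ (periodization h _)]
    rw [← integral_mul_toTor hh (mFourier (-n)).continuous.measurable (K := 1)
      fun t => ((mFourier (-n)).norm_coe_le_norm t).trans mFourier_norm.le]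
    refine integral_congr_ae (.of_forall fun x => ?_)
    simp only [h, mul_assoc, wave_mul_mFourier]
  have hmean : ∫ t, periodization h t = (𝓕⁻ (V : Euc d → ℂ)) ξ := by
    rw [← mFourierCoeff_zero_index, hcoef]
    rw [show intVec (0 : Fin d → ℤ) = 0 by ext i; simp, sub_zero]
  have e1 : ∫ x, V x * wave ξ x * F (toTor x) = ∫ t, periodization h t * F' t := by
    rw [← integral_mul_toTor hh hF' hK']
    refine integral_congr_ae ?_
    filter_upwards [ae_toTor hFF] with x hx
    simp only [h, hx]
  have hFi : Integrable F' := Integrable.of_bound hF'.aestronglyMeasurable K (.of_forall hK')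
  have e2 : (∫ x, V x * wave ξ x * F (toTor x)) - (∫ t, F t) * (𝓕⁻ (V : Euc d → ℂ)) ξ =
      ∫ t, (periodization h t - ∫ s, periodization h s) * F' t := by
    rw [e1, integral_congr_ae hFF, ← hmean, mul_comm (∫ t, F' t), ← integral_const_mul]
    simp only [sub_mul]
    rw [integral_sub (hP.mul_bdd hF'.aestronglyMeasurable (.of_forall hK')) (hFi.const_mul _)]
  rw [e2]
  have hm : AEMeasurable fun t => ‖periodization h t - ∫ s, periodization h s‖ₑ :=
    (hP.1.aemeasurable.sub_const _).enorm
  calc _ ≤ (∫⁻ t, ‖periodization h t - ∫ s, periodization h s‖ₑ * ENNReal.ofReal K) ^ 2 := by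
        refine pow_le_pow_left₀ zero_le ((enorm_integral_le_lintegral_enorm _).trans
          (lintegral_mono fun t => ?_)) 2
        rw [enorm_mul]
        gcongr
        rw [← ofReal_norm]
        exact ENNReal.ofReal_le_ofReal (hK' t)
    _ ≤ (∫⁻ t, ‖periodization h t - ∫ s, periodization h s‖ₑ ^ 2) *
          ∫⁻ t : Tor d, ENNReal.ofReal K ^ 2 := lintegral_mul_sq_le hm aemeasurable_const
    _ = _ := by
        rw [lintegral_sub_mean_sq hP2]
        simp [hcoef, mul_comm]

end BlochPairing

section SpaceOperator

open FourierTransform SchwartzMap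
open Complex (I)
open scoped RealInnerProductSpace

variable {d : ℕ} {ρ : Measure (Euc d)} [IsProbabilityMeasure ρ] [ρ.IsNegInvariant]
  {w : Tor d → Tor d → ℝ} {wm wp : ℝ}

/-- The periodic extension of a conductance on the torus. -/
def liftCond (w : Tor d → Tor d → ℝ) (x y : Euc d) : ℝ := w (toTor x) (toTor y)

lemma IsConductance.liftCond (hw : IsConductance w wm wp) :
    IsConductance (liftCond w) wm wp where
  measurable := hw.measurable.comp ((measurable_toTor.comp measurable_fst).prodMk
    (measurable_toTor.comp measurable_snd))
  symm _ _ := hw.symm _ _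
  lower _ _ := hw.lower _ _
  upper _ _ := hw.upper _ _
  pos := hw.pos

/-- The nonlocal operator on `ℝ^d` with periodic conductance. -/
def spaceOp (ρ : Measure (Euc d)) (w : Tor d → Tor d → ℝ) (u : Euc d → ℂ) : Euc d → ℂ :=
  nonlocalOp ρ (AddMonoidHom.id (Euc d)) (liftCond w) u

lemma measurePreserving_sub_prod :
    MeasurePreserving (fun p : Euc d × Euc d => p.2 - p.1) (ρ.prod volume) volume := by
  have h := measurePreserving_flip (Z := Euc d) (G := Euc d) (ρ := ρ) (m := volume)
    (j := AddMonoidHom.id (Euc d)) measurable_id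
  exact (measurePreserving_snd (μ := ρ) (ν := (volume : Measure (Euc d)))).comp h

lemma integrable_sub_prod {V : Euc d → ℂ} (hV : Integrable V) :
    Integrable (fun p : Euc d × Euc d => V p.2 - V (p.2 - p.1)) (ρ.prod volume) :=
  (hV.comp_snd ρ).sub (measurePreserving_sub_prod.integrable_comp_of_integrable hV)

lemma integrable_spaceOp (hw : IsConductance w wm wp) {V : Euc d → ℂ} (hV : Integrable V) :
    Integrable (spaceOp ρ w V) :=
  (hw.liftCond.integrable_smul (j := AddMonoidHom.id (Euc d)) measurable_id
    (integrable_sub_prod hV)).integral_prod_right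

lemma norm_spaceOp_le (hw : IsConductance w wm wp) {V : Euc d → ℂ} {B : ℝ}
    (hB : ∀ x, ‖V x‖ ≤ B) (x : Euc d) : ‖spaceOp ρ w V x‖ ≤ wp * (B + B) := by
  have hwp : 0 ≤ wp := (norm_nonneg _).trans (hw.norm_le 0 0)
  refine (norm_integral_le_of_norm_le_const (C := wp * (B + B)) (.of_forall fun z => ?_)).trans
    (by simp)
  rw [norm_smul]
  exact mul_le_mul (hw.norm_le _ _) ((norm_sub_le _ _).trans (add_le_add (hB _) (hB _)))
    (norm_nonneg _) hwp

lemma memLp_two_of_bound {V : Euc d → ℂ} (hV : Integrable V) {B : ℝ} (hB : ∀ x, ‖V x‖ ≤ B) :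
    MemLp V 2 := by
  rw [memLp_two_iff_integrable_sq_norm hV.1]
  simp only [sq]
  exact hV.norm.mul_bdd hV.1.norm (c := B) (.of_forall fun x => by simpa using hB x)

/-- The corrected plane wave. -/
def blochWave (χ : Fin d → Tor d → ℝ) (ξ x : Euc d) : ℂ :=
  wave ξ x * (1 + I * dirCorrector χ ξ (toTor x))

lemma spaceOp_blochWave (χ : Fin d → Tor d → ℝ) (ξ x : Euc d) :
    spaceOp ρ w (blochWave χ ξ) x = wave ξ x * fiber ρ w χ ξ (toTor x) := by
  rw [spaceOp, nonlocalOp, fiber, ← integral_const_mul]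
  refine integral_congr_ae (.of_forall fun z => ?_)
  simp only [blochWave, AddMonoidHom.id_apply, wave_sub, liftCond, map_sub, Complex.real_smul]
  ring

namespace IsCorrector

variable {χ : Fin d → Tor d → ℝ} {K : ℝ} (hχ : IsCorrector ρ w χ K)
include hχ

lemma measurable_blochWave (ξ : Euc d) : Measurable (blochWave χ ξ) := by
  have h1 := (hχ.measurable_dirCorrector ξ).comp measurable_toTor
  have h2 := (continuous_wave ξ).measurable
  have h3 : Measurable fun x : Euc d => ((dirCorrector χ ξ (toTor x) : ℝ) : ℂ) :=
    Complex.measurable_ofReal.comp h1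
  unfold blochWave
  fun_prop

lemma norm_blochWave_le (ξ x : Euc d) : ‖blochWave χ ξ x‖ ≤ 1 + 2 * π * d * K * ‖ξ‖ := by
  rw [blochWave, norm_mul, norm_wave, one_mul]
  refine (norm_add_le _ _).trans ?_
  simpa using hχ.abs_dirCorrector_le ξ (toTor x)

lemma measurable_fiber (hw : IsConductance w wm wp) (ξ : Euc d) :
    Measurable (fiber ρ w χ ξ) := by
  have h1 := hχ.measurable_dirCorrector ξ
  have h2 := hw.measurable_comp (Z := Euc d) (j := toTor) measurable_toTor
  have h3 : Measurable fun p : Tor d × Euc d => p.1 - toTor p.2 :=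
    measurable_fst.sub (measurable_toTor.comp measurable_snd)
  have h4 : Measurable (phase ξ) := (continuous_phase ξ).measurable
  have h5 : Measurable fun p : Tor d × Euc d => w p.1 (p.1 - toTor p.2) :=
    h2.comp measurable_swap
  have h6 : Measurable fun p : Tor d × Euc d => ((dirCorrector χ ξ (p.1 - toTor p.2) : ℝ) : ℂ) :=
    Complex.measurable_ofReal.comp (h1.comp h3)
  have h7 : Measurable fun p : Tor d × Euc d => ((dirCorrector χ ξ p.1 : ℝ) : ℂ) :=
    Complex.measurable_ofReal.comp (h1.comp measurable_fst)
  have h8 : Measurable fun p : Tor d × Euc d => ((-phase ξ p.2 : ℝ) : ℂ) :=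
    Complex.measurable_ofReal.comp (h4.comp measurable_snd).neg
  have h : Measurable fun p : Tor d × Euc d => w p.1 (p.1 - toTor p.2) •
      ((1 + I * dirCorrector χ ξ p.1) - Complex.exp (I * (-phase ξ p.2 : ℝ)) *
        (1 + I * dirCorrector χ ξ (p.1 - toTor p.2))) := by
    exact h5.smul ((measurable_const.add (measurable_const.mul h7)).sub
      ((Complex.measurable_exp.comp (measurable_const.mul h8)).mul
        (measurable_const.add (measurable_const.mul h6))))
  exact h.stronglyMeasurable.integral_prod_right.measurable

lemma integral_spaceOp_mul_blochWave (hw : IsConductance w wm wp) {V : Euc d → ℂ}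
    (hV : Integrable V) (ξ : Euc d) :
    ∫ x, spaceOp ρ w V x * blochWave χ ξ x =
      ∫ x, V x * wave ξ x * fiber ρ w χ ξ (toTor x) := by
  have hm : AEStronglyMeasurable (fun p : Euc d × Euc d => blochWave χ ξ p.2) (ρ.prod volume) :=
    ((hχ.measurable_blochWave ξ).comp measurable_snd).aestronglyMeasurable
  have h := hw.liftCond.integral_nonlocalOp_mul_comm (ρ := ρ) (m := volume)
    (j := AddMonoidHom.id (Euc d)) measurable_id (u := V) (v := blochWave χ ξ)
    ((hV.comp_snd ρ).mul_bdd hm (.of_forall fun p => hχ.norm_blochWave_le ξ p.2))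
    ((measurePreserving_sub_prod.integrable_comp_of_integrable hV).mul_bdd hm
      (.of_forall fun p => hχ.norm_blochWave_le ξ p.2))
  refine h.trans (integral_congr_ae (.of_forall fun x => ?_))
  dsimp only
  rw [← spaceOp, spaceOp_blochWave, mul_assoc]

lemma integral_mul_blochWave {h : Euc d → ℂ} (hh : Integrable h) (ξ : Euc d) :
    ∫ x, h x * blochWave χ ξ x = (𝓕⁻ h) ξ +
      2 * π * I * ∑ i, (ξ i : ℂ) * (𝓕⁻ fun x => h x * χ i (toTor x)) ξ := by
  have hw := (continuous_wave ξ).aestronglyMeasurable (μ := (volume : Measure (Euc d)))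
  have hwb : ∀ᵐ x, ‖wave ξ x‖ ≤ 1 := .of_forall fun x => (norm_wave ξ x).le
  have hi (i) : Integrable fun x => h x * ((χ i (toTor x) : ℝ) : ℂ) :=
    hh.mul_bdd (Complex.measurable_ofReal.comp ((hχ.measurable i).comp
      measurable_toTor)).aestronglyMeasurable (c := K) (.of_forall fun x => by
        simpa using hχ.bound i (toTor x))
  simp only [fourierInv_eq_integral_wave]
  simp only [← integral_const_mul]
  rw [← integral_finsetSum _ fun i _ => (((hi i).mul_bdd hw hwb).const_mul _),
    ← integral_const_mul, ← integral_add (hh.mul_bdd hw hwb)]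
  · refine integral_congr_ae (.of_forall fun x => ?_)
    simp only [blochWave, dirCorrector, Finset.mul_sum, mul_add, Complex.ofReal_mul,
      Complex.ofReal_sum, mul_one]
    congr 1
    refine Finset.sum_congr rfl fun i _ => ?_
    push_cast
    ring
  · exact (integrable_finsetSum _ fun i _ => (((hi i).mul_bdd hw hwb).const_mul _)).const_mul _

end IsCorrector

end SpaceOperator

lemma enorm_add_sq_le (a b : ℝ≥0∞) : (a + b) ^ 2 ≤ 2 * (a ^ 2 + b ^ 2) := by
  have h := ENNReal.rpow_add_le_mul_rpow_add_rpow a b (p := 2) one_le_two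
  norm_num at h
  exact h

section EnergyLower

open FourierTransform SchwartzMap
open Complex (I)
open scoped RealInnerProductSpace

variable {d : ℕ} {ρ : Measure (Euc d)} [IsProbabilityMeasure ρ] [ρ.IsNegInvariant]

lemma fourierInv_comp_sub (f : Euc d → ℂ) (z ξ : Euc d) :
    (𝓕⁻ fun x => f (x - z)) ξ = wave ξ z * (𝓕⁻ f) ξ := by
  rw [fourierInv_eq_integral_wave, fourierInv_eq_integral_wave, ← integral_const_mul,
    ← integral_add_right_eq_self _ z]
  refine integral_congr_ae (.of_forall fun x => ?_)
  have h : wave ξ (x + z) = wave ξ z * wave ξ x := by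
    rw [wave, wave, wave, ← Complex.exp_add]
    congr 1
    simp only [phase, inner_add_left]
    push_cast
    ring
  simp only [add_sub_cancel_right, h]
  ring

lemma norm_one_sub_wave_sq (ξ z : Euc d) :
    ‖1 - wave ξ z‖ ^ 2 = 2 * (1 - cos (2 * π * ⟪z, ξ⟫)) := by
  rw [wave, phase, ← Complex.normSq_eq_norm_sq, Complex.normSq_apply]
  simp only [Complex.sub_re, Complex.sub_im, Complex.one_re, Complex.one_im,
    Complex.exp_ofReal_mul_I_re, Complex.exp_ofReal_mul_I_im]
  nlinarith [sin_sq_add_cos_sq (2 * π * ⟪z, ξ⟫)]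

/-- The Dirichlet form of the nonlocal operator with unit conductance. -/
def energy (ρ : Measure (Euc d)) (V : Euc d → ℂ) : ℝ≥0∞ :=
  ∫⁻ p : Euc d × Euc d, ‖V p.2 - V (p.2 - p.1)‖ₑ ^ 2 ∂(ρ.prod volume)

lemma le_energy {c : ℝ} (hc : ∀ ξ, c * min 1 (‖ξ‖ ^ 2) ≤ symbol ρ ξ) (hc0 : 0 ≤ c)
    (V : 𝓢(Euc d, ℂ)) :
    ENNReal.ofReal (2 * c) * ∫⁻ ξ, (min 1 ‖ξ‖ₑ * ‖(𝓕⁻ (V : Euc d → ℂ)) ξ‖ₑ) ^ 2 ≤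
      energy ρ V := by
  have hVc := V.continuous.measurable
  have hFc : Measurable (𝓕⁻ (V : Euc d → ℂ)) := (continuous_fourierInv V.integrable).measurable
  have hmeas : Measurable fun p : Euc d × Euc d => ‖V p.2 - V (p.2 - p.1)‖ₑ ^ 2 := by fun_prop
  have h1 (z : Euc d) : ∫⁻ x, ‖V x - V (x - z)‖ₑ ^ 2 =
      ∫⁻ ξ, ENNReal.ofReal (2 * (1 - cos (2 * π * ⟪z, ξ⟫))) * ‖(𝓕⁻ (V : Euc d → ℂ)) ξ‖ₑ ^ 2 := by
    have i1 : Integrable fun x => V x - V (x - z) := V.integrable.sub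
        (V.integrable.comp_sub_right z)
    have i2 : MemLp (fun x => V x - V (x - z)) 2 :=
      (V.memLp 2).sub ((SchwartzMap.compSubConstCLM ℂ z V).memLp 2)
    rw [← lintegral_enorm_sq_fourierInv i1 i2]
    refine lintegral_congr fun ξ => ?_
    have h2 : (𝓕⁻ fun x => V x - V (x - z)) ξ = (1 - wave ξ z) * (𝓕⁻ (V : Euc d → ℂ)) ξ := by
      rw [sub_mul, one_mul, ← fourierInv_comp_sub, fourierInv_eq_integral_wave,
        fourierInv_eq_integral_wave, fourierInv_eq_integral_wave, ← integral_sub]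
      · simp only [sub_mul]
      · exact V.integrable.mul_bdd (continuous_wave ξ).aestronglyMeasurable
          (.of_forall fun x => (norm_wave ξ x).le)
      · exact (V.integrable.comp_sub_right z).mul_bdd (continuous_wave ξ).aestronglyMeasurable
          (.of_forall fun x => (norm_wave ξ x).le)
    rw [h2, enorm_mul, mul_pow, ← norm_one_sub_wave_sq, ENNReal.ofReal_pow (norm_nonneg _),
      ofReal_norm]
  rw [energy, lintegral_prod _ hmeas.aemeasurable]
  simp only [h1]
  rw [lintegral_lintegral_swap (by fun_prop), ← lintegral_const_mul _ (by fun_prop)]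
  refine lintegral_mono fun ξ => ?_
  rw [lintegral_mul_const _ (by fun_prop), mul_pow, ← mul_assoc]
  gcongr
  rw [← ofReal_integral_eq_lintegral_ofReal ((integrable_one_sub_cos _).const_mul 2)
      (.of_forall fun z => mul_nonneg two_pos.le (sub_nonneg.2 (cos_le_one _))), integral_const_mul]
  have h3 : min 1 ‖ξ‖ₑ ^ 2 = ENNReal.ofReal (min 1 (‖ξ‖ ^ 2)) := by
    rw [ENNReal.ofReal_min, ENNReal.ofReal_pow (norm_nonneg _), ofReal_norm, ENNReal.ofReal_one]
    rcases le_total 1 ‖ξ‖ₑ with h | h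
    · rw [min_eq_left h, min_eq_left (one_le_pow₀ h), one_pow]
    · rw [min_eq_right h, min_eq_right (pow_le_one₀ zero_le h)]
  rw [h3, ← ENNReal.ofReal_mul (by positivity)]
  refine ENNReal.ofReal_le_ofReal ?_
  have := hc ξ
  simp only [symbol] at this
  linarith

lemma lintegral_ball_tsum_le {W : Euc d → ℝ≥0∞} (hW : Measurable W) :
    ∫⁻ ξ in Metric.ball 0 (1 / 2), ∑' n : Fin d → ℤ, (if n = 0 then 0 else W (ξ - intVec n)) ≤
      ∫⁻ ξ in {ξ | 1 / 2 ≤ ‖ξ‖}, W ξ := by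
  have hm (n : Fin d → ℤ) : Measurable fun ξ => if n = 0 then 0 else W (ξ - intVec n) := by
    split_ifs <;> fun_prop
  have hs : MeasurableSet {ξ : Euc d | 1 / 2 ≤ ‖ξ‖} := measurableSet_le measurable_const
      measurable_norm
  rw [lintegral_tsum fun n => (hm n).aemeasurable, ← lintegral_indicator hs]
  have h1 (n : Fin d → ℤ) : ∫⁻ ξ in Metric.ball 0 (1 / 2), (if n = 0 then 0 else W (ξ - intVec n)) =
      ∫⁻ ξ, if n ≠ 0 ∧ ‖ξ + intVec n‖ < 1 / 2 then W ξ else 0 := by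
    rw [← lintegral_indicator measurableSet_ball, ← lintegral_add_right_eq_self _ (intVec n)]
    refine lintegral_congr fun ξ => ?_
    by_cases h0 : n = 0
    · simp [h0]
    · simp [h0, Set.indicator]
  have h2 (n : Fin d → ℤ) :
      Measurable fun ξ => if n ≠ 0 ∧ ‖ξ + intVec n‖ < 1 / 2 then W ξ else 0 := by
    refine Measurable.ite ?_ hW measurable_const
    by_cases h0 : n = 0
    · simp [h0]
    · simpa [h0] using measurableSet_lt (f := fun ξ : Euc d => ‖ξ + intVec n‖) (by fun_prop)
        measurable_const
  simp only [h1]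
  rw [← lintegral_tsum fun n => (h2 n).aemeasurable]
  refine lintegral_mono fun ξ => ?_
  by_cases h : ∃ n : Fin d → ℤ, n ≠ 0 ∧ ‖ξ + intVec n‖ < 1 / 2
  · obtain ⟨n, hn0, hn⟩ := h
    have h3 := one_le_norm_intVec hn0
    have h4 : ‖intVec n‖ ≤ ‖ξ + intVec n‖ + ‖ξ‖ := by
      simpa using norm_sub_le (ξ + intVec n) ξ
    rw [tsum_eq_single n]
    · rw [if_pos ⟨hn0, hn⟩, Set.indicator_of_mem]
      simp only [Set.mem_ofPred_eq]
      linarith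
    · intro k hk
      rw [if_neg]
      rintro ⟨-, hk'⟩
      have h5 : intVec (k - n) = (ξ + intVec k) - (ξ + intVec n) := by
        ext i
        simp
      have h6 := one_le_norm_intVec (sub_ne_zero.2 hk)
      rw [h5] at h6
      have := norm_sub_le (ξ + intVec k) (ξ + intVec n)
      linarith
  · push Not at h
    rw [ENNReal.tsum_eq_zero.2 fun n => if_neg fun hn => (h n hn.1).not_gt hn.2]
    exact zero_le

end EnergyLower

lemma enorm_integral_mul_sq_le {α : Type*} [MeasurableSpace α] {μ : Measure α} {F D : α → ℂ}
    {p q A B : α → ℝ≥0∞} (hF : Measurable F) (hp : Measurable p) (hq : Measurable q)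
    (hA : Measurable A) (hB : Measurable B)
    (h : ∀ x, ∃ D₁ D₂, D x = D₁ + D₂ ∧ ‖D₁‖ₑ ^ 2 ≤ p x ^ 2 * A x ∧ ‖D₂‖ₑ ^ 2 ≤ q x ^ 2 * B x) :
    ‖∫ x, F x * D x ∂μ‖ₑ ^ 2 ≤ 2 * ((∫⁻ x, (p x * ‖F x‖ₑ) ^ 2 ∂μ) * (∫⁻ x, A x ∂μ) +
      (∫⁻ x, (q x * ‖F x‖ₑ) ^ 2 ∂μ) * ∫⁻ x, B x ∂μ) := by
  have hroot {b c e : ℝ≥0∞} (hb : b ^ 2 ≤ c ^ 2 * e) : b ≤ c * e ^ (1 / 2 : ℝ) := by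
    have h1 := ENNReal.rpow_le_rpow hb (z := 1 / 2) (by norm_num)
    rw [ENNReal.mul_rpow_of_nonneg _ _ (by norm_num), ← ENNReal.rpow_natCast_mul,
      ← ENNReal.rpow_natCast_mul] at h1
    simpa using h1
  have hsq (b : ℝ≥0∞) : (b ^ (1 / 2 : ℝ)) ^ 2 = b := by
    rw [← ENNReal.rpow_mul_natCast]
    simp
  have h1 : ‖∫ x, F x * D x ∂μ‖ₑ ≤ (∫⁻ x, (p x * ‖F x‖ₑ) * A x ^ (1 / 2 : ℝ) ∂μ) +
      ∫⁻ x, (q x * ‖F x‖ₑ) * B x ^ (1 / 2 : ℝ) ∂μ := by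
    rw [← lintegral_add_left (by fun_prop)]
    refine (enorm_integral_le_lintegral_enorm _).trans (lintegral_mono fun x => ?_)
    obtain ⟨D₁, D₂, h0, h1, h2⟩ := h x
    rw [enorm_mul, h0, mul_right_comm, mul_right_comm _ _ (B x ^ _), ← add_mul, mul_comm]
    gcongr
    exact (enorm_add_le _ _).trans (add_le_add (hroot h1) (hroot h2))
  refine (pow_le_pow_left₀ zero_le h1 2).trans ((enorm_add_sq_le _ _).trans ?_)
  gcongr
  · refine (lintegral_mul_sq_le (by fun_prop) (by fun_prop)).trans_eq ?_
    simp only [hsq]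
  · refine (lintegral_mul_sq_le (by fun_prop) (by fun_prop)).trans_eq ?_
    simp only [hsq]

section Symbol

open FourierTransform SchwartzMap
open Complex (I)
open scoped RealInnerProductSpace

variable {d : ℕ} {ρ : Measure (Euc d)} [IsProbabilityMeasure ρ] [ρ.IsNegInvariant]
  {w : Tor d → Tor d → ℝ} {wm wp : ℝ} {χ : Fin d → Tor d → ℝ} {K : ℝ}

/-- The part of the symbol defect controlled by the energy. -/
def energyDefect (V : Euc d → ℂ) (ξ : Euc d) : ℝ≥0∞ :=
  (min 1 ‖ξ‖ₑ * ‖(𝓕⁻ V) ξ‖ₑ) ^ 2 + (Metric.ball (0 : Euc d) (1 / 2)).indicator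
    (fun ξ => ∑' n : Fin d → ℤ, if n = 0 then 0 else ‖(𝓕⁻ V) (ξ - intVec n)‖ₑ ^ 2) ξ

/-- The part of the symbol defect controlled by the operator. -/
def operatorDefect (ρ : Measure (Euc d)) (w : Tor d → Tor d → ℝ) (χ : Fin d → Tor d → ℝ)
    (V : Euc d → ℂ) (ξ : Euc d) : ℝ≥0∞ :=
  ‖(𝓕⁻ (spaceOp ρ w V)) ξ‖ₑ ^ 2 +
    ∑ i, ‖(𝓕⁻ fun x => spaceOp ρ w V x * χ i (toTor x)) ξ‖ₑ ^ 2

lemma measurable_energyDefect (V : 𝓢(Euc d, ℂ)) : Measurable (energyDefect (V : Euc d → ℂ)) := by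
  have hFc : Measurable (𝓕⁻ (V : Euc d → ℂ)) := (continuous_fourierInv V.integrable).measurable
  have hm : Measurable fun ξ : Euc d => (min 1 ‖ξ‖ₑ * ‖(𝓕⁻ (V : Euc d → ℂ)) ξ‖ₑ) ^ 2 := by fun_prop
  refine hm.add (Measurable.indicator ?_ measurableSet_ball)
  refine Measurable.tsum fun n => ?_
  split_ifs <;> fun_prop

lemma lintegral_energyDefect_le (V : 𝓢(Euc d, ℂ)) :
    ∫⁻ ξ, energyDefect (V : Euc d → ℂ) ξ ≤
      5 * ∫⁻ ξ, (min 1 ‖ξ‖ₑ * ‖(𝓕⁻ (V : Euc d → ℂ)) ξ‖ₑ) ^ 2 := by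
  have hFc : Measurable (𝓕⁻ (V : Euc d → ℂ)) := (continuous_fourierInv V.integrable).measurable
  have hm : Measurable fun ξ : Euc d => (min 1 ‖ξ‖ₑ * ‖(𝓕⁻ (V : Euc d → ℂ)) ξ‖ₑ) ^ 2 := by fun_prop
  unfold energyDefect
  rw [lintegral_add_left hm, lintegral_indicator measurableSet_ball]
  rw [show (5 : ℝ≥0∞) = 1 + 4 by norm_num, add_mul, one_mul]
  gcongr
  refine (lintegral_ball_tsum_le (W := fun ξ => ‖(𝓕⁻ (V : Euc d → ℂ)) ξ‖ₑ ^ 2)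
    (by fun_prop)).trans ?_
  have hs : MeasurableSet {ξ : Euc d | 1 / 2 ≤ ‖ξ‖} :=
    measurableSet_le measurable_const measurable_norm
  rw [← lintegral_const_mul' 4 _ (by simp), ← lintegral_indicator hs]
  refine lintegral_mono fun ξ => ?_
  by_cases hξ : 1 / 2 ≤ ‖ξ‖
  · rw [Set.indicator_of_mem (by exact hξ), mul_pow, ← mul_assoc]
    refine le_mul_of_one_le_left zero_le ?_
    have h : 1 / 2 ≤ min 1 ‖ξ‖ₑ := by
      rw [← ofReal_norm, show (1 / 2 : ℝ≥0∞) = ENNReal.ofReal (1 / 2) by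
        rw [ENNReal.ofReal_div_of_pos two_pos]; simp, ← ENNReal.ofReal_one, ← ENNReal.ofReal_min]
      exact ENNReal.ofReal_le_ofReal (le_min (by norm_num) hξ)
    calc (1 : ℝ≥0∞) = (2 * (1 / 2)) ^ 2 := by
          rw [ENNReal.mul_div_cancel (by simp) (by simp), one_pow]
      _ ≤ (2 * min 1 ‖ξ‖ₑ) ^ 2 := by gcongr
      _ = _ := by rw [mul_pow]; norm_num
  · rw [Set.indicator_of_notMem (by exact hξ)]
    exact zero_le

namespace IsCorrector

variable (hχ : IsCorrector ρ w χ K)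
include hχ

lemma integrable_mul {h : Euc d → ℂ} (hh : Integrable h) (i : Fin d) :
    Integrable fun x => h x * ((χ i (toTor x) : ℝ) : ℂ) :=
  hh.mul_bdd (Complex.measurable_ofReal.comp ((hχ.measurable i).comp
    measurable_toTor)).aestronglyMeasurable (c := K) (.of_forall fun x => by
      simpa using hχ.bound i (toTor x))

lemma memLp_mul {h : Euc d → ℂ} (hh : MemLp h 2) (i : Fin d) :
    MemLp (fun x => h x * ((χ i (toTor x) : ℝ) : ℂ)) 2 := by
  have hm := (Complex.measurable_ofReal.comp ((hχ.measurable i).comp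
    measurable_toTor)).aestronglyMeasurable (μ := (volume : Measure (Euc d)))
  refine hh.of_le_mul (c := K) (hh.1.mul hm) (.of_forall fun x => ?_)
  rw [norm_mul, mul_comm K]
  gcongr
  simpa using hχ.bound i (toTor x)

lemma measurable_operatorDefect (hw : IsConductance w wm wp) {V : Euc d → ℂ}
    (hV : Integrable V) : Measurable (operatorDefect ρ w χ V) := by
  have h1 : Measurable (𝓕⁻ (spaceOp ρ w V)) :=
    (continuous_fourierInv (integrable_spaceOp hw hV)).measurable
  have h2 (i) : Measurable (𝓕⁻ fun x => spaceOp ρ w V x * ((χ i (toTor x) : ℝ) : ℂ)) :=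
    (continuous_fourierInv (hχ.integrable_mul (integrable_spaceOp hw hV) i)).measurable
  unfold operatorDefect
  fun_prop

lemma lintegral_operatorDefect_le (hw : IsConductance w wm wp) {V : Euc d → ℂ}
    (hV : Integrable V) (hV2 : MemLp (spaceOp ρ w V) 2) :
    ∫⁻ ξ, operatorDefect ρ w χ V ξ ≤
      (1 + d * ENNReal.ofReal K ^ 2) * ∫⁻ x, ‖spaceOp ρ w V x‖ₑ ^ 2 := by
  have hi := integrable_spaceOp (ρ := ρ) hw hV
  have h1 : Measurable (𝓕⁻ (spaceOp ρ w V)) := (continuous_fourierInv hi).measurable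
  have h2 (i) : Measurable (𝓕⁻ fun x => spaceOp ρ w V x * ((χ i (toTor x) : ℝ) : ℂ)) :=
    (continuous_fourierInv (hχ.integrable_mul hi i)).measurable
  unfold operatorDefect
  rw [lintegral_add_left (h1.enorm.pow_const 2), lintegral_finsetSum _ (by fun_prop), add_mul,
      one_mul,
    lintegral_enorm_sq_fourierInv hi hV2]
  gcongr
  refine (Finset.sum_le_card_nsmul _ _ (ENNReal.ofReal K ^ 2 *
    ∫⁻ x, ‖spaceOp ρ w V x‖ₑ ^ 2) fun i _ => ?_).trans_eq (by simp [mul_assoc])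
  rw [lintegral_enorm_sq_fourierInv (hχ.integrable_mul hi i) (hχ.memLp_mul hV2 i),
    ← lintegral_const_mul' _ _ (by simp)]
  refine lintegral_mono fun x => ?_
  rw [enorm_mul, mul_pow, mul_comm]
  gcongr
  rw [← ofReal_norm]
  exact ENNReal.ofReal_le_ofReal (by simpa using hχ.bound i (toTor x))

end IsCorrector

end Symbol

section Core

open FourierTransform SchwartzMap
open Complex (I)
open scoped RealInnerProductSpace

variable {d : ℕ} {ρ : Measure (Euc d)} [IsProbabilityMeasure ρ] [ρ.IsNegInvariant]
  {w : Tor d → Tor d → ℝ} {wm wp : ℝ} {χ : Fin d → Tor d → ℝ} {K : ℝ}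

lemma one_le_two_mul_min {ξ : Euc d} (hξ : 1 / 2 ≤ ‖ξ‖) : 1 ≤ 2 * min 1 ‖ξ‖ₑ := by
  have h2 : (2 : ℝ≥0∞) * ENNReal.ofReal (min 1 ‖ξ‖) = ENNReal.ofReal (2 * min 1 ‖ξ‖) := by
    rw [ENNReal.ofReal_mul two_pos.le]
    simp
  rw [← ofReal_norm, ← ENNReal.ofReal_one, ← ENNReal.ofReal_min, h2]
  refine ENNReal.ofReal_le_ofReal ?_
  have : 1 / 2 ≤ min 1 ‖ξ‖ := le_min (by norm_num) hξ
  linarith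

lemma enorm_sum_mul_sq_le (ξ : Euc d) (f : Fin d → ℂ) :
    ‖∑ i, (ξ i : ℂ) * f i‖ₑ ^ 2 ≤ ‖ξ‖ₑ ^ 2 * (d * ∑ i, ‖f i‖ₑ ^ 2) := by
  have h1 : ‖∑ i, (ξ i : ℂ) * f i‖ₑ ≤ ‖ξ‖ₑ * ∑ i, ‖f i‖ₑ := by
    rw [Finset.mul_sum]
    refine (enorm_sum_le _ _).trans (Finset.sum_le_sum fun i _ => ?_)
    rw [enorm_mul]
    gcongr
    rw [← ofReal_norm, ← ofReal_norm, Complex.norm_real]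
    exact ENNReal.ofReal_le_ofReal (PiLp.norm_apply_le ξ i)
  have h2 := ENNReal.rpow_sum_le_const_mul_sum_rpow Finset.univ (fun i => ‖f i‖ₑ) (p := 2)
    one_le_two
  norm_num at h2
  refine (pow_le_pow_left₀ zero_le h1 2).trans ?_
  rw [mul_pow]
  gcongr

lemma IsCorrector.exists_defect (hχ : IsCorrector ρ w χ K) (hw : IsConductance w wm wp)
    (hM1 : Integrable (fun z : Euc d => ‖z‖ ^ 1) ρ)
    (hM2 : Integrable (fun z : Euc d => ‖z‖ ^ 2) ρ)
    (hM3 : Integrable (fun z : Euc d => ‖z‖ ^ 3) ρ) :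
    ∃ c : ℝ≥0∞, c ≠ ∞ ∧ ∀ (V : 𝓢(Euc d, ℂ)) (ξ : Euc d), ∃ D₁ D₂ : ℂ,
      (effSymbol (effMatrix ρ w χ) ξ : ℂ) * (𝓕⁻ (V : Euc d → ℂ)) ξ -
        (𝓕⁻ (spaceOp ρ w V)) ξ = D₁ + D₂ ∧
      ‖D₁‖ₑ ^ 2 ≤ (‖ξ‖ₑ ^ 2) ^ 2 * (c * energyDefect (V : Euc d → ℂ) ξ) ∧
      ‖D₂‖ₑ ^ 2 ≤ ‖ξ‖ₑ ^ 2 * (c * operatorDefect ρ w χ V ξ) := by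
  obtain ⟨C₁, hC₁, h1⟩ := hχ.exists_norm_integral_fiber_sub_le hw hM1 hM2 hM3
  obtain ⟨C₂, hC₂, h2⟩ := hχ.exists_norm_fiber_le hw hM1 hM2
  obtain ⟨C₃, hC₃, h3⟩ := exists_abs_effSymbol_le (effMatrix ρ w χ)
  set G := effSymbol (effMatrix ρ w χ)
  refine ⟨2 * ENNReal.ofReal C₁ ^ 2 + 2 * ENNReal.ofReal C₂ ^ 2 + 4 * ENNReal.ofReal C₃ ^ 2 + 4 +
    ENNReal.ofReal (2 * π) ^ 2 * d, by simp [ENNReal.mul_eq_top], fun V ξ => ?_⟩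
  set c : ℝ≥0∞ := 2 * ENNReal.ofReal C₁ ^ 2 + 2 * ENNReal.ofReal C₂ ^ 2 +
    4 * ENNReal.ofReal C₃ ^ 2 + 4 + ENNReal.ofReal (2 * π) ^ 2 * d with hc
  set v := (𝓕⁻ (V : Euc d → ℂ)) ξ
  set H := (𝓕⁻ (spaceOp ρ w V)) ξ
  by_cases hξ : ‖ξ‖ < 1 / 2
  · let P := (∫ x, V x * wave ξ x * fiber ρ w χ ξ (toTor x)) - (∫ t, fiber ρ w χ ξ t) * v
    let J := ∑ i, (ξ i : ℂ) * (𝓕⁻ fun x => spaceOp ρ w V x * χ i (toTor x)) ξ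
    have hid := (hχ.integral_mul_blochWave (integrable_spaceOp hw V.integrable) ξ).symm.trans
      (hχ.integral_spaceOp_mul_blochWave hw V.integrable ξ)
    refine ⟨((G ξ : ℂ) - ∫ t, fiber ρ w χ ξ t) * v - P, 2 * π * I * J, ?_, ?_, ?_⟩
    · simp only [P, J]
      linear_combination -hid
    · have hP := enorm_integral_wave_mul_sub_le V ξ (hχ.measurable_fiber hw ξ)
        (by positivity) (h2 ξ)
      have hball : ξ ∈ Metric.ball (0 : Euc d) (1 / 2) := by simpa using hξ
      rw [energyDefect, Set.indicator_of_mem hball]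
      set S := ∑' n : Fin d → ℤ, if n = 0 then 0 else ‖(𝓕⁻ (V : Euc d → ℂ)) (ξ - intVec n)‖ₑ ^ 2
      have hmin : min 1 ‖ξ‖ₑ = ‖ξ‖ₑ := by
        rw [min_eq_right]
        rw [← ofReal_norm, ← ENNReal.ofReal_one]
        exact ENNReal.ofReal_le_ofReal (by linarith)
      have hA : ‖((G ξ : ℂ) - ∫ t, fiber ρ w χ ξ t) * v‖ₑ ≤
          ENNReal.ofReal C₁ * (‖ξ‖ₑ ^ 2 * (‖ξ‖ₑ * ‖v‖ₑ)) := by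
        rw [enorm_mul, ← mul_assoc (‖ξ‖ₑ ^ 2), ← mul_assoc, ← pow_succ]
        gcongr
        rw [← ofReal_norm, ← ofReal_norm, ← ENNReal.ofReal_pow (norm_nonneg _),
          ← ENNReal.ofReal_mul hC₁, norm_sub_rev]
        exact ENNReal.ofReal_le_ofReal (h1 ξ)
      rw [ENNReal.ofReal_mul hC₂, ENNReal.ofReal_pow (norm_nonneg _), ofReal_norm] at hP
      have hsub : ‖((G ξ : ℂ) - ∫ t, fiber ρ w χ ξ t) * v - P‖ₑ ≤
          ‖((G ξ : ℂ) - ∫ t, fiber ρ w χ ξ t) * v‖ₑ + ‖P‖ₑ := enorm_sub_le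
      calc _ ≤ 2 * ((ENNReal.ofReal C₁ * (‖ξ‖ₑ ^ 2 * (‖ξ‖ₑ * ‖v‖ₑ))) ^ 2 +
            (ENNReal.ofReal C₂ * ‖ξ‖ₑ ^ 2) ^ 2 * S) := by
            refine (pow_le_pow_left₀ zero_le hsub 2).trans ((enorm_add_sq_le _ _).trans ?_)
            gcongr
        _ = (‖ξ‖ₑ ^ 2) ^ 2 * ((2 * ENNReal.ofReal C₁ ^ 2) * (min 1 ‖ξ‖ₑ * ‖v‖ₑ) ^ 2 +
            (2 * ENNReal.ofReal C₂ ^ 2) * S) := by rw [hmin]; ring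
        _ ≤ (‖ξ‖ₑ ^ 2) ^ 2 * (c * (min 1 ‖ξ‖ₑ * ‖v‖ₑ) ^ 2 + c * S) := by
            gcongr
            · rw [hc]
              simp only [add_assoc]
              exact le_self_add
            · rw [hc]
              simp only [add_assoc]
              exact le_add_left le_self_add
        _ = _ := by ring
    · have hJ : ‖2 * (π : ℂ) * I * J‖ₑ = ENNReal.ofReal (2 * π) * ‖J‖ₑ := by
        rw [enorm_mul]
        congr 1
        rw [← ofReal_norm]
        simp [abs_of_pos pi_pos]
      rw [hJ, mul_pow]
      calc _ ≤ ENNReal.ofReal (2 * π) ^ 2 * (‖ξ‖ₑ ^ 2 *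
            (d * ∑ i, ‖(𝓕⁻ fun x => spaceOp ρ w V x * χ i (toTor x)) ξ‖ₑ ^ 2)) := by
            gcongr
            exact enorm_sum_mul_sq_le _ _
        _ = ‖ξ‖ₑ ^ 2 * ((ENNReal.ofReal (2 * π) ^ 2 * d) *
            ∑ i, ‖(𝓕⁻ fun x => spaceOp ρ w V x * χ i (toTor x)) ξ‖ₑ ^ 2) := by ring
        _ ≤ _ := by
            gcongr
            · rw [hc]
              exact le_add_self
            · rw [operatorDefect]
              exact le_add_self
  · have h4 := one_le_two_mul_min (not_lt.1 hξ)
    have hG : ‖(G ξ : ℂ)‖ₑ ≤ ENNReal.ofReal C₃ * ‖ξ‖ₑ ^ 2 := by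
      rw [← ofReal_norm, ← ofReal_norm, ← ENNReal.ofReal_pow (norm_nonneg _),
        ← ENNReal.ofReal_mul hC₃, Complex.norm_real]
      exact ENNReal.ofReal_le_ofReal (h3 ξ)
    refine ⟨G ξ * v, -H, sub_eq_add_neg _ _, ?_, ?_⟩
    · rw [enorm_mul]
      calc _ ≤ ((ENNReal.ofReal C₃ * ‖ξ‖ₑ ^ 2) * ((2 * min 1 ‖ξ‖ₑ) * ‖v‖ₑ)) ^ 2 := by
            gcongr
            exact le_mul_of_one_le_left zero_le h4
        _ = (‖ξ‖ₑ ^ 2) ^ 2 * ((4 * ENNReal.ofReal C₃ ^ 2) * (min 1 ‖ξ‖ₑ * ‖v‖ₑ) ^ 2) := by ring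
        _ ≤ _ := by
            gcongr
            · rw [hc]
              simp only [add_assoc]
              exact le_add_left (le_add_left le_self_add)
            · exact le_self_add
    · rw [enorm_neg]
      have h5 : 1 ≤ 4 * ‖ξ‖ₑ ^ 2 := by
        calc 1 ≤ (2 * min 1 ‖ξ‖ₑ) ^ 2 := one_le_pow₀ h4
          _ ≤ (2 * ‖ξ‖ₑ) ^ 2 := by
            gcongr
            exact min_le_right _ _
          _ = _ := by ring
      calc _ ≤ (4 * ‖ξ‖ₑ ^ 2) * ‖H‖ₑ ^ 2 := le_mul_of_one_le_left zero_le h5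
        _ = ‖ξ‖ₑ ^ 2 * (4 * ‖H‖ₑ ^ 2) := by ring
        _ ≤ _ := by
            gcongr
            · rw [hc]
              simp only [add_assoc]
              exact le_add_left (le_add_left (le_add_left le_self_add))
            · exact le_self_add

/-- Sesquilinear homogenization estimate at unit scale. -/
theorem IsCorrector.exists_integral_sub_le (hχ : IsCorrector ρ w χ K)
    (hw : IsConductance w wm wp) (hac : ρ ≪ volume)
    (hM1 : Integrable (fun z : Euc d => ‖z‖ ^ 1) ρ)
    (hM2 : Integrable (fun z : Euc d => ‖z‖ ^ 2) ρ)
    (hM3 : Integrable (fun z : Euc d => ‖z‖ ^ 3) ρ) :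
    ∃ c : ℝ≥0∞, c ≠ ∞ ∧ ∀ Y V : 𝓢(Euc d, ℂ), MemLp (spaceOp ρ w V) 2 →
      ‖(∫ ξ, (𝓕 Y) ξ * ((effSymbol (effMatrix ρ w χ) ξ : ℂ) * (𝓕⁻ (V : Euc d → ℂ)) ξ)) -
        ∫ x, Y x * spaceOp ρ w V x‖ₑ ^ 2 ≤
      c * ((∫⁻ ξ, (‖ξ‖ₑ ^ 2 * ‖(𝓕 Y) ξ‖ₑ) ^ 2) * energy ρ V +
        (∫⁻ ξ, (‖ξ‖ₑ * ‖(𝓕 Y) ξ‖ₑ) ^ 2) * ∫⁻ x, ‖spaceOp ρ w V x‖ₑ ^ 2) := by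
  obtain ⟨c₁, hc₁, h1⟩ := hχ.exists_defect hw hM1 hM2 hM3
  obtain ⟨c₂, hc₂, h2⟩ := exists_symbol_ge hac
  obtain ⟨C₃, hC₃, h3⟩ := exists_abs_effSymbol_le (effMatrix ρ w χ)
  set A₁ : ℝ≥0∞ := c₁ * (5 * (ENNReal.ofReal (2 * c₂))⁻¹)
  set A₂ : ℝ≥0∞ := c₁ * (1 + d * ENNReal.ofReal K ^ 2)
  have hinv : (ENNReal.ofReal (2 * c₂))⁻¹ ≠ ∞ := by
    simpa using hc₂
  refine ⟨2 * (A₁ + A₂), by finiteness, fun Y V hV2 => ?_⟩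
  have hVi := integrable_spaceOp (ρ := ρ) hw V.integrable
  have hm1 := measurable_energyDefect V
  have hm2 := hχ.measurable_operatorDefect hw V.integrable
  have hFV : Continuous (𝓕⁻ (V : Euc d → ℂ)) := continuous_fourierInv V.integrable
  have hFH : Continuous (𝓕⁻ (spaceOp ρ w V)) := continuous_fourierInv hVi
  have hb (h : Euc d → ℂ) (ξ : Euc d) : ‖(𝓕⁻ h) ξ‖ ≤ ∫ x, ‖h x‖ := by
    rw [fourierInv_eq_integral_wave]
    refine (norm_integral_le_integral_norm _).trans_eq ?_
    simp [norm_wave]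
  have hi1 : Integrable fun ξ => (𝓕 Y) ξ * (𝓕⁻ (spaceOp ρ w V)) ξ :=
    (𝓕 Y).integrable.mul_bdd hFH.aestronglyMeasurable (.of_forall (hb _))
  have hi2 : Integrable fun ξ => (𝓕 Y) ξ * ((effSymbol (effMatrix ρ w χ) ξ : ℂ) *
      (𝓕⁻ (V : Euc d → ℂ)) ξ) := by
    have hG : Continuous fun ξ => (effSymbol (effMatrix ρ w χ) ξ : ℂ) :=
      Complex.continuous_ofReal.comp (continuous_effSymbol _)
    have h4 : Integrable fun ξ => (𝓕 Y) ξ * (effSymbol (effMatrix ρ w χ) ξ : ℂ) := by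
      refine (((𝓕 Y).integrable_pow_mul volume 2).const_mul C₃).mono'
        ((𝓕 Y).continuous.mul hG).aestronglyMeasurable (.of_forall fun ξ => ?_)
      rw [norm_mul, Complex.norm_real, mul_comm, ← mul_assoc]
      exact mul_le_mul_of_nonneg_right (h3 ξ) (norm_nonneg _)
    simp only [← mul_assoc]
    exact h4.mul_bdd hFV.aestronglyMeasurable (.of_forall (hb _))
  rw [← integral_fourier_mul_fourierInv Y hVi, ← integral_sub hi2 hi1]
  simp only [← mul_sub]
  refine (enorm_integral_mul_sq_le (p := fun ξ => ‖ξ‖ₑ ^ 2) (q := fun ξ => ‖ξ‖ₑ)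
    (A := fun ξ => c₁ * energyDefect (V : Euc d → ℂ) ξ)
    (B := fun ξ => c₁ * operatorDefect ρ w χ V ξ) (𝓕 Y).continuous.measurable
    (by fun_prop) (by fun_prop) (by fun_prop) (by fun_prop) (h1 V)).trans ?_
  have hA : ∫⁻ ξ, c₁ * energyDefect (V : Euc d → ℂ) ξ ≤ (A₁ + A₂) * energy ρ V := by
    rw [lintegral_const_mul' _ _ hc₁]
    refine le_trans ?_ (mul_le_mul_left (le_self_add : A₁ ≤ A₁ + A₂) _)
    rw [mul_assoc c₁, mul_assoc 5]
    refine mul_le_mul_right ((lintegral_energyDefect_le V).trans (mul_le_mul_right ?_ _)) _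
    have h5 := le_energy h2 hc₂.le V
    rwa [mul_comm _ (energy ρ V), ← div_eq_mul_inv,
      ENNReal.le_div_iff_mul_le (by simp [hc₂])
        (.inl ENNReal.ofReal_ne_top), mul_comm]
  have hB : ∫⁻ ξ, c₁ * operatorDefect ρ w χ V ξ ≤
      (A₁ + A₂) * ∫⁻ x, ‖spaceOp ρ w V x‖ₑ ^ 2 := by
    rw [lintegral_const_mul' _ _ hc₁]
    refine le_trans ?_ (mul_le_mul_left (le_add_self : A₂ ≤ A₁ + A₂) _)
    rw [mul_assoc c₁]
    exact mul_le_mul_right (hχ.lintegral_operatorDefect_le hw V.integrable hV2) _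
  refine (mul_le_mul_right
    (add_le_add (mul_le_mul_right hA _) (mul_le_mul_right hB _)) 2).trans_eq ?_
  ring

end Core

section ScaledOperator

open FourierTransform SchwartzMap
open scoped RealInnerProductSpace ComplexConjugate

variable {d : ℕ} {ρ : Measure (Euc d)} [IsProbabilityMeasure ρ] [ρ.IsNegInvariant]
  {w : Tor d → Tor d → ℝ} {wm wp : ℝ}

lemma integral_spaceOp_mul_aux {u v : Euc d → ℂ} (hu : MemLp u 2) (hv : MemLp v 2) :
    Integrable (fun p : Euc d × Euc d => u p.2 * v p.2) (ρ.prod volume) ∧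
      Integrable (fun p : Euc d × Euc d => u (p.2 - AddMonoidHom.id (Euc d) p.1) * v p.2)
        (ρ.prod volume) := by
  refine ⟨(hu.integrable_mul hv).comp_snd ρ, ?_⟩
  exact (hu.comp_measurePreserving measurePreserving_sub_prod).integrable_mul
    (hv.comp_measurePreserving measurePreserving_snd)

lemma integral_spaceOp_mul_comm (hw : IsConductance w wm wp) {u v : Euc d → ℂ}
    (hu : MemLp u 2) (hv : MemLp v 2) :
    ∫ x, spaceOp ρ w u x * v x = ∫ x, u x * spaceOp ρ w v x := by
  obtain ⟨h1, h2⟩ := integral_spaceOp_mul_aux (ρ := ρ) hu hv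
  exact hw.liftCond.integral_nonlocalOp_mul_comm measurable_id h1 h2

lemma exists_integral_spaceOp_mul_conj (hw : IsConductance w wm wp) {u : Euc d → ℂ}
    (hu : MemLp u 2) :
    ∃ q : ℝ, 0 ≤ q ∧ ∫ x, spaceOp ρ w u x * conj (u x) = q ∧
      ENNReal.ofReal wm * energy ρ u ≤ 2 * ENNReal.ofReal q := by
  have hu' : MemLp (fun x => conj (u x)) 2 := hu.star
  obtain ⟨h1, h2⟩ := integral_spaceOp_mul_aux (ρ := ρ) hu hu'
  have hD : MemLp (fun p : Euc d × Euc d => u p.2 - u (p.2 - p.1)) 2 (ρ.prod volume) :=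
    (hu.comp_measurePreserving measurePreserving_snd).sub
      (hu.comp_measurePreserving measurePreserving_sub_prod)
  have hI : Integrable (fun p : Euc d × Euc d => liftCond w p.2 (p.2 - p.1) *
      ‖u p.2 - u (p.2 - p.1)‖ ^ 2) (ρ.prod volume) :=
    hw.liftCond.integrable_smul (j := AddMonoidHom.id (Euc d)) measurable_id
      ((memLp_two_iff_integrable_sq_norm hD.1).1 hD)
  have hn (p : Euc d × Euc d) : 0 ≤ liftCond w p.2 (p.2 - p.1) * ‖u p.2 - u (p.2 - p.1)‖ ^ 2 :=
    mul_nonneg (hw.liftCond.nonneg _ _) (sq_nonneg _)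
  refine ⟨1 / 2 * ∫ p : Euc d × Euc d, liftCond w p.2 (p.2 - p.1) *
    ‖u p.2 - u (p.2 - p.1)‖ ^ 2 ∂(ρ.prod volume),
    mul_nonneg (by norm_num) (integral_nonneg hn), ?_, ?_⟩
  · refine (hw.liftCond.integral_nonlocalOp_mul measurable_id h1 h2).trans ?_
    rw [Complex.ofReal_mul, ← integral_complex_ofReal, Complex.real_smul]
    congr 1
    refine integral_congr_ae (.of_forall fun p => ?_)
    simp only [AddMonoidHom.id_apply, ← map_sub, Complex.mul_conj, Complex.normSq_eq_norm_sq,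
      Complex.real_smul]
    push_cast
    ring
  · rw [ENNReal.ofReal_mul (by norm_num), ofReal_integral_eq_lintegral_ofReal hI (.of_forall hn),
      ← mul_assoc, energy, ← lintegral_const_mul' _ _ ENNReal.ofReal_ne_top,
      show (2 : ℝ≥0∞) * ENNReal.ofReal (1 / 2) = 1 by
        rw [ENNReal.ofReal_div_of_pos two_pos, ENNReal.ofReal_one, ENNReal.ofReal_ofNat]
        exact ENNReal.mul_div_cancel (by simp) (by simp), one_mul]
    refine lintegral_mono fun p => ?_
    rw [ENNReal.ofReal_mul (hw.liftCond.nonneg _ _), ENNReal.ofReal_pow (norm_nonneg _),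
      ofReal_norm]
    gcongr
    exact hw.liftCond.lower _ _

lemma memLp_comp_smul {u : Euc d → ℂ} (hu : MemLp u 2) {ε : ℝ} (hε : ε ≠ 0) :
    MemLp (fun x => u (ε • x)) 2 := by
  have h : MemLp u 2 (Measure.map (ε • · : Euc d → Euc d) volume) := by
    rw [Measure.map_addHaar_smul volume hε]
    exact hu.smul_measure ENNReal.ofReal_ne_top
  exact h.comp_of_map (measurable_const_smul ε).aemeasurable

lemma integral_comp_smul_euc (f : Euc d → ℂ) {ε : ℝ} (hε : 0 < ε) :
    ∫ x, f (ε • x) = (ε ^ d)⁻¹ • ∫ x, f x := by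
  have h := Measure.integral_comp_smul_of_nonneg (volume : Measure (Euc d)) f ε (hR := hε.le)
  rwa [finrank_euclideanSpace_fin] at h

lemma lintegral_comp_smul_euc (f : Euc d → ℝ≥0∞) {ε : ℝ} (hε : 0 < ε) :
    ∫⁻ x, f (ε • x) = ENNReal.ofReal ((ε ^ d)⁻¹) * ∫⁻ x, f x := by
  have h := lintegral_map_equiv (μ := (volume : Measure (Euc d))) f
    (Homeomorph.smulOfNeZero ε hε.ne').toMeasurableEquiv
  have h2 : Measure.map ((Homeomorph.smulOfNeZero ε hε.ne').toMeasurableEquiv : Euc d → Euc d)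
      volume = ENNReal.ofReal ((ε ^ d)⁻¹) • volume := by
    have := Measure.map_addHaar_smul (volume : Measure (Euc d)) hε.ne'
    rw [abs_of_nonneg (by positivity), finrank_euclideanSpace_fin] at this
    exact this
  rw [h2, lintegral_smul_measure] at h
  exact h.symm

/-- The nonlocal operator with `ε`-periodic conductance. -/
def scaledOp (ρ : Measure (Euc d)) (w : Tor d → Tor d → ℝ) (ε : ℝ) (u : Euc d → ℂ) (x : Euc d) :
    ℂ :=
  (ε ^ 2)⁻¹ • spaceOp ρ w (fun y => u (ε • y)) (ε⁻¹ • x)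

lemma spaceOp_comp_smul {ε : ℝ} (hε : 0 < ε) (u : Euc d → ℂ) (x : Euc d) :
    spaceOp ρ w (fun y => u (ε • y)) x = ε ^ 2 • scaledOp ρ w ε u (ε • x) := by
  rw [scaledOp, smul_smul, mul_inv_cancel₀ (by positivity), one_smul, inv_smul_smul₀ hε.ne']

lemma integral_mul_spaceOp_comp_smul {ε : ℝ} (hε : 0 < ε) (u v : Euc d → ℂ) :
    ∫ x, u (ε • x) * spaceOp ρ w (fun y => v (ε • y)) x =
      (ε ^ 2 * (ε ^ d)⁻¹) • ∫ x, u x * scaledOp ρ w ε v x := by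
  simp only [spaceOp_comp_smul hε, mul_smul_comm]
  rw [integral_smul, integral_comp_smul_euc (fun x => u x * scaledOp ρ w ε v x) hε, smul_smul]

lemma integral_scaledOp_mul_comm (hw : IsConductance w wm wp) {u v : Euc d → ℂ}
    (hu : MemLp u 2) (hv : MemLp v 2) {ε : ℝ} (hε : 0 < ε) :
    ∫ x, scaledOp ρ w ε u x * v x = ∫ x, u x * scaledOp ρ w ε v x := by
  have h := integral_spaceOp_mul_comm (ρ := ρ) hw (memLp_comp_smul hu hε.ne')
    (memLp_comp_smul hv hε.ne')
  rw [integral_mul_spaceOp_comp_smul hε] at h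
  simp only [mul_comm _ (v _)] at h ⊢
  rw [integral_mul_spaceOp_comp_smul hε] at h
  exact smul_right_injective ℂ (by positivity : ε ^ 2 * (ε ^ d)⁻¹ ≠ 0) h

lemma exists_integral_scaledOp_mul_conj (hw : IsConductance w wm wp) {u : Euc d → ℂ}
    (hu : MemLp u 2) {ε : ℝ} (hε : 0 < ε) :
    ∃ q : ℝ, 0 ≤ q ∧ ∫ x, scaledOp ρ w ε u x * conj (u x) = q ∧
      ENNReal.ofReal wm * energy ρ (fun x => u (ε • x)) ≤
        2 * ENNReal.ofReal (ε ^ 2 * (ε ^ d)⁻¹ * q) := by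
  obtain ⟨q, hq, h1, h2⟩ := exists_integral_spaceOp_mul_conj (ρ := ρ) hw
    (memLp_comp_smul hu hε.ne')
  have hc : 0 < ε ^ 2 * (ε ^ d)⁻¹ := by positivity
  simp only [mul_comm _ (conj (u _))] at h1 ⊢
  have h3 := integral_mul_spaceOp_comp_smul (ρ := ρ) (w := w) hε (fun x => conj (u x)) u
  rw [h1] at h3
  refine ⟨(ε ^ 2 * (ε ^ d)⁻¹)⁻¹ * q, by positivity, ?_, ?_⟩
  · rw [← inv_smul_eq_iff₀ hc.ne'] at h3
    rw [← h3, Complex.real_smul]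
    push_cast
    rfl
  · rwa [mul_inv_cancel_left₀ hc.ne']

lemma lintegral_spaceOp_comp_smul {ε : ℝ} (hε : 0 < ε) (u : Euc d → ℂ) :
    ∫⁻ x, ‖spaceOp ρ w (fun y => u (ε • y)) x‖ₑ ^ 2 =
      ENNReal.ofReal (ε ^ 4 * (ε ^ d)⁻¹) * ∫⁻ x, ‖scaledOp ρ w ε u x‖ₑ ^ 2 := by
  have h (x : Euc d) : ‖ε ^ 2 • scaledOp ρ w ε u (ε • x)‖ₑ ^ 2 =
      ENNReal.ofReal (ε ^ 4) * ‖scaledOp ρ w ε u (ε • x)‖ₑ ^ 2 := by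
    rw [enorm_smul, mul_pow, ← ofReal_norm, Real.norm_of_nonneg (by positivity),
      ← ENNReal.ofReal_pow (by positivity), ← pow_mul]
  simp only [spaceOp_comp_smul hε, h]
  rw [lintegral_const_mul' _ _ ENNReal.ofReal_ne_top,
    lintegral_comp_smul_euc (fun x => ‖scaledOp ρ w ε u x‖ₑ ^ 2) hε,
    ENNReal.ofReal_mul (by positivity), mul_assoc]

lemma wave_smul (ε : ℝ) (ξ x : Euc d) : wave (ε • ξ) x = wave ξ (ε • x) := by
  simp only [wave, phase, inner_smul_left, inner_smul_right]
  rfl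

lemma fourierInv_comp_smul (f : Euc d → ℂ) {ε : ℝ} (hε : 0 < ε) (ξ : Euc d) :
    (𝓕⁻ fun x => f (ε • x)) ξ = (ε ^ d)⁻¹ • (𝓕⁻ f) (ε⁻¹ • ξ) := by
  rw [fourierInv_eq_integral_wave, fourierInv_eq_integral_wave, ← integral_comp_smul_euc _ hε]
  simp only [wave_smul, inv_smul_smul₀ hε.ne']

lemma fourier_comp_smul (f : Euc d → ℂ) {ε : ℝ} (hε : 0 < ε) (ξ : Euc d) :
    (𝓕 fun x => f (ε • x)) ξ = (ε ^ d)⁻¹ • (𝓕 f) (ε⁻¹ • ξ) := by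
  have h := fourierInv_comp_smul f hε (-ξ)
  rwa [Real.fourierInv_eq_fourier_neg, Real.fourierInv_eq_fourier_neg, smul_neg, neg_neg,
    neg_neg] at h

/-- Dilation of a Schwartz function. -/
def dilate (ε : ℝ) (hε : ε ≠ 0) (u : 𝓢(Euc d, ℂ)) : 𝓢(Euc d, ℂ) :=
  SchwartzMap.compCLMOfContinuousLinearEquiv ℂ (ContinuousLinearEquiv.smulLeft (Units.mk0 ε hε)) u

lemma coe_dilate (ε : ℝ) (hε : ε ≠ 0) (u : 𝓢(Euc d, ℂ)) :
    (dilate ε hε u : Euc d → ℂ) = fun x => u (ε • x) := by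
  ext x
  simp [dilate, Units.smul_def]

end ScaledOperator

section ScaledCore

open FourierTransform SchwartzMap
open scoped RealInnerProductSpace ComplexConjugate

variable {d : ℕ} {ρ : Measure (Euc d)} [IsProbabilityMeasure ρ] [ρ.IsNegInvariant]
  {w : Tor d → Tor d → ℝ} {wm wp : ℝ} {χ : Fin d → Tor d → ℝ} {K : ℝ}

lemma effSymbol_smul (g : Matrix (Fin d) (Fin d) ℝ) (ε : ℝ) (ξ : Euc d) :
    effSymbol g (ε • ξ) = ε ^ 2 * effSymbol g ξ := by
  simp only [effSymbol, PiLp.smul_apply, smul_eq_mul, Finset.mul_sum]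
  refine Finset.sum_congr rfl fun i _ => Finset.sum_congr rfl fun j _ => ?_
  ring

lemma fourier_dilate {ε : ℝ} (hε : 0 < ε) (u : 𝓢(Euc d, ℂ)) (ξ : Euc d) :
    (𝓕 (dilate ε hε.ne' u)) ξ = (ε ^ d)⁻¹ • (𝓕 u) (ε⁻¹ • ξ) := by
  rw [fourier_coe, fourier_coe, coe_dilate, fourier_comp_smul _ hε]

lemma lintegral_fourier_dilate {ε : ℝ} (hε : 0 < ε) (u : 𝓢(Euc d, ℂ)) (n : ℕ) :
    ∫⁻ ξ, (‖ξ‖ₑ ^ n * ‖(𝓕 (dilate ε hε.ne' u)) ξ‖ₑ) ^ 2 =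
      ENNReal.ofReal ((ε ^ n) ^ 2 * (ε ^ d)⁻¹) * ∫⁻ ξ, (‖ξ‖ₑ ^ n * ‖(𝓕 u) ξ‖ₑ) ^ 2 := by
  have hr {r : ℝ} (hr : 0 ≤ r) : ‖r‖ₑ = ENNReal.ofReal r := by
    rw [← ofReal_norm, Real.norm_of_nonneg hr]
  have h (ξ : Euc d) : (‖ξ‖ₑ ^ n * ‖(𝓕 (dilate ε hε.ne' u)) ξ‖ₑ) ^ 2 =
      ENNReal.ofReal ((ε ^ n) ^ 2 * (ε ^ d)⁻¹ ^ 2) *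
        (‖ε⁻¹ • ξ‖ₑ ^ n * ‖(𝓕 u) (ε⁻¹ • ξ)‖ₑ) ^ 2 := by
    have hξ : ‖ξ‖ₑ = ENNReal.ofReal ε * ‖ε⁻¹ • ξ‖ₑ := by
      conv_lhs => rw [← smul_inv_smul₀ hε.ne' ξ, enorm_smul, hr hε.le]
    have hz (z : ℂ) : ‖(ε ^ d)⁻¹ • z‖ₑ = ENNReal.ofReal (ε ^ d)⁻¹ * ‖z‖ₑ := by
      rw [enorm_smul, hr (by positivity)]
    rw [fourier_dilate hε, hz, hξ, ENNReal.ofReal_mul (by positivity), ENNReal.ofReal_pow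
        (by positivity),
      ENNReal.ofReal_pow (by positivity), ENNReal.ofReal_pow (by positivity)]
    ring
  simp only [h]
  rw [lintegral_const_mul' _ _ ENNReal.ofReal_ne_top,
    lintegral_comp_smul_euc (fun ξ : Euc d => (‖ξ‖ₑ ^ n * ‖(𝓕 u : 𝓢(Euc d, ℂ)) ξ‖ₑ) ^ 2)
        (inv_pos.2 hε), ← mul_assoc,
    ← ENNReal.ofReal_mul (by positivity)]
  congr 2
  simp only [inv_pow, inv_inv]
  field_simp

lemma memLp_two_spaceOp (hw : IsConductance w wm wp) (V : 𝓢(Euc d, ℂ)) :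
    MemLp (spaceOp ρ w V) 2 := by
  have h (x : Euc d) := SchwartzMap.norm_le_seminorm ℂ V x
  exact memLp_two_of_bound (integrable_spaceOp hw V.integrable) (norm_spaceOp_le hw h)

lemma integral_fourier_dilate (g : Matrix (Fin d) (Fin d) ℝ) {ε : ℝ} (hε : 0 < ε)
    (u v : 𝓢(Euc d, ℂ)) :
    ∫ ξ, (𝓕 (dilate ε hε.ne' u)) ξ * ((effSymbol g ξ : ℂ) *
        (𝓕⁻ (dilate ε hε.ne' v : Euc d → ℂ)) ξ) =
      (ε ^ 2 * (ε ^ d)⁻¹) •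
        ∫ ξ, (𝓕 u) ξ * ((effSymbol g ξ : ℂ) * (𝓕⁻ (v : Euc d → ℂ)) ξ) := by
  have h (ξ : Euc d) : (𝓕 (dilate ε hε.ne' u)) ξ * ((effSymbol g ξ : ℂ) *
        (𝓕⁻ (dilate ε hε.ne' v : Euc d → ℂ)) ξ) = (ε ^ 2 * (ε ^ d)⁻¹ * (ε ^ d)⁻¹) •
      ((𝓕 u) (ε⁻¹ • ξ) * ((effSymbol g (ε⁻¹ • ξ) : ℂ) * (𝓕⁻ (v : Euc d → ℂ)) (ε⁻¹ • ξ))) := by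
    have h1 : effSymbol g ξ = ε ^ 2 * effSymbol g (ε⁻¹ • ξ) := by
      rw [← effSymbol_smul, smul_inv_smul₀ hε.ne']
    rw [fourier_dilate hε, coe_dilate, fourierInv_comp_smul _ hε, h1]
    simp only [Complex.real_smul]
    push_cast
    ring
  simp only [h]
  rw [integral_smul, integral_comp_smul_euc
    (fun ξ : Euc d => (𝓕 u : 𝓢(Euc d, ℂ)) ξ *
      ((effSymbol g ξ : ℂ) * (𝓕⁻ (v : Euc d → ℂ) : Euc d → ℂ) ξ)) (inv_pos.2 hε), smul_smul]
  congr 1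
  simp only [inv_pow, inv_inv]
  field_simp

/-- Homogenization estimate at scale `ε`. -/
theorem IsCorrector.exists_integral_scaledOp_sub_le (hχ : IsCorrector ρ w χ K)
    (hw : IsConductance w wm wp) (hac : ρ ≪ volume)
    (hM1 : Integrable (fun z : Euc d => ‖z‖ ^ 1) ρ)
    (hM2 : Integrable (fun z : Euc d => ‖z‖ ^ 2) ρ)
    (hM3 : Integrable (fun z : Euc d => ‖z‖ ^ 3) ρ) :
    ∃ c : ℝ≥0∞, c ≠ ∞ ∧ ∀ (ε : ℝ), 0 < ε → ∀ u v : 𝓢(Euc d, ℂ), ∃ q : ℝ, 0 ≤ q ∧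
      ∫ x, scaledOp ρ w ε v x * conj (v x) = q ∧
      ‖(∫ ξ, (𝓕 u) ξ * ((effSymbol (effMatrix ρ w χ) ξ : ℂ) * (𝓕⁻ (v : Euc d → ℂ)) ξ)) -
        ∫ x, u x * scaledOp ρ w ε v x‖ₑ ^ 2 ≤
      c * ENNReal.ofReal (ε ^ 2) * ((∫⁻ ξ, (‖ξ‖ₑ ^ 2 * ‖(𝓕 u) ξ‖ₑ) ^ 2) * ENNReal.ofReal q +
        (∫⁻ ξ, (‖ξ‖ₑ ^ 1 * ‖(𝓕 u) ξ‖ₑ) ^ 2) * ∫⁻ x, ‖scaledOp ρ w ε v x‖ₑ ^ 2) := by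
  obtain ⟨c, hc, h⟩ := hχ.exists_integral_sub_le hw hac hM1 hM2 hM3
  set b : ℝ≥0∞ := 2 / ENNReal.ofReal wm
  have hb : b ≠ ∞ := ENNReal.div_ne_top (by simp) (by simpa using hw.pos)
  refine ⟨c * (b + 1), by finiteness, fun ε hε u v => ?_⟩
  obtain ⟨q, hq, hq1, hq2⟩ := exists_integral_scaledOp_mul_conj (ρ := ρ) hw (v.memLp 2) hε
  refine ⟨q, hq, hq1, ?_⟩
  set k := ε ^ 2 * (ε ^ d)⁻¹ with hk
  have hk0 : 0 < k := by positivity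
  have h1 := h (dilate ε hε.ne' u) (dilate ε hε.ne' v) (memLp_two_spaceOp hw _)
  rw [integral_fourier_dilate _ hε] at h1
  have e1 := lintegral_fourier_dilate hε u 1
  rw [lintegral_fourier_dilate hε u 2] at h1
  simp only [pow_one] at e1 ⊢
  rw [e1] at h1
  simp only [coe_dilate] at h1
  rw [integral_mul_spaceOp_comp_smul hε, lintegral_spaceOp_comp_smul hε, ← smul_sub,
    enorm_smul, mul_pow, ← ofReal_norm k, Real.norm_of_nonneg hk0.le] at h1
  have hE : energy ρ (fun x => v (ε • x)) ≤ b * ENNReal.ofReal (k * q) := by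
    rw [ENNReal.mul_comm_div, mul_div_assoc', ENNReal.le_div_iff_mul_le (by simp [hw.pos])
        (by simp),
      mul_comm]
    exact hq2
  set I₁ := ∫⁻ ξ, (‖ξ‖ₑ * ‖(𝓕 u) ξ‖ₑ) ^ 2
  set I₂ := ∫⁻ ξ, (‖ξ‖ₑ ^ 2 * ‖(𝓕 u) ξ‖ₑ) ^ 2
  set S := ∫⁻ x, ‖scaledOp ρ w ε v x‖ₑ ^ 2
  have hkne : ENNReal.ofReal k ^ 2 ≠ 0 := by simpa using hk0
  rw [← ENNReal.mul_le_mul_iff_right hkne (by finiteness)]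
  refine h1.trans ?_
  have e2 : ENNReal.ofReal ((ε ^ 2) ^ 2 * (ε ^ d)⁻¹) * ENNReal.ofReal k =
      ENNReal.ofReal k ^ 2 * ENNReal.ofReal (ε ^ 2) := by
    rw [← ENNReal.ofReal_mul (by positivity), ← ENNReal.ofReal_pow hk0.le,
      ← ENNReal.ofReal_mul (by positivity), hk]
    congr 1
    ring
  have e3 : ENNReal.ofReal (ε ^ 2 * (ε ^ d)⁻¹) * ENNReal.ofReal (ε ^ 4 * (ε ^ d)⁻¹) =
      ENNReal.ofReal k ^ 2 * ENNReal.ofReal (ε ^ 2) := by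
    rw [← ENNReal.ofReal_mul (by positivity), ← ENNReal.ofReal_pow hk0.le,
      ← ENNReal.ofReal_mul (by positivity), hk]
    congr 1
    ring
  calc _ ≤ c * (ENNReal.ofReal ((ε ^ 2) ^ 2 * (ε ^ d)⁻¹) * I₂ *
          (b * (ENNReal.ofReal k * ENNReal.ofReal q)) +
        ENNReal.ofReal (ε ^ 2 * (ε ^ d)⁻¹) * I₁ * (ENNReal.ofReal (ε ^ 4 * (ε ^ d)⁻¹) * S)) := by
        rw [← ENNReal.ofReal_mul hk0.le]
        exact mul_le_mul_right (add_le_add (mul_le_mul_right hE _) le_rfl) _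
    _ = c * (b * I₂ * ENNReal.ofReal q *
          (ENNReal.ofReal ((ε ^ 2) ^ 2 * (ε ^ d)⁻¹) * ENNReal.ofReal k) +
        I₁ * S * (ENNReal.ofReal (ε ^ 2 * (ε ^ d)⁻¹) * ENNReal.ofReal (ε ^ 4 * (ε ^ d)⁻¹))) := by
        ring
    _ = c * (ENNReal.ofReal k ^ 2 * ENNReal.ofReal (ε ^ 2)) *
          (b * (I₂ * ENNReal.ofReal q) + 1 * (I₁ * S)) := by
        rw [e2, e3]
        ring
    _ ≤ c * (ENNReal.ofReal k ^ 2 * ENNReal.ofReal (ε ^ 2)) *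
          ((b + 1) * (I₂ * ENNReal.ofReal q) + (b + 1) * (I₁ * S)) := by
        refine mul_le_mul_right (add_le_add (mul_le_mul_left le_self_add _)
          (mul_le_mul_left le_add_self _)) _
    _ = _ := by ring

end ScaledCore

section Elliptic

open FourierTransform SchwartzMap LineDeriv
open scoped RealInnerProductSpace ComplexConjugate

variable {d : ℕ} {g : Matrix (Fin d) (Fin d) ℝ}

lemma hasTemperateGrowth_coord (i : Fin d) :
    (fun ξ : Euc d => ξ i).HasTemperateGrowth :=
  (EuclideanSpace.proj i : Euc d →L[ℝ] ℝ).hasTemperateGrowth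

lemma hasTemperateGrowth_effSymbol (g : Matrix (Fin d) (Fin d) ℝ) :
    (effSymbol g).HasTemperateGrowth := by
  refine (Function.HasTemperateGrowth.const _).mul (.sum fun i _ => .sum fun j _ => ?_)
  exact (Function.HasTemperateGrowth.const _).mul
    ((hasTemperateGrowth_coord i).mul (hasTemperateGrowth_coord j))

/-- The operator `1 - div g ∇` on Schwartz functions. -/
def ellipticOp (g : Matrix (Fin d) (Fin d) ℝ) : 𝓢(Euc d, ℂ) →L[ℝ] 𝓢(Euc d, ℂ) :=
  fourierMultiplierCLM ℂ fun ξ => 1 + effSymbol g ξ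

lemma hasTemperateGrowth_one_add_effSymbol (g : Matrix (Fin d) (Fin d) ℝ) :
    (fun ξ => 1 + effSymbol g ξ).HasTemperateGrowth :=
  (Function.HasTemperateGrowth.const _).add (hasTemperateGrowth_effSymbol g)

lemma fourier_ellipticOp (φ : 𝓢(Euc d, ℂ)) (ξ : Euc d) :
    (𝓕 (ellipticOp g φ)) ξ = (1 + effSymbol g ξ) • (𝓕 φ) ξ := by
  rw [ellipticOp, fourierMultiplierCLM_apply, fourier_fourierInv_eq,
    smulLeftCLM_apply_apply (hasTemperateGrowth_one_add_effSymbol g)]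

lemma effSymbol_neg (ξ : Euc d) : effSymbol g (-ξ) = effSymbol g ξ := by
  simp [effSymbol]

lemma fourierInv_ellipticOp (φ : 𝓢(Euc d, ℂ)) (ξ : Euc d) :
    (𝓕⁻ (ellipticOp g φ : Euc d → ℂ)) ξ = (1 + effSymbol g ξ) • (𝓕⁻ (φ : Euc d → ℂ)) ξ := by
  rw [Real.fourierInv_eq_fourier_neg, Real.fourierInv_eq_fourier_neg, ← fourier_coe, ← fourier_coe,
    fourier_ellipticOp, effSymbol_neg]

lemma integral_ellipticOp_mul_eq_fourier (u v : 𝓢(Euc d, ℂ)) :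
    ∫ x, ellipticOp g u x * v x =
      ∫ ξ, (𝓕 u) ξ * ((1 + effSymbol g ξ) • (𝓕⁻ (v : Euc d → ℂ)) ξ) := by
  rw [← integral_fourier_mul_fourierInv _ v.integrable]
  simp only [fourier_ellipticOp, smul_mul_assoc, mul_smul_comm]

lemma integral_ellipticOp_mul_comm (u v : 𝓢(Euc d, ℂ)) :
    ∫ x, ellipticOp g u x * v x = ∫ x, u x * ellipticOp g v x := by
  rw [integral_ellipticOp_mul_eq_fourier,
    ← integral_fourier_mul_fourierInv _ (ellipticOp g v).integrable]
  simp only [fourierInv_ellipticOp]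

lemma integrable_fourier_mul_effSymbol (u v : 𝓢(Euc d, ℂ)) :
    Integrable (fun ξ => (𝓕 u) ξ * ((effSymbol g ξ : ℂ) * (𝓕⁻ (v : Euc d → ℂ)) ξ)) := by
  have h : (fun ξ => (𝓕 u) ξ * ((effSymbol g ξ : ℂ) * (𝓕⁻ (v : Euc d → ℂ)) ξ)) =
      fun ξ => (smulLeftCLM ℂ (effSymbol g) (𝓕 u)) ξ * (𝓕⁻ v) ξ := by
    ext ξ
    rw [smulLeftCLM_apply_apply (hasTemperateGrowth_effSymbol g), fourierInv_coe, Complex.real_smul]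
    ring
  rw [h]
  exact ((smulLeftCLM ℂ (effSymbol g) (𝓕 u)).memLp 2).integrable_mul ((𝓕⁻ v).memLp 2)

lemma integral_ellipticOp_mul (u v : 𝓢(Euc d, ℂ)) :
    ∫ x, ellipticOp g u x * v x = (∫ x, u x * v x) +
      ∫ ξ, (𝓕 u) ξ * ((effSymbol g ξ : ℂ) * (𝓕⁻ (v : Euc d → ℂ)) ξ) := by
  have h1 : Integrable fun ξ => (𝓕 u) ξ * (𝓕⁻ (v : Euc d → ℂ)) ξ := by
    rw [← fourierInv_coe]
    exact ((𝓕 u).memLp 2).integrable_mul ((𝓕⁻ v).memLp 2)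
  rw [integral_ellipticOp_mul_eq_fourier, ← integral_fourier_mul_fourierInv _ v.integrable,
    ← integral_add h1 (integrable_fourier_mul_effSymbol u v)]
  refine integral_congr_ae (.of_forall fun ξ => ?_)
  simp only [Complex.real_smul]
  push_cast
  ring

lemma effSymbol_nonneg (hg : g.PosDef) (ξ : Euc d) : 0 ≤ effSymbol g ξ := by
  have h := hg.posSemidef.dotProduct_mulVec_nonneg (fun i => ξ i)
  simp only [dotProduct, Matrix.mulVec, Pi.star_apply, star_trivial, Finset.mul_sum] at h
  refine mul_nonneg (by positivity) (h.trans_eq ?_)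
  refine Finset.sum_congr rfl fun i _ => Finset.sum_congr rfl fun j _ => ?_
  ring

lemma exists_effSymbol_eq_norm_sq (hg : g.PosDef) :
    ∃ (m : ℕ) (L : Euc d →L[ℝ] Euc m), ∀ ξ, effSymbol g ξ = ‖L ξ‖ ^ 2 := by
  obtain ⟨m, v, hv⟩ := Matrix.posSemidef_iff_eq_sum_vecMulVec.1 hg.posSemidef
  refine ⟨m, (2 * π) • (Matrix.toLpLin 2 2 (Matrix.of v)).toContinuousLinearMap, fun ξ => ?_⟩
  rw [_root_.smul_apply, norm_smul, mul_pow, EuclideanSpace.norm_sq_eq, effSymbol,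
    Real.norm_of_nonneg (by positivity), mul_pow]
  congr 1
  · norm_num
  subst hv
  simp only [Matrix.sum_apply, Matrix.vecMulVec_apply, LinearMap.coe_toContinuousLinearMap',
    Matrix.toLpLin_apply, Matrix.mulVec, dotProduct, Real.norm_eq_abs, sq,
    Matrix.of_apply, star_trivial, Finset.sum_mul, abs_mul_abs_self]
  simp_rw [Finset.sum_comm (t := (Finset.univ : Finset (Fin m)))]
  refine Finset.sum_congr rfl fun k _ => Finset.sum_congr rfl fun i _ => ?_
  rw [Finset.mul_sum]
  refine Finset.sum_congr rfl fun j _ => ?_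
  ring

lemma hasTemperateGrowth_inv_one_add_effSymbol (hg : g.PosDef) :
    (fun ξ => (1 + effSymbol g ξ)⁻¹).HasTemperateGrowth := by
  obtain ⟨m, L, hL⟩ := exists_effSymbol_eq_norm_sq hg
  have h := (Function.hasTemperateGrowth_one_add_norm_sq_rpow (Euc m) (-1)).comp
    L.hasTemperateGrowth
  simpa only [Function.comp_def, ← hL, Real.rpow_neg_one] using h

lemma ellipticOp_surjective (hg : g.PosDef) : Function.Surjective (ellipticOp g) := by
  intro φ
  refine ⟨fourierMultiplierCLM ℂ (fun ξ => (1 + effSymbol g ξ)⁻¹) φ, ?_⟩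
  rw [ellipticOp, fourierMultiplierCLM_fourierMultiplierCLM_apply
    (hasTemperateGrowth_one_add_effSymbol g) (hasTemperateGrowth_inv_one_add_effSymbol hg)]
  have h : ((fun ξ => 1 + effSymbol g ξ) * fun ξ => (1 + effSymbol g ξ)⁻¹) =
      fun _ : Euc d => (1 : ℝ) := by
    ext ξ
    have := effSymbol_nonneg hg ξ
    rw [Pi.mul_apply, mul_inv_cancel₀ (by positivity)]
  rw [h, fourierMultiplierCLM_const]
  simp

lemma fourier_lineDeriv_single (i : Fin d) (φ : 𝓢(Euc d, ℂ)) (ξ : Euc d) :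
    (𝓕 (∂_{(EuclideanSpace.single i 1 : Euc d)} φ)) ξ = 2 * π * Complex.I * (ξ i * (𝓕 φ) ξ) := by
  rw [fourier_lineDerivOp_eq, _root_.smul_apply,
    smulLeftCLM_apply_apply (Function.hasTemperateGrowth_inner_left _),
    EuclideanSpace.inner_single_right]
  simp

lemma ellipticOp_eq (φ : 𝓢(Euc d, ℂ)) :
    ellipticOp g φ = φ - ∑ i, ∑ j, (g i j : ℂ) • ∂_{(EuclideanSpace.single i 1 : Euc d)}
      (∂_{(EuclideanSpace.single j 1 : Euc d)} φ) := by
  refine (FourierTransform.fourierCLE ℂ 𝓢(Euc d, ℂ)).injective ?_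
  simp only [map_sub, map_sum, map_smul, FourierTransform.fourierCLE_apply]
  ext ξ
  rw [fourier_ellipticOp, _root_.sub_apply, _root_.sum_apply]
  simp only [_root_.sum_apply, _root_.smul_apply, fourier_lineDeriv_single, effSymbol,
    Complex.real_smul, smul_eq_mul]
  push_cast
  rw [add_mul, one_mul, sub_eq_add_neg, Finset.mul_sum, Finset.sum_mul, ← Finset.sum_neg_distrib]
  refine congrArg _ (Finset.sum_congr rfl fun i _ => ?_)
  rw [Finset.mul_sum, Finset.sum_mul, ← Finset.sum_neg_distrib]
  refine Finset.sum_congr rfl fun j _ => ?_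
  linear_combination (4 * π ^ 2 * g i j * ξ i * ξ j * (𝓕 φ) ξ) * Complex.I_sq

lemma ellipticOp_apply (φ : 𝓢(Euc d, ℂ)) (x : Euc d) :
    ellipticOp g φ x = φ x - ∑ i, ∑ j, (g i j : ℂ) * iteratedFDeriv ℝ 2 (φ : Euc d → ℂ) x
      ![EuclideanSpace.single i 1, EuclideanSpace.single j 1] := by
  simp only [ellipticOp_eq, _root_.sub_apply, _root_.sum_apply, _root_.smul_apply,
    ← iteratedLineDerivOp_eq_iteratedFDeriv, smul_eq_mul]
  rfl

lemma lintegral_fourier_le_ellipticOp {c : ℝ} (hc : 0 < c)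
    (h : ∀ ξ, c * ‖ξ‖ ^ 2 ≤ effSymbol g ξ) :
    ∃ b : ℝ≥0∞, b ≠ ∞ ∧ ∀ u : 𝓢(Euc d, ℂ),
      (∫⁻ ξ, (‖ξ‖ₑ ^ 2 * ‖(𝓕 u) ξ‖ₑ) ^ 2) ≤ b * ∫⁻ x, ‖ellipticOp g u x‖ₑ ^ 2 ∧
      (∫⁻ ξ, (‖ξ‖ₑ ^ 1 * ‖(𝓕 u) ξ‖ₑ) ^ 2) ≤ b * ∫⁻ x, ‖ellipticOp g u x‖ₑ ^ 2 := by
  set k : ℝ := c⁻¹ + 1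
  have hk : 0 < k := by positivity
  have key (n : ℕ) (hn : ∀ ξ : Euc d, ‖ξ‖ ^ n ≤ k * (1 + effSymbol g ξ)) (u : 𝓢(Euc d, ℂ)) :
      ∫⁻ ξ, (‖ξ‖ₑ ^ n * ‖(𝓕 u) ξ‖ₑ) ^ 2 ≤
        ENNReal.ofReal (k ^ 2) * ∫⁻ x, ‖ellipticOp g u x‖ₑ ^ 2 := by
    rw [← lintegral_enorm_sq_fourier (ellipticOp g u).integrable ((ellipticOp g u).memLp 2),
      ← lintegral_const_mul' _ _ ENNReal.ofReal_ne_top]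
    refine lintegral_mono fun ξ => ?_
    have hG : 0 ≤ 1 + effSymbol g ξ := nonneg_of_mul_nonneg_right
      ((pow_nonneg (norm_nonneg _) n).trans (hn ξ)) hk
    rw [← fourier_coe, fourier_ellipticOp, enorm_smul, ENNReal.ofReal_pow hk.le, ← mul_pow,
      ← mul_assoc, ← ofReal_norm ξ, ← ENNReal.ofReal_pow (norm_nonneg _),
      ← ofReal_norm (1 + effSymbol g ξ), Real.norm_of_nonneg hG, ← ENNReal.ofReal_mul hk.le]
    exact pow_le_pow_left₀ zero_le (mul_le_mul_left (ENNReal.ofReal_le_ofReal (hn ξ)) _) 2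
  have h2 (ξ : Euc d) : ‖ξ‖ ^ 2 ≤ c⁻¹ * effSymbol g ξ := by
    rw [← div_eq_inv_mul, le_div_iff₀ hc, mul_comm]
    exact h ξ
  have h0 (ξ : Euc d) : 0 ≤ effSymbol g ξ := le_trans (by positivity) (h ξ)
  have hc' : 0 < c⁻¹ := inv_pos.2 hc
  refine ⟨ENNReal.ofReal (k ^ 2), ENNReal.ofReal_ne_top, fun u => ⟨key 2 (fun ξ => ?_) u,
    key 1 (fun ξ => ?_) u⟩⟩
  · have := h2 ξ
    have := h0 ξ
    simp only [k]
    nlinarith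
  · have := h2 ξ
    have := h0 ξ
    simp only [k]
    nlinarith [sq_nonneg (‖ξ‖ - 1)]

end Elliptic

section Assembly

open FourierTransform SchwartzMap
open scoped RealInnerProductSpace ComplexConjugate

variable {d : ℕ}

/-- `L²(ℝ^d; ℂ)`. -/
abbrev LTwo (d : ℕ) := Lp ℂ 2 (volume : Measure (Euc d))

/-- The class in `L²` of a Schwartz function. -/
def toLTwo (u : 𝓢(Euc d, ℂ)) : LTwo d :=
  u.toLp 2 volume

lemma coeFn_toLTwo (u : 𝓢(Euc d, ℂ)) : toLTwo u =ᵐ[volume] u :=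
  u.coeFn_toLp 2 volume

lemma inner_star_eq_integral (F h : LTwo d) : inner ℂ (star F) h = ∫ x, F x * h x := by
  rw [L2.inner_def]
  refine integral_congr_ae ?_
  filter_upwards [Lp.coeFn_star F] with x hx
  rw [hx]
  simp [mul_comm]

lemma norm_star_lp (F : LTwo d) : ‖star F‖ = ‖F‖ := by
  rw [Lp.norm_def, Lp.norm_def, eLpNorm_congr_ae (Lp.coeFn_star F), eLpNorm_star]

lemma lintegral_enorm_sq_lp (F : LTwo d) : ∫⁻ x, ‖F x‖ₑ ^ 2 = ENNReal.ofReal (‖F‖ ^ 2) := by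
  have h := eLpNorm_nnreal_pow_eq_lintegral (f := F) (μ := volume) (p := 2) two_ne_zero
  rw [ENNReal.ofReal_pow (norm_nonneg _), ofReal_norm, Lp.enorm_def]
  simpa using h.symm

lemma denseRange_schwartz_toLp : DenseRange (toLTwo (d := d)) :=
  denseRange_toLpCLM ENNReal.ofNat_ne_top

lemma continuous_toLTwo : Continuous (toLTwo (d := d)) :=
  (toLpCLM ℝ ℂ 2 volume).continuous

lemma norm_le_of_inner_star_le {F : LTwo d} {K : ℝ} (hK : 0 ≤ K) {ι : Type*} {s : ι → LTwo d}
    (hs : DenseRange s) (h : ∀ i, ‖inner ℂ (star F) (s i)‖ ≤ K * ‖s i‖) : ‖F‖ ≤ K := by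
  have h1 (x : LTwo d) : ‖inner ℂ (star F) x‖ ≤ K * ‖x‖ := by
    refine hs.induction_on x (isClosed_le (by fun_prop) (by fun_prop)) h
  have h2 := h1 (star F)
  rw [inner_self_eq_norm_sq_to_K] at h2
  rw [← norm_star_lp]
  rcases (norm_nonneg (star F)).eq_or_lt with h3 | h3
  · rwa [← h3]
  · have h4 : ‖star F‖ * ‖star F‖ ≤ K * ‖star F‖ := by simpa [sq] using h2
    exact le_of_mul_le_mul_right h4 h3

lemma inner_star_toLp (F : LTwo d) (φ : 𝓢(Euc d, ℂ)) :
    inner ℂ (star F) (toLTwo φ) = ∫ x, F x * φ x := by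
  rw [inner_star_eq_integral]
  refine integral_congr_ae ?_
  filter_upwards [coeFn_toLTwo φ] with x hx
  rw [hx]

lemma integral_toLp_mul (u : 𝓢(Euc d, ℂ)) (h : Euc d → ℂ) :
    ∫ x, toLTwo u x * h x = ∫ x, u x * h x := by
  refine integral_congr_ae ?_
  filter_upwards [coeFn_toLTwo u] with x hx
  rw [hx]

lemma resolvent_ellipticOp {g : Matrix (Fin d) (Fin d) ℝ} (hg : g.PosDef)
    {R : LTwo d →L[ℂ] LTwo d} (hR : ∀ (u : LTwo d) (φ : 𝓢(Euc d, ℂ)),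
      ∫ x, R u x * ellipticOp g φ x = ∫ x, u x * φ x) (u : 𝓢(Euc d, ℂ)) :
    R (toLTwo (ellipticOp g u)) = toLTwo u := by
  have h0 : star (R (toLTwo (ellipticOp g u))) - star (toLTwo u) = 0 := by
    refine (denseRange_schwartz_toLp (d := d)).eq_zero_of_inner_left ℂ fun ψ => ?_
    obtain ⟨φ, rfl⟩ := ellipticOp_surjective hg ψ
    rw [inner_sub_left, inner_star_toLp, inner_star_toLp, hR, sub_eq_zero, integral_toLp_mul,
      integral_toLp_mul, integral_ellipticOp_mul_comm]
  exact star_injective (sub_eq_zero.1 h0)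

end Assembly

section Assembly

open FourierTransform SchwartzMap
open scoped RealInnerProductSpace ComplexConjugate

variable {d : ℕ}

lemma quasiMeasurePreserving_smul_euc {ε : ℝ} (hε : ε ≠ 0) :
    Measure.QuasiMeasurePreserving (fun x : Euc d => ε • x) volume volume := by
  refine ⟨by fun_prop, ?_⟩
  rw [Measure.map_addHaar_smul _ hε]
  exact Measure.smul_absolutelyContinuous

lemma norm_le_of_enorm_sq_le {D : ℂ} {ε f H q B k : ℝ} {b c I₁ I₂ : ℝ≥0∞}
    (hD : ‖D‖ₑ ^ 2 ≤ c * ENNReal.ofReal (ε ^ 2) *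
      (I₂ * ENNReal.ofReal q + I₁ * ENNReal.ofReal (B ^ 2)))
    (h₂ : I₂ ≤ b * ENNReal.ofReal (f ^ 2)) (h₁ : I₁ ≤ b * ENNReal.ofReal (f ^ 2))
    (hq : q ≤ H ^ 2) (hB₀ : 0 ≤ B) (hB : B ≤ 2 * H) (hε : 0 ≤ ε) (hf : 0 ≤ f) (hk : 0 ≤ k)
    (hck : c * b * 5 ≤ ENNReal.ofReal k) : ‖D‖ ≤ √k * ε * f * H := by
  have hH : 0 ≤ H := by linarith
  have h : ENNReal.ofReal (‖D‖ ^ 2) ≤ ENNReal.ofReal (k * ε ^ 2 * f ^ 2 * H ^ 2) := by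
    rw [ENNReal.ofReal_pow (norm_nonneg _), ofReal_norm]
    refine hD.trans ?_
    have hB2 : ENNReal.ofReal (B ^ 2) ≤ 4 * ENNReal.ofReal (H ^ 2) := by
      rw [← ENNReal.ofReal_ofNat 4, ← ENNReal.ofReal_mul (by norm_num)]
      exact ENNReal.ofReal_le_ofReal (by nlinarith)
    calc c * ENNReal.ofReal (ε ^ 2) * (I₂ * ENNReal.ofReal q + I₁ * ENNReal.ofReal (B ^ 2))
        ≤ c * ENNReal.ofReal (ε ^ 2) * (b * ENNReal.ofReal (f ^ 2) * ENNReal.ofReal (H ^ 2) +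
          b * ENNReal.ofReal (f ^ 2) * (4 * ENNReal.ofReal (H ^ 2))) :=
          mul_le_mul_right (add_le_add (mul_le_mul' h₂ (ENNReal.ofReal_le_ofReal hq))
            (mul_le_mul' h₁ hB2)) _
      _ = c * b * 5 * ENNReal.ofReal (ε ^ 2) * ENNReal.ofReal (f ^ 2) *
          ENNReal.ofReal (H ^ 2) := by ring
      _ ≤ ENNReal.ofReal k * ENNReal.ofReal (ε ^ 2) * ENNReal.ofReal (f ^ 2) *
          ENNReal.ofReal (H ^ 2) :=
          mul_le_mul_left (mul_le_mul_left (mul_le_mul_left hck _) _) _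
      _ = _ := by
          rw [ENNReal.ofReal_mul (by positivity), ENNReal.ofReal_mul (by positivity),
            ENNReal.ofReal_mul hk]
  rw [ENNReal.ofReal_le_ofReal_iff (by positivity)] at h
  refine (sq_le_sq₀ (norm_nonneg _) (by positivity)).1 (h.trans_eq ?_)
  rw [mul_pow, mul_pow, mul_pow, Real.sq_sqrt hk]

section Resolvent

variable {ρ : Measure (Euc d)} [IsProbabilityMeasure ρ] [ρ.IsNegInvariant]
  {w : Tor d → Tor d → ℝ} {wm wp : ℝ} {χ : Fin d → Tor d → ℝ} {K : ℝ}

lemma scaledOp_congr_ae {u v : Euc d → ℂ} (h : u =ᵐ[volume] v) {ε : ℝ} (hε : 0 < ε) :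
    scaledOp ρ w ε u =ᵐ[volume] scaledOp ρ w ε v := by
  have h1 : ∀ᵐ x : Euc d, u (ε • x) = v (ε • x) := (quasiMeasurePreserving_smul_euc hε.ne').ae h
  have hm : MeasurePreserving (fun p : Euc d × Euc d => p.1 - p.2) (volume.prod ρ) volume :=
    measurePreserving_sub_prod.comp Measure.measurePreserving_swap
  have h2 : ∀ᵐ x : Euc d, ∀ᵐ z ∂ρ, u (ε • (x - z)) = v (ε • (x - z)) :=
    Measure.ae_ae_of_ae_prod (hm.quasiMeasurePreserving.ae h1)
  filter_upwards [(quasiMeasurePreserving_smul_euc (d := d) (inv_ne_zero hε.ne')).ae (h1.and h2)]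
    with x hx
  simp only [scaledOp, spaceOp, nonlocalOp, hx.1]
  congr 1
  refine integral_congr_ae ?_
  filter_upwards [hx.2] with z hz
  rw [AddMonoidHom.id_apply, hz]

lemma inner_star_comm {A : LTwo d →L[ℂ] LTwo d} (hw : IsConductance w wm wp) {ε : ℝ} (hε : 0 < ε)
    (hA : ∀ u : LTwo d, A u =ᵐ[volume] scaledOp ρ w ε u) (F h : LTwo d) :
    inner ℂ (star (A F)) h = inner ℂ (star F) (A h) := by
  rw [inner_star_eq_integral, inner_star_eq_integral]
  refine (integral_congr_ae ?_).trans ((integral_scaledOp_mul_comm (ρ := ρ) hw (Lp.memLp F)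
    (Lp.memLp h) hε).trans (integral_congr_ae ?_))
  · filter_upwards [hA F] with x hx
    rw [hx]
  · filter_upwards [hA h] with x hx
    rw [hx]

lemma toLp_scaledOp {A : LTwo d →L[ℂ] LTwo d} {ε : ℝ} (hε : 0 < ε)
    (hA : ∀ u : LTwo d, A u =ᵐ[volume] scaledOp ρ w ε u) (v : 𝓢(Euc d, ℂ)) :
    A (toLTwo v) =ᵐ[volume] scaledOp ρ w ε v :=
  (hA _).trans (scaledOp_congr_ae (coeFn_toLTwo v) hε)

lemma norm_bounds_of_inner {V B : LTwo d} {q : ℝ} (hq : 0 ≤ q) (h : inner ℂ V B = (q : ℂ)) :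
    q ≤ ‖B + V‖ ^ 2 ∧ ‖B‖ ≤ 2 * ‖B + V‖ := by
  have h1 : q + ‖V‖ ^ 2 ≤ ‖V‖ * ‖B + V‖ := by
    have h2 := norm_inner_le_norm (𝕜 := ℂ) V (B + V)
    rw [inner_add_right, h, inner_self_eq_norm_sq_to_K] at h2
    refine le_trans (le_of_eq ?_) h2
    have : ((q : ℂ) + ((‖V‖ : ℝ) : ℂ) ^ 2) = ((q + ‖V‖ ^ 2 : ℝ) : ℂ) := by push_cast; rfl
    refine Eq.trans ?_ (congrArg _ this).symm
    rw [Complex.norm_real, Real.norm_of_nonneg (by positivity)]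
  have h2 := norm_nonneg V
  have h3 := norm_nonneg (B + V)
  have h4 : ‖V‖ ≤ ‖B + V‖ := by
    by_contra! h5
    nlinarith
  refine ⟨by nlinarith, ?_⟩
  have h5 := norm_sub_le (B + V) V
  rw [add_sub_cancel_right] at h5
  linarith

variable {A R R₀ : LTwo d →L[ℂ] LTwo d} {g : Matrix (Fin d) (Fin d) ℝ}

lemma inner_resolvent (hcomm : ∀ F h : LTwo d, inner ℂ (star (A F)) h = inner ℂ (star F) (A h))
    (hAR : ∀ u, A (R u) + R u = u) (f : LTwo d) (v : 𝓢(Euc d, ℂ)) :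
    inner ℂ (star (R f)) (A (toLTwo v) + toLTwo v) = ∫ x, f x * v x := by
  rw [inner_add_right, ← hcomm, inner_star_eq_integral, inner_star_eq_integral,
    ← integral_add ?_ ?_, ← inner_star_toLp, inner_star_eq_integral]
  · refine integral_congr_ae ?_
    filter_upwards [Lp.coeFn_add (A (R f)) (R f)] with x hx
    rw [hAR] at hx
    rw [hx, Pi.add_apply, add_mul]
  · exact (Lp.memLp (A (R f))).integrable_mul (Lp.memLp _)
  · exact (Lp.memLp (R f)).integrable_mul (Lp.memLp _)

lemma star_sub_lp (F h : LTwo d) : star (F - h) = star F - star h := by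
  refine Lp.ext ?_
  filter_upwards [Lp.coeFn_star (F - h), Lp.coeFn_sub F h, Lp.coeFn_sub (star F) (star h),
    Lp.coeFn_star F, Lp.coeFn_star h] with x h1 h2 h3 h4 h5
  rw [h1, h3, Pi.sub_apply, h4, h5, Pi.star_apply, h2, Pi.sub_apply, star_sub]
  rfl

lemma inner_resolvent_sub {ε : ℝ} (hε : 0 < ε) (hg : g.PosDef)
    (hA : ∀ u : LTwo d, A u =ᵐ[volume] scaledOp ρ w ε u)
    (hcomm : ∀ F h : LTwo d, inner ℂ (star (A F)) h = inner ℂ (star F) (A h))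
    (hAR : ∀ u, A (R u) + R u = u)
    (hR₀ : ∀ (u : LTwo d) (φ : 𝓢(Euc d, ℂ)),
      ∫ x, R₀ u x * ellipticOp g φ x = ∫ x, u x * φ x) (u v : 𝓢(Euc d, ℂ)) :
    inner ℂ (star ((R - R₀) (toLTwo (ellipticOp g u)))) (A (toLTwo v) + toLTwo v) =
      (∫ ξ, (𝓕 u) ξ * ((effSymbol g ξ : ℂ) * (𝓕⁻ (v : Euc d → ℂ)) ξ)) -
        ∫ x, u x * scaledOp ρ w ε v x := by
  rw [_root_.sub_apply, star_sub_lp, inner_sub_left, inner_resolvent hcomm hAR,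
    integral_toLp_mul, integral_ellipticOp_mul, resolvent_ellipticOp hg hR₀, inner_add_right,
    inner_star_toLp, integral_toLp_mul, inner_star_eq_integral, integral_toLp_mul]
  have h : ∫ x, u x * A (toLTwo v) x = ∫ x, u x * scaledOp ρ w ε v x := by
    refine integral_congr_ae ?_
    filter_upwards [toLp_scaledOp hε hA v] with x hx
    rw [hx]
  rw [h]
  ring

lemma lintegral_enorm_sq_schwartz (u : 𝓢(Euc d, ℂ)) :
    ∫⁻ x, ‖u x‖ₑ ^ 2 = ENNReal.ofReal (‖toLTwo u‖ ^ 2) := by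
  rw [← lintegral_enorm_sq_lp]
  refine lintegral_congr_ae ?_
  filter_upwards [coeFn_toLTwo u] with x hx
  rw [hx]

/-- Resolvent estimate for the operators with `ε`-periodic conductance. -/
theorem IsCorrector.exists_norm_resolvent_sub_le (hχ : IsCorrector ρ w χ K)
    (hw : IsConductance w wm wp) (hac : ρ ≪ volume)
    (hM1 : Integrable (fun z : Euc d => ‖z‖ ^ 1) ρ)
    (hM2 : Integrable (fun z : Euc d => ‖z‖ ^ 2) ρ)
    (hM3 : Integrable (fun z : Euc d => ‖z‖ ^ 3) ρ) (hg : (effMatrix ρ w χ).PosDef) :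
    ∃ C : ℝ, 0 < C ∧ ∀ ε : ℝ, 0 < ε → ∀ A R R₀ : LTwo d →L[ℂ] LTwo d,
      (∀ u : LTwo d, A u =ᵐ[volume] scaledOp ρ w ε u) → (∀ u, A (R u) + R u = u) →
      (∀ (u : LTwo d) (φ : 𝓢(Euc d, ℂ)),
        ∫ x, R₀ u x * ellipticOp (effMatrix ρ w χ) φ x = ∫ x, u x * φ x) →
      ‖R - R₀‖ ≤ C * ε := by
  obtain ⟨c₁, hc₁, hge⟩ := hχ.exists_effSymbol_ge hw hac hM2
  obtain ⟨b, hb, hell⟩ := lintegral_fourier_le_ellipticOp hc₁ hge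
  obtain ⟨c, hc, hcore⟩ := hχ.exists_integral_scaledOp_sub_le hw hac hM1 hM2 hM3
  set k : ℝ := (c * b).toReal * 5 + 1 with hk'
  have hk : 0 < k := by positivity
  have hck : c * b * 5 ≤ ENNReal.ofReal k := by
    rw [hk', ENNReal.ofReal_add (by positivity) zero_le_one, ENNReal.ofReal_mul (by positivity),
      ENNReal.ofReal_toReal (by finiteness), ENNReal.ofReal_ofNat]
    exact le_self_add
  refine ⟨√k, by positivity, fun ε hε A R R₀ hA hAR hR₀ => ?_⟩
  set g := effMatrix ρ w χ
  have main (u v : 𝓢(Euc d, ℂ)) :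
      ‖inner ℂ (star ((R - R₀) (toLTwo (ellipticOp g u)))) (A (toLTwo v) + toLTwo v)‖ ≤
        √k * ε * ‖toLTwo (ellipticOp g u)‖ * ‖A (toLTwo v) + toLTwo v‖ := by
    rw [inner_resolvent_sub hε hg hA (inner_star_comm hw hε hA) hAR hR₀]
    have hAv := toLp_scaledOp hε hA v
    obtain ⟨q, hq, hq1, hD⟩ := hcore ε hε u v
    have hinner : inner ℂ (toLTwo v) (A (toLTwo v)) = (q : ℂ) := by
      rw [L2.inner_def, ← hq1]
      refine integral_congr_ae ?_
      filter_upwards [hAv, coeFn_toLTwo v] with x hx hx'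
      rw [hx, hx']
      simp
    obtain ⟨hb1, hb2⟩ := norm_bounds_of_inner hq hinner
    have hS : ∫⁻ x, ‖scaledOp ρ w ε v x‖ₑ ^ 2 = ENNReal.ofReal (‖A (toLTwo v)‖ ^ 2) := by
      rw [← lintegral_enorm_sq_lp]
      refine lintegral_congr_ae ?_
      filter_upwards [hAv] with x hx
      rw [hx]
    obtain ⟨hl2, hl1⟩ := hell u
    rw [lintegral_enorm_sq_schwartz] at hl1 hl2
    rw [hS] at hD
    exact norm_le_of_enorm_sq_le hD hl2 hl1 hb1 (norm_nonneg _) hb2 hε.le (norm_nonneg _) hk.le hck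
  have hdense1 : DenseRange fun v : 𝓢(Euc d, ℂ) => A (toLTwo v) + toLTwo v := by
    have h1 : Function.Surjective fun F : LTwo d => A F + F := fun F => ⟨R F, hAR F⟩
    exact h1.denseRange.comp denseRange_schwartz_toLp (by fun_prop)
  have hdense2 : DenseRange fun u : 𝓢(Euc d, ℂ) => toLTwo (ellipticOp g u) :=
    (denseRange_schwartz_toLp (d := d)).comp (ellipticOp_surjective hg).denseRange
      continuous_toLTwo
  refine ContinuousLinearMap.opNorm_le_bound _ (by positivity) fun F => ?_
  refine hdense2.induction_on F (isClosed_le (by fun_prop) (by fun_prop)) fun u => ?_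
  exact norm_le_of_inner_star_le (by positivity) hdense1 (main u)

end Resolvent

end Assembly

section Normalization

variable {d : ℕ}

/-- The probability measure with density proportional to the kernel `a`. -/
def kernelMeasure (a : Euc d → ℝ) : Measure (Euc d) :=
  volume.withDensity fun z => ENNReal.ofReal (a z / ∫ x, a x)

/-- The periodic coefficient clipped to `[μm, μp]`, scaled by the mass of `a`, on the torus. -/
def torusCond (a : Euc d → ℝ) (μf : Euc d → Euc d → ℝ) (μm μp : ℝ) (X Y : Tor d) : ℝ :=
  (∫ x, a x) * max μm (min (μf (sec X) (sec Y)) μp)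

/-- A kernel that is measurable, nonnegative and even everywhere, with positive mass. -/
structure IsKernel (a : Euc d → ℝ) : Prop where
  measurable : Measurable a
  nonneg : ∀ x, 0 ≤ a x
  even : ∀ x, a (-x) = a x
  integrable : Integrable a
  pos : 0 < ∫ x, a x

lemma exists_isKernel {a : Euc d → ℝ} (ha_int : Integrable a) (ha_nn : ∀ᵐ x : Euc d, 0 ≤ a x)
    (ha_even : ∀ x : Euc d, a (-x) = a x) (ha_supp : 0 < volume {x : Euc d | a x ≠ 0}) :
    ∃ a' : Euc d → ℝ, IsKernel a' ∧ a' =ᵐ[volume] a := by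
  set b := ha_int.1.mk a
  have hb : Measurable b := ha_int.1.stronglyMeasurable_mk.measurable
  have hab : b =ᵐ[volume] a := ha_int.1.ae_eq_mk.symm
  have hae : (fun x => max 0 ((b x + b (-x)) / 2)) =ᵐ[volume] a := by
    filter_upwards [hab, (Measure.measurePreserving_neg
      (volume : Measure (Euc d))).quasiMeasurePreserving.ae hab, ha_nn] with x h1 h2 h3
    rw [h1, h2, ha_even, add_self_div_two, max_eq_right h3]
  refine ⟨_, ⟨by fun_prop, fun x => le_max_left _ _, fun x => ?_, ha_int.congr hae.symm, ?_⟩, hae⟩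
  · rw [neg_neg, add_comm]
  · rw [integral_congr_ae hae, integral_pos_iff_support_of_nonneg_ae ha_nn ha_int]
    exact ha_supp

namespace IsKernel

variable {a : Euc d → ℝ}

lemma div_nonneg (ha : IsKernel a) (z : Euc d) : 0 ≤ a z / ∫ x, a x :=
  _root_.div_nonneg (ha.nonneg z) ha.pos.le

lemma isProbabilityMeasure (ha : IsKernel a) : IsProbabilityMeasure (kernelMeasure a) := by
  refine ⟨?_⟩
  rw [kernelMeasure, withDensity_apply _ .univ, setLIntegral_univ,
    ← ofReal_integral_eq_lintegral_ofReal (ha.integrable.div_const _)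
      (.of_forall ha.div_nonneg), integral_div, div_self ha.pos.ne', ENNReal.ofReal_one]

lemma isNegInvariant (ha : IsKernel a) : (kernelMeasure a).IsNegInvariant := by
  refine ⟨Measure.ext fun s hs => ?_⟩
  have hm := ha.measurable
  rw [Measure.neg_def, Measure.map_apply measurable_neg hs, kernelMeasure, withDensity_apply _ hs,
    withDensity_apply _ (measurable_neg hs), ← lintegral_indicator hs,
    ← lintegral_indicator (measurable_neg hs), ← lintegral_neg_eq_self (μ := volume)]
  refine lintegral_congr fun z => ?_
  by_cases hz : z ∈ s <;> simp [hz, ha.even]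

lemma absolutelyContinuous : kernelMeasure a ≪ volume :=
  withDensity_absolutelyContinuous _ _

lemma integral_kernelMeasure (ha : IsKernel a) (F : Euc d → ℂ) :
    ∫ z, F z ∂(kernelMeasure a) = ∫ z, (a z / ∫ x, a x) • F z := by
  have hm := ha.measurable
  rw [kernelMeasure, integral_withDensity_eq_integral_toReal_smul (by fun_prop)
    (.of_forall fun _ => ENNReal.ofReal_lt_top)]
  simp only [ENNReal.toReal_ofReal (ha.div_nonneg _)]

lemma integrable_kernelMeasure (ha : IsKernel a) {F : Euc d → ℝ}
    (hF : Integrable fun z => F z * a z) : Integrable F (kernelMeasure a) := by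
  have hm := ha.measurable
  rw [kernelMeasure, integrable_withDensity_iff (by fun_prop)
    (.of_forall fun _ => ENNReal.ofReal_lt_top)]
  simp only [ENNReal.toReal_ofReal (ha.div_nonneg _), ← mul_div_assoc]
  exact hF.div_const _

variable {μf : Euc d → Euc d → ℝ} {μm μp : ℝ}

lemma isConductance (ha : IsKernel a) (hμ_meas : Measurable (Function.uncurry μf))
    (hμ_symm : ∀ x y : Euc d, μf x y = μf y x) (hμm : 0 < μm) (hle : μm ≤ μp) :
    IsConductance (torusCond a μf μm μp) ((∫ x, a x) * μm) ((∫ x, a x) * μp) where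
  measurable := by
    have h : Measurable fun p : Tor d × Tor d => μf (sec p.1) (sec p.2) :=
      hμ_meas.comp ((measurable_sec.comp measurable_fst).prodMk
        (measurable_sec.comp measurable_snd))
    exact ((measurable_const.max (h.min measurable_const))).const_mul _
  symm x y := by rw [torusCond, torusCond, hμ_symm]
  lower x y := mul_le_mul_of_nonneg_left (le_max_left _ _) ha.pos.le
  upper x y := mul_le_mul_of_nonneg_left (max_le hle (min_le_right _ _)) ha.pos.le
  pos := mul_pos ha.pos hμm

end IsKernel

lemma liftCond_torusCond {a : Euc d → ℝ} {μf : Euc d → Euc d → ℝ} {μm μp : ℝ}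
    (hμ_per : ∀ (x y : Euc d) (m n : Fin d → ℤ), μf (x + intVec m) (y + intVec n) = μf x y)
    (x y : Euc d) :
    liftCond (torusCond a μf μm μp) x y = (∫ x, a x) * max μm (min (μf x y) μp) := by
  obtain ⟨m, hm⟩ := exists_intVec_of_toTor_eq (toTor_sec (toTor x))
  obtain ⟨n, hn⟩ := exists_intVec_of_toTor_eq (toTor_sec (toTor y))
  rw [liftCond, torusCond, hm, hn, hμ_per]

lemma IsKernel.scaledOp_ae_eq {a a' : Euc d → ℝ} (ha : IsKernel a') (haa : a' =ᵐ[volume] a)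
    {μf : Euc d → Euc d → ℝ} {μm μp : ℝ}
    (hμ_per : ∀ (x y : Euc d) (m n : Fin d → ℤ), μf (x + intVec m) (y + intVec n) = μf x y)
    (hμ_bdd : ∀ᵐ p : Euc d × Euc d, μm ≤ μf p.1 p.2 ∧ μf p.1 p.2 ≤ μp) {ε : ℝ} (hε : 0 < ε)
    (u : Euc d → ℂ) :
    (fun x => ((ε ^ (d + 2))⁻¹ : ℝ) • ∫ y : Euc d,
      ((a (ε⁻¹ • (x - y)) * μf (ε⁻¹ • x) (ε⁻¹ • y) : ℝ) : ℂ) * (u x - u y)) =ᵐ[volume]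
    scaledOp (kernelMeasure a') (torusCond a' μf μm μp) ε u := by
  have hε' := hε.ne'
  have h1 : ∀ᵐ x : Euc d, ∀ᵐ y : Euc d, μm ≤ μf x y ∧ μf x y ≤ μp :=
    Measure.ae_ae_of_ae_prod hμ_bdd
  filter_upwards [(quasiMeasurePreserving_smul_euc (inv_ne_zero hε')).ae h1] with x hx
  rw [scaledOp, spaceOp, nonlocalOp, ha.integral_kernelMeasure, pow_add, mul_comm (ε ^ d),
    mul_inv, mul_smul, ← integral_comp_smul_euc _ hε,
    ← integral_sub_left_eq_self (μ := volume) _ (ε⁻¹ • x)]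
  congr 1
  refine integral_congr_ae ?_
  filter_upwards [(Measure.measurePreserving_sub_left (volume : Measure (Euc d))
    (ε⁻¹ • x)).quasiMeasurePreserving.ae hx, haa] with z h2 h3
  simp only [AddMonoidHom.id_apply, liftCond_torusCond hμ_per, min_eq_left h2.2, max_eq_right h2.1,
    smul_inv_smul₀ hε', inv_smul_smul₀ hε', smul_sub, sub_sub_cancel, smul_smul, h3]
  rw [← mul_assoc, div_mul_cancel₀ _ ha.pos.ne', Complex.real_smul, Complex.real_smul, mul_sub]

end Normalization

end NonlocalHomogenization

/-- Homogenization of nonlocal convolution-type operators: there exist a symmetric positive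
definite effective matrix `g⁰` and a constant `C > 0` (depending only on `a`, `μ`, `d`) such that
for every `ε > 0`, if `Aε` is the bounded operator on `L²(ℝ^d;ℂ)` given by
`(Aε u)(x) = ε^{-d-2} ∫ a((x-y)/ε) μ(x/ε,y/ε) (u(x)-u(y)) dy`, `Rε` is its resolvent
`(Aε + I)⁻¹`, and `R0 = (𝔸⁰ + I)⁻¹` is the resolvent of the effective operator
`𝔸⁰ = -div g⁰∇` (characterized weakly against Schwartz functions), then
`‖Rε - R0‖ ≤ C ε`. -/
theorem stmt0 {d : ℕ} (hd : 1 ≤ d)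
    (a : Euc d → ℝ) (μf : Euc d → Euc d → ℝ) (μm μp : ℝ)
    (ha_int : Integrable a)
    (ha_nn : ∀ᵐ x : Euc d, 0 ≤ a x)
    (ha_even : ∀ x : Euc d, a (-x) = a x)
    (ha_supp : 0 < volume {x : Euc d | a x ≠ 0})
    (hμ_meas : Measurable (Function.uncurry μf))
    (hμ_symm : ∀ x y : Euc d, μf x y = μf y x)
    (hμ_per : ∀ (x y : Euc d) (m n : Fin d → ℤ), μf (x + intVec m) (y + intVec n) = μf x y)
    (hμm : 0 < μm)
    (hμ_bdd : ∀ᵐ p : Euc d × Euc d, μm ≤ μf p.1 p.2 ∧ μf p.1 p.2 ≤ μp)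
    (hM1 : Integrable fun x : Euc d => ‖x‖ ^ 1 * a x)
    (hM2 : Integrable fun x : Euc d => ‖x‖ ^ 2 * a x)
    (hM3 : Integrable fun x : Euc d => ‖x‖ ^ 3 * a x) :
    ∃ (g : Matrix (Fin d) (Fin d) ℝ) (C : ℝ),
      g.IsSymm ∧ g.PosDef ∧ 0 < C ∧
      ∀ ε : ℝ, 0 < ε →
        ∀ Aε Rε R0 : Lp ℂ 2 (volume : Measure (Euc d)) →L[ℂ] Lp ℂ 2 (volume : Measure (Euc d)),
          -- `Aε` acts by the rescaled nonlocal convolution-type formula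
          (∀ u : Lp ℂ 2 (volume : Measure (Euc d)), ∀ᵐ x : Euc d,
              Aε u x = ((ε ^ (d + 2))⁻¹ : ℝ) •
                ∫ y : Euc d,
                  ((a (ε⁻¹ • (x - y)) * μf (ε⁻¹ • x) (ε⁻¹ • y) : ℝ) : ℂ) * (u x - u y)) →
          -- `Rε` is the resolvent `(Aε + I)⁻¹`
          (∀ u, Rε (Aε u + u) = u) →
          (∀ u, Aε (Rε u) + Rε u = u) →
          -- `R0` is the resolvent of the effective operator `-div g∇ + I`,
          -- characterized weakly against Schwartz test functions
          (∀ (u : Lp ℂ 2 (volume : Measure (Euc d))) (φ : SchwartzMap (Euc d) ℂ),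
              (∫ x : Euc d, R0 u x *
                ((φ : Euc d → ℂ) x - ∑ i, ∑ j, (g i j : ℂ) *
                  iteratedFDeriv ℝ 2 (φ : Euc d → ℂ) x
                    ![EuclideanSpace.single i 1, EuclideanSpace.single j 1]))
                = ∫ x : Euc d, u x * (φ : Euc d → ℂ) x) →
          ‖Rε - R0‖ ≤ C * ε := by
  obtain ⟨a', ha, haa⟩ :=
    NonlocalHomogenization.exists_isKernel ha_int ha_nn ha_even ha_supp
  have hle : μm ≤ μp := by
    obtain ⟨p, hp⟩ := hμ_bdd.exists
    exact hp.1.trans hp.2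
  have hmoment (k : ℕ) (h : Integrable fun x : Euc d => ‖x‖ ^ k * a x) :
      Integrable (fun x : Euc d => ‖x‖ ^ k) (NonlocalHomogenization.kernelMeasure a') := by
    refine ha.integrable_kernelMeasure (h.congr ?_)
    filter_upwards [haa] with x hx
    rw [hx]
  have := ha.isProbabilityMeasure
  have := ha.isNegInvariant
  have hac := NonlocalHomogenization.IsKernel.absolutelyContinuous (a := a')
  have hw := ha.isConductance hμ_meas hμ_symm hμm hle
  obtain ⟨χ, K, hχ⟩ := NonlocalHomogenization.exists_isCorrector hw hac (hmoment 2 hM2)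
  have hsymm := NonlocalHomogenization.effMatrix_isSymm
    (ρ := NonlocalHomogenization.kernelMeasure a')
    (w := NonlocalHomogenization.torusCond a' μf μm μp) (χ := χ)
  obtain ⟨c, hc, hge⟩ := hχ.exists_effSymbol_ge hw hac (hmoment 2 hM2)
  have hpos := NonlocalHomogenization.posDef_of_effSymbol_ge hsymm hc hge
  obtain ⟨C, hC, h⟩ := hχ.exists_norm_resolvent_sub_le hw hac (hmoment 1 hM1) (hmoment 2 hM2)
    (hmoment 3 hM3) hpos
  refine ⟨_, C, hsymm, hpos, hC, fun ε hε Aε Rε R0 hA _ hR hR0 => h ε hε Aε Rε R0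
    (fun u => Filter.EventuallyEq.trans (hA u) (ha.scaledOp_ae_eq haa hμ_per hμ_bdd hε u)) hR
    fun u φ => ?_⟩
  simp only [NonlocalHomogenization.ellipticOp_apply]
  exact hR0 u φ
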